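/- arXiv:2603.17005 — 6 statements merged into one kernel-verified Lean document; each statement's English description precedes it below -/
import Mathlib

section
/- Non-negativity and finiteness of the doubly minimized Petz Rényi lautum information (Theorem 1(b)): Let A and B be nonempty finite types, α ∈ (0,1), and ρ_AB a bipartite state on A × B. Then 0 ≤ L_α^↓↓(A:B)_ρ and L_α^↓↓(A:B)_ρ < +∞. In particular, D_α(σ_A ⊗ τ_B ‖ ρ_AB) ≥ 0 for all states σ_A on A and τ_B on B, and there exist states σ_A, τ_B with D_α(σ_A ⊗ τ_B ‖ ρ_AB) < +∞. -/
open scoped BigOperators Kronecker ComplexOrder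

noncomputable section

/-- Matrix power on the support via spectral decomposition (convention `0 ^ p = 0`);
junk value `0` for non-Hermitian matrices. -/
noncomputable def mpow {A : Type*} [Fintype A] [DecidableEq A] (X : Matrix A A ℂ) (p : ℝ) :
    Matrix A A ℂ :=
  if h : X.IsHermitian then
    (h.eigenvectorUnitary : Matrix A A ℂ) *
      Matrix.diagonal (fun i =>
        ((if h.eigenvalues i = 0 then (0 : ℝ) else (h.eigenvalues i) ^ p : ℝ) : ℂ)) *
      (star (h.eigenvectorUnitary : Matrix A A ℂ))
  else 0

/-- Matrix logarithm via spectral decomposition (`Real.log 0 = 0`); junk value `0`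
for non-Hermitian matrices. -/
noncomputable def mlog {A : Type*} [Fintype A] [DecidableEq A] (X : Matrix A A ℂ) :
    Matrix A A ℂ :=
  if h : X.IsHermitian then
    (h.eigenvectorUnitary : Matrix A A ℂ) *
      Matrix.diagonal (fun i => ((Real.log (h.eigenvalues i) : ℝ) : ℂ)) *
      (star (h.eigenvectorUnitary : Matrix A A ℂ))
  else 0

/-- A quantum state: a positive semidefinite matrix with unit trace. -/
structure MState (A : Type*) [Fintype A] [DecidableEq A] where
  mat : Matrix A A ℂ
  posSemidef : mat.PosSemidef
  trace_one : mat.trace = 1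

/-- `Q_α(ρ‖σ) = Tr[ρ^α σ^(1-α)]`. -/
noncomputable def QRenyi {A : Type*} [Fintype A] [DecidableEq A] (α : ℝ)
    (ρ σ : Matrix A A ℂ) : ℝ :=
  ((mpow ρ α * mpow σ (1 - α)).trace).re

/-- Petz Rényi divergence `D_α(ρ‖σ)`, valued in `(-∞,∞]`. -/
noncomputable def DRenyi {A : Type*} [Fintype A] [DecidableEq A] (α : ℝ)
    (ρ σ : Matrix A A ℂ) : EReal :=
  if QRenyi α ρ σ = 0 then ⊤ else (((α - 1)⁻¹ * Real.log (QRenyi α ρ σ) : ℝ) : EReal)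

-- Quantum relative entropy `D(ρ‖σ)`, valued in `(-∞,∞]`.
open Classical in
noncomputable def relEnt {A : Type*} [Fintype A] [DecidableEq A] (ρ σ : Matrix A A ℂ) : EReal :=
  if LinearMap.ker (Matrix.toLin' σ) ≤ LinearMap.ker (Matrix.toLin' ρ) then
    (((ρ * (mlog ρ - mlog σ)).trace).re : EReal)
  else ⊤

/-- Doubly minimized Petz Rényi lautum information. -/
noncomputable def Ldd {A B : Type*} [Fintype A] [DecidableEq A] [Fintype B] [DecidableEq B]
    (α : ℝ) (ρ : Matrix (A × B) (A × B) ℂ) : EReal :=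
  ⨅ (σ : MState A) (τ : MState B), DRenyi α (σ.mat ⊗ₖ τ.mat) ρ

/-- Tumula information. -/
noncomputable def Tum {A B : Type*} [Fintype A] [DecidableEq A] [Fintype B] [DecidableEq B]
    (ρ : Matrix (A × B) (A × B) ℂ) : EReal :=
  ⨅ (σ : MState A) (τ : MState B), relEnt (σ.mat ⊗ₖ τ.mat) ρ

/-- Partial trace over the first factor. -/
noncomputable def ptrA {A B : Type*} [Fintype A] (M : Matrix (A × B) (A × B) ℂ) :
    Matrix B B ℂ :=
  Matrix.of fun b b' => ∑ a, M (a, b) (a, b')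

/-- Partial trace over the second factor. -/
noncomputable def ptrB {A B : Type*} [Fintype B] (M : Matrix (A × B) (A × B) ℂ) :
    Matrix A A ℂ :=
  Matrix.of fun a a' => ∑ b, M (a, b) (a', b)


open Matrix in
theorem trace_aux {n : Type*} [Fintype n] [DecidableEq n] (U V : Matrix n n ℂ) (a b : n → ℝ) :
    ((U * diagonal (fun i => (a i : ℂ)) * star U) * (V * diagonal (fun i => (b i : ℂ)) * star V)).trace.re
      = ∑ i, ∑ j, a i * b j * Complex.normSq ((star U * V) i j) := by
  have h : ((U * diagonal (fun i => (a i : ℂ)) * star U) * (V * diagonal (fun i => (b i : ℂ)) * star V)).trace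
      = (diagonal (fun i => (a i : ℂ)) * (star U * V) * diagonal (fun i => (b i : ℂ)) * star (star U * V)).trace := by
    rw [star_mul, star_star]
    simp only [Matrix.mul_assoc]
    rw [Matrix.trace_mul_comm U]
    simp only [Matrix.mul_assoc]
  rw [h]
  generalize star U * V = W
  simp only [Matrix.trace, Matrix.diag_apply, Complex.re_sum]
  refine Finset.sum_congr rfl fun i _ => ?_
  rw [Matrix.mul_apply, Complex.re_sum]
  refine Finset.sum_congr rfl fun j _ => ?_
  rw [Matrix.mul_diagonal, Matrix.diagonal_mul, Matrix.star_apply]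
  simp only [RCLike.star_def]
  have : (a i : ℂ) * W i j * (b j : ℂ) * (starRingEnd ℂ) (W i j)
      = ((a i * b j * Complex.normSq (W i j) : ℝ) : ℂ) := by
    push_cast
    rw [← Complex.mul_conj]; ring
  rw [this, Complex.ofReal_re]

theorem row_aux {n : Type*} [Fintype n] [DecidableEq n] (W : Matrix n n ℂ) (h : W * star W = 1) (i : n) :
    ∑ j, Complex.normSq (W i j) = 1 := by
  have := congrFun (congrFun h i) i
  rw [Matrix.mul_apply, Matrix.one_apply_eq] at this
  simp only [Matrix.star_apply, RCLike.star_def, Complex.mul_conj] at this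
  exact_mod_cast this

theorem col_aux {n : Type*} [Fintype n] [DecidableEq n] (W : Matrix n n ℂ) (h : star W * W = 1) (j : n) :
    ∑ i, Complex.normSq (W i j) = 1 := by
  have := row_aux (star W) (by rwa [star_star]) j
  simpa [Matrix.star_apply] using this

/-- Nussbaum-Szkola form of the Renyi quantity. -/
theorem Q_form {n : Type*} [Fintype n] [DecidableEq n] (α : ℝ) (hα : α ∈ Set.Ioo (0 : ℝ) 1)
    (ρ σ : Matrix n n ℂ) (hρ : ρ.IsHermitian) (hσ : σ.IsHermitian) :
    ∃ w : n → n → ℝ, (∀ i j, 0 ≤ w i j) ∧ (∀ i, ∑ j, w i j = 1) ∧ (∀ j, ∑ i, w i j = 1) ∧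
      QRenyi α ρ σ = ∑ i, ∑ j, hρ.eigenvalues i ^ α * hσ.eigenvalues j ^ (1 - α) * w i j := by
  have h1 : ∀ x p : ℝ, p ≠ 0 → (if x = 0 then (0 : ℝ) else x ^ p) = x ^ p := by
    intro x p hp
    split_ifs with hx
    · rw [hx, Real.zero_rpow hp]
    · rfl
  have hU := Unitary.mem_iff.1 hρ.eigenvectorUnitary.2
  have hV := Unitary.mem_iff.1 hσ.eigenvectorUnitary.2
  refine ⟨fun i j => Complex.normSq ((star (hρ.eigenvectorUnitary : Matrix n n ℂ) *
    (hσ.eigenvectorUnitary : Matrix n n ℂ)) i j), fun i j => Complex.normSq_nonneg _,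
    row_aux _ ?_, col_aux _ ?_, ?_⟩
  · rw [star_mul, star_star, Matrix.mul_assoc, ← Matrix.mul_assoc _ (star _), hV.2, Matrix.one_mul, hU.1]
  · rw [star_mul, star_star, Matrix.mul_assoc, ← Matrix.mul_assoc _ (star _), hU.2, Matrix.one_mul, hV.1]
  · rw [QRenyi, mpow, mpow, dif_pos hρ, dif_pos hσ, trace_aux]
    simp only [h1 _ _ hα.1.ne', h1 _ _ (sub_pos.2 hα.2).ne']

theorem sum_eig {n : Type*} [Fintype n] [DecidableEq n] (ρ : Matrix n n ℂ) (hρ : ρ.IsHermitian)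
    (ht : ρ.trace = 1) : ∑ i, hρ.eigenvalues i = 1 := by
  have := hρ.trace_eq_sum_eigenvalues
  rw [ht] at this
  simp only [Complex.coe_algebraMap] at this
  exact_mod_cast this.symm

theorem Q_bounds {n : Type*} [Fintype n] [DecidableEq n] (α : ℝ) (hα : α ∈ Set.Ioo (0 : ℝ) 1)
    (ρ σ : Matrix n n ℂ) (hρ : ρ.PosSemidef) (hσ : σ.PosSemidef) (hρt : ρ.trace = 1)
    (hσt : σ.trace = 1) : 0 ≤ QRenyi α ρ σ ∧ QRenyi α ρ σ ≤ 1 := by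
  obtain ⟨w, hw, hr, hc, hQ⟩ := Q_form α hα ρ σ hρ.1 hσ.1
  rw [hQ]
  have hl := hρ.eigenvalues_nonneg
  have hm := hσ.eigenvalues_nonneg
  refine ⟨Finset.sum_nonneg fun i _ => Finset.sum_nonneg fun j _ => mul_nonneg (mul_nonneg
    (Real.rpow_nonneg (hl i) _) (Real.rpow_nonneg (hm j) _)) (hw i j), ?_⟩
  calc _ ≤ ∑ i, ∑ j, (α * hρ.1.eigenvalues i + (1 - α) * hσ.1.eigenvalues j) * w i j := by
        refine Finset.sum_le_sum fun i _ => Finset.sum_le_sum fun j _ =>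
          mul_le_mul_of_nonneg_right ?_ (hw i j)
        exact Real.geom_mean_le_arith_mean2_weighted hα.1.le (sub_pos.2 hα.2).le (hl i) (hm j)
          (by ring)
    _ = α * ∑ i, hρ.1.eigenvalues i * ∑ j, w i j + (1 - α) * ∑ j, hσ.1.eigenvalues j * ∑ i, w i j := by
        simp only [add_mul, Finset.sum_add_distrib, Finset.mul_sum]
        congr 1
        · simp only [mul_assoc]
        · rw [Finset.sum_comm]
          simp only [mul_assoc]
    _ = 1 := by
        simp only [hr, hc, mul_one, sum_eig ρ hρ.1 hρt, sum_eig σ hσ.1 hσt]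
        ring

theorem Q_ne_zero {n : Type*} [Fintype n] [DecidableEq n] (α : ℝ) (hα : α ∈ Set.Ioo (0 : ℝ) 1)
    (ρ σ : Matrix n n ℂ) (hρ : ρ.PosDef) (hσ : σ.PosSemidef)
    (hσt : σ.trace = 1) : QRenyi α ρ σ ≠ 0 := by
  obtain ⟨w, hw, hr, hc, hQ⟩ := Q_form α hα ρ σ hρ.1 hσ.1
  have hl : ∀ i, 0 < hρ.1.eigenvalues i := hρ.eigenvalues_pos
  have hm := hσ.eigenvalues_nonneg
  rw [hQ]
  intro h0
  have hnn : ∀ i j, 0 ≤ hρ.1.eigenvalues i ^ α * hσ.1.eigenvalues j ^ (1 - α) * w i j :=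
    fun i j => mul_nonneg (mul_nonneg
    (Real.rpow_nonneg (hl i).le _) (Real.rpow_nonneg (hm j) _)) (hw i j)
  have hz : ∀ i j, hσ.1.eigenvalues j * w i j = 0 := by
    intro i j
    have h1 := (Finset.sum_eq_zero_iff_of_nonneg
      (fun i _ => Finset.sum_nonneg fun j _ => hnn i j)).1 h0 i (Finset.mem_univ _)
    have h2 := (Finset.sum_eq_zero_iff_of_nonneg (fun j _ => hnn i j)).1 h1 j (Finset.mem_univ _)
    rcases mul_eq_zero.1 h2 with h3 | h3
    · rcases mul_eq_zero.1 h3 with h4 | h4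
      · exact absurd h4 (Real.rpow_pos_of_pos (hl i) _).ne'
      · rw [((Real.rpow_eq_zero_iff_of_nonneg (hm j)).1 h4).1, zero_mul]
    · rw [h3, mul_zero]
  have h1 := sum_eig σ hσ.1 hσt
  have : ∀ j, hσ.1.eigenvalues j = 0 := fun j => by
    rw [← mul_one (hσ.1.eigenvalues j), ← hc j, Finset.mul_sum]
    exact Finset.sum_eq_zero fun i _ => hz i j
  simp [this] at h1

theorem D_nonneg {n : Type*} [Fintype n] [DecidableEq n] (α : ℝ) (hα : α ∈ Set.Ioo (0 : ℝ) 1)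
    (ρ σ : Matrix n n ℂ) (hρ : ρ.PosSemidef) (hσ : σ.PosSemidef) (hρt : ρ.trace = 1)
    (hσt : σ.trace = 1) : (0 : EReal) ≤ DRenyi α ρ σ := by
  obtain ⟨h0, h1⟩ := Q_bounds α hα ρ σ hρ hσ hρt hσt
  rw [DRenyi]
  split_ifs with h
  · exact le_top
  · exact_mod_cast mul_nonneg_of_nonpos_of_nonpos (inv_nonpos.2 (by linarith [hα.2]))
      (Real.log_nonpos h0 h1)

theorem maxmixed (n : Type*) [Fintype n] [DecidableEq n] [Nonempty n] :
    ∃ σ : MState n, σ.mat.PosDef := by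
  have hc : (0 : ℂ) < (Fintype.card n : ℂ)⁻¹ := by
    rw [← Complex.ofReal_natCast, ← Complex.ofReal_inv]
    exact_mod_cast inv_pos.2 (Nat.cast_pos.2 Fintype.card_pos)
  have hp : ((Fintype.card n : ℂ)⁻¹ • (1 : Matrix n n ℂ)).PosDef := Matrix.PosDef.one.smul hc
  refine ⟨⟨_, hp.posSemidef, ?_⟩, hp⟩
  rw [Matrix.trace_smul, Matrix.trace_one, smul_eq_mul]
  exact inv_mul_cancel₀ (by exact_mod_cast Fintype.card_ne_zero)

/-- Non-negativity and finiteness of the doubly minimized Petz Rényi lautum information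
(Theorem 1(b)). -/
theorem Ldd_nonneg_and_finite {A B : Type*} [Fintype A] [DecidableEq A] [Nonempty A]
    [Fintype B] [DecidableEq B] [Nonempty B]
    (α : ℝ) (hα : α ∈ Set.Ioo (0 : ℝ) 1) (ρ : MState (A × B)) :
    (0 : EReal) ≤ Ldd α ρ.mat ∧ Ldd α ρ.mat < ⊤ ∧
      (∀ (σ : MState A) (τ : MState B), (0 : EReal) ≤ DRenyi α (σ.mat ⊗ₖ τ.mat) ρ.mat) ∧
      (∃ (σ : MState A) (τ : MState B), DRenyi α (σ.mat ⊗ₖ τ.mat) ρ.mat < ⊤) := by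
  have h1 : ∀ (σ : MState A) (τ : MState B), (0 : EReal) ≤ DRenyi α (σ.mat ⊗ₖ τ.mat) ρ.mat :=
    fun σ τ => D_nonneg α hα _ _ (σ.posSemidef.kronecker τ.posSemidef) ρ.posSemidef
      (by rw [Matrix.trace_kronecker, σ.trace_one, τ.trace_one, mul_one]) ρ.trace_one
  obtain ⟨σ, hσ⟩ := maxmixed A
  obtain ⟨τ, hτ⟩ := maxmixed B
  have h2 : DRenyi α (σ.mat ⊗ₖ τ.mat) ρ.mat < ⊤ := by
    rw [DRenyi, if_neg (Q_ne_zero α hα _ _ (hσ.kronecker hτ) ρ.posSemidef ρ.trace_one)]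
    exact EReal.coe_lt_top _
  refine ⟨le_iInf fun σ => le_iInf fun τ => h1 σ τ, ?_, h1, σ, τ, h2⟩
  have h3 : Ldd α ρ.mat ≤ DRenyi α (σ.mat ⊗ₖ τ.mat) ρ.mat :=
    (iInf_le (fun σ : MState A => ⨅ τ : MState B, DRenyi α (σ.mat ⊗ₖ τ.mat) ρ.mat) σ).trans
      (iInf_le (fun τ : MState B => DRenyi α (σ.mat ⊗ₖ τ.mat) ρ.mat) τ)
  exact h3.trans_lt h2


end
end

section
/- Additivity of the doubly minimized Petz Rényi lautum information (Theorem 1(c)): Let A₁, B₁, A₂, B₂ be nonempty finite types, α ∈ (0, 1/2], ρ a bipartite state on A₁ × B₁, and ρ' a bipartite state on A₂ × B₂. Let Π denote the state on (A₁ × A₂) × (B₁ × B₂) obtained from the Kronecker product ρ ⊗ ρ' (a matrix indexed by (A₁ × B₁) × (A₂ × B₂)) by reindexing along the bijection (A₁ × A₂) × (B₁ × B₂) ≃ (A₁ × B₁) × (A₂ × B₂). Then the infimum over states σ on A₁ × A₂ and τ on B₁ × B₂ of D_α(σ ⊗ τ ‖ Π) equals L_α^↓↓(A₁:B₁)_ρ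 + L_α^↓↓(A₂:B₂)_{ρ'}. -/
open scoped BigOperators Kronecker ComplexOrder

noncomputable section

/-! ### Spectral representation and powers -/

open Matrix in
/-- Matrix with unitary `V` and real spectrum `d`. -/
def ud {A : Type*} [Fintype A] [DecidableEq A] (V : Matrix A A ℂ) (d : A → ℝ) : Matrix A A ℂ :=
  V * Matrix.diagonal (fun i => (d i : ℂ)) * Vᴴ

/-- Scalar power on the support. -/
def pw (x p : ℝ) : ℝ := if x = 0 then 0 else x ^ p

open Matrix

lemma pw_nonneg {x : ℝ} (hx : 0 ≤ x) (p : ℝ) : 0 ≤ pw x p := by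
  unfold pw; split_ifs
  · exact le_rfl
  · positivity

lemma pw_pos {x : ℝ} (hx : 0 < x) (p : ℝ) : 0 < pw x p := by
  unfold pw; rw [if_neg hx.ne']; positivity

lemma pw_add {x : ℝ} (hx : 0 ≤ x) (p q : ℝ) : pw x p * pw x q = pw x (p + q) := by
  unfold pw
  by_cases h : x = 0
  · simp [h]
  · simp only [h, if_false]
    rw [Real.rpow_add (lt_of_le_of_ne hx (Ne.symm h))]

lemma pw_eq {x p : ℝ} (hp : p ≠ 0) : pw x p = x ^ p := by
  unfold pw; split_ifs with h
  · rw [h, Real.zero_rpow hp]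
  · rfl

lemma pw_mul {x y : ℝ} (hx : 0 ≤ x) (hy : 0 ≤ y) (p : ℝ) : pw (x * y) p = pw x p * pw y p := by
  unfold pw
  by_cases h : x = 0
  · simp [h]
  by_cases h' : y = 0
  · simp [h']
  simp [h, h', Real.mul_rpow hx hy]

lemma ud_herm {A : Type*} [Fintype A] [DecidableEq A] (V : Matrix A A ℂ) (d : A → ℝ) :
    (ud V d).IsHermitian := by
  unfold ud IsHermitian
  rw [conjTranspose_mul, conjTranspose_mul, conjTranspose_conjTranspose, diagonal_conjTranspose,
    ← mul_assoc]
  congr 3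
  ext i; simp

lemma ud_psd {A : Type*} [Fintype A] [DecidableEq A] (V : Matrix A A ℂ) {d : A → ℝ}
    (hd : ∀ i, 0 ≤ d i) : (ud V d).PosSemidef := by
  apply PosSemidef.mul_mul_conjTranspose_same
  apply PosSemidef.diagonal
  intro i; simpa using hd i

lemma ud_trace {A : Type*} [Fintype A] [DecidableEq A] {V : Matrix A A ℂ} (hV : Vᴴ * V = 1)
    (d : A → ℝ) : (ud V d).trace = ((∑ i, d i : ℝ) : ℂ) := by
  unfold ud
  rw [trace_mul_comm, ← mul_assoc, hV, one_mul, trace_diagonal]; push_cast; rfl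

lemma ud_mul {A : Type*} [Fintype A] [DecidableEq A] {V : Matrix A A ℂ} (hV : Vᴴ * V = 1)
    (d e : A → ℝ) : ud V d * ud V e = ud V (fun i => d i * e i) := by
  unfold ud
  have : V * diagonal (fun i => (d i : ℂ)) * Vᴴ * (V * diagonal (fun i => (e i : ℂ)) * Vᴴ)
      = V * diagonal (fun i => (d i : ℂ)) * (Vᴴ * V) * diagonal (fun i => (e i : ℂ)) * Vᴴ := by
    simp only [mul_assoc]
  rw [this, hV, mul_one, mul_assoc V, diagonal_mul_diagonal]
  push_cast; rfl

lemma ud_smul {A : Type*} [Fintype A] [DecidableEq A] (V : Matrix A A ℂ)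
    (d : A → ℝ) (c : ℝ) : c • ud V d = ud V (fun i => c * d i) := by
  unfold ud
  rw [← Matrix.smul_mul, ← Matrix.mul_smul, ← diagonal_smul]
  congr 3
  ext i; simp

lemma ud_sub {A : Type*} [Fintype A] [DecidableEq A] (V : Matrix A A ℂ)
    (d e : A → ℝ) : ud V d - ud V e = ud V (fun i => d i - e i) := by
  unfold ud
  rw [← Matrix.sub_mul, ← Matrix.mul_sub, diagonal_sub]
  push_cast; rfl

lemma ud_one {A : Type*} [Fintype A] [DecidableEq A] {V : Matrix A A ℂ} (hV : V * Vᴴ = 1) :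
    ud V (fun _ => 1) = 1 := by
  unfold ud; simp [hV]

lemma herm_spec {A : Type*} [Fintype A] [DecidableEq A] {X : Matrix A A ℂ} (h : X.IsHermitian) :
    ∃ (V : Matrix A A ℂ), V * Vᴴ = 1 ∧ Vᴴ * V = 1 ∧ X = ud V h.eigenvalues ∧
      ∀ p, mpow X p = ud V (fun i => pw (h.eigenvalues i) p) := by
  refine ⟨h.eigenvectorUnitary, ?_, ?_, ?_, ?_⟩
  · exact (Unitary.mem_iff.mp h.eigenvectorUnitary.2).2
  · exact (Unitary.mem_iff.mp h.eigenvectorUnitary.2).1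
  · conv_lhs => rw [h.spectral_theorem]
    rfl
  · intro p
    unfold mpow
    rw [dif_pos h]
    rfl

lemma ud_fun {A : Type*} [Fintype A] [DecidableEq A] {V W : Matrix A A ℂ} {d e : A → ℝ}
    (hV : V * Vᴴ = 1) (hV' : Vᴴ * V = 1) (hW : W * Wᴴ = 1) (hW' : Wᴴ * W = 1)
    (h : ud V d = ud W e) (f : ℝ → ℝ) :
    ud V (fun i => f (d i)) = ud W (fun i => f (e i)) := by
  have key : diagonal (fun i => (d i : ℂ)) * (Vᴴ * W)
      = (Vᴴ * W) * diagonal (fun i => (e i : ℂ)) := by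
    have h1 : Vᴴ * ud V d * W = Vᴴ * ud W e * W := by rw [h]
    unfold ud at h1
    calc _ = (Vᴴ * V) * diagonal (fun i => (d i : ℂ)) * (Vᴴ * W) := by rw [hV', one_mul]
      _ = Vᴴ * (V * diagonal (fun i => (d i : ℂ)) * Vᴴ) * W := by simp only [mul_assoc]
      _ = _ := h1
      _ = (Vᴴ * W) * diagonal (fun i => (e i : ℂ)) * (Wᴴ * W) := by simp only [mul_assoc]
      _ = _ := by rw [hW', mul_one]
  have key2 : diagonal (fun i => (f (d i) : ℂ)) * (Vᴴ * W)
      = (Vᴴ * W) * diagonal (fun i => (f (e i) : ℂ)) := by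
    ext i j
    have := congrFun (congrFun key i) j
    rw [diagonal_mul, mul_diagonal] at this ⊢
    by_cases h0 : (Vᴴ * W) i j = 0
    · simp [h0]
    · have h2 : (d i : ℂ) = e j := by
        rw [mul_comm] at this
        exact mul_left_cancel₀ h0 this
      have h3 : d i = e j := by exact_mod_cast h2
      rw [h3, mul_comm]
  unfold ud
  calc V * diagonal (fun i => (f (d i) : ℂ)) * Vᴴ
      = V * (diagonal (fun i => (f (d i) : ℂ)) * (Vᴴ * W)) * Wᴴ := by
        simp only [mul_assoc]; rw [hW, mul_one]
    _ = (V * Vᴴ) * W * diagonal (fun i => (f (e i) : ℂ)) * Wᴴ := by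
        rw [key2]; simp only [mul_assoc]
    _ = _ := by rw [hV, one_mul]

lemma mpow_ud {A : Type*} [Fintype A] [DecidableEq A] {V : Matrix A A ℂ}
    (hV : V * Vᴴ = 1) (hV' : Vᴴ * V = 1) (d : A → ℝ) (p : ℝ) :
    mpow (ud V d) p = ud V (fun i => pw (d i) p) := by
  obtain ⟨W, hW, hW', h1, h2⟩ := herm_spec (ud_herm V d)
  rw [h2 p]
  exact (ud_fun hV hV' hW hW' h1 (fun x => pw x p)).symm

/-- PSD spectral representation. -/
lemma psd_spec {A : Type*} [Fintype A] [DecidableEq A] {X : Matrix A A ℂ} (h : X.PosSemidef) :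
    ∃ (V : Matrix A A ℂ) (d : A → ℝ), V * Vᴴ = 1 ∧ Vᴴ * V = 1 ∧ (∀ i, 0 ≤ d i) ∧ X = ud V d ∧
      ∀ p, mpow X p = ud V (fun i => pw (d i) p) := by
  obtain ⟨V, h1, h2, h3, h4⟩ := herm_spec h.1
  exact ⟨V, _, h1, h2, h.eigenvalues_nonneg, h3, h4⟩

lemma pd_spec {A : Type*} [Fintype A] [DecidableEq A] {X : Matrix A A ℂ} (h : X.PosDef) :
    ∃ (V : Matrix A A ℂ) (d : A → ℝ), V * Vᴴ = 1 ∧ Vᴴ * V = 1 ∧ (∀ i, 0 < d i) ∧ X = ud V d ∧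
      ∀ p, mpow X p = ud V (fun i => pw (d i) p) := by
  obtain ⟨V, h1, h2, h3, h4⟩ := herm_spec h.1
  exact ⟨V, _, h1, h2, h.eigenvalues_pos, h3, h4⟩

lemma ud_pd {A : Type*} [Fintype A] [DecidableEq A] {V : Matrix A A ℂ} {d : A → ℝ}
    (hV : V * Vᴴ = 1) (hd : ∀ i, 0 < d i) : (ud V d).PosDef := by
  have h1 : (diagonal (fun i => (d i : ℂ))).PosDef := by
    apply PosDef.diagonal
    intro i; simpa using hd i
  apply h1.mul_mul_conjTranspose_same
  intro x y hxy
  have := congrArg (fun z => z ᵥ* Vᴴ) hxy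
  simpa [vecMul_vecMul, hV] using this

lemma mpow_psd {A : Type*} [Fintype A] [DecidableEq A] {X : Matrix A A ℂ} (h : X.PosSemidef)
    (p : ℝ) : (mpow X p).PosSemidef := by
  obtain ⟨V, d, h1, h2, h3, h4, h5⟩ := psd_spec h
  rw [h5]; exact ud_psd _ (fun i => pw_nonneg (h3 i) p)

lemma mpow_pd {A : Type*} [Fintype A] [DecidableEq A] {X : Matrix A A ℂ} (h : X.PosDef)
    (p : ℝ) : (mpow X p).PosDef := by
  obtain ⟨V, d, h1, h2, h3, h4, h5⟩ := pd_spec h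
  rw [h5]; exact ud_pd h1 (fun i => pw_pos (h3 i) p)

lemma mpow_mul {A : Type*} [Fintype A] [DecidableEq A] {X : Matrix A A ℂ} (h : X.PosSemidef)
    (p q : ℝ) : mpow X p * mpow X q = mpow X (p + q) := by
  obtain ⟨V, d, h1, h2, h3, h4, h5⟩ := psd_spec h
  rw [h5, h5, h5, ud_mul h2]
  congr 1; ext i; exact pw_add (h3 i) p q

lemma mpow_one' {A : Type*} [Fintype A] [DecidableEq A] {X : Matrix A A ℂ} (h : X.PosSemidef) :
    mpow X 1 = X := by
  obtain ⟨V, d, h1, h2, h3, h4, h5⟩ := psd_spec h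
  rw [h5]; conv_rhs => rw [h4]
  congr 1; ext i; rw [pw_eq one_ne_zero, Real.rpow_one]

lemma mpow_zero' {A : Type*} [Fintype A] [DecidableEq A] {X : Matrix A A ℂ} (h : X.PosDef) :
    mpow X 0 = 1 := by
  obtain ⟨V, d, h1, h2, h3, h4, h5⟩ := pd_spec h
  rw [h5, ← ud_one h1]
  congr 1; ext i; simp [pw, (h3 i).ne']

lemma ud_kron {A B : Type*} [Fintype A] [DecidableEq A] [Fintype B] [DecidableEq B]
    (V : Matrix A A ℂ) (W : Matrix B B ℂ) (d : A → ℝ) (e : B → ℝ) :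
    ud V d ⊗ₖ ud W e = ud (V ⊗ₖ W) (fun i => d i.1 * e i.2) := by
  unfold ud
  rw [mul_kronecker_mul, mul_kronecker_mul, diagonal_kronecker_diagonal, conjTranspose_kronecker]
  push_cast; rfl

lemma kron_unit {A B : Type*} [Fintype A] [DecidableEq A] [Fintype B] [DecidableEq B]
    {V : Matrix A A ℂ} {W : Matrix B B ℂ} (hV : V * Vᴴ = 1) (hW : W * Wᴴ = 1) :
    (V ⊗ₖ W) * (V ⊗ₖ W)ᴴ = 1 := by
  rw [conjTranspose_kronecker, ← mul_kronecker_mul, hV, hW, one_kronecker_one]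

lemma kron_unit' {A B : Type*} [Fintype A] [DecidableEq A] [Fintype B] [DecidableEq B]
    {V : Matrix A A ℂ} {W : Matrix B B ℂ} (hV : Vᴴ * V = 1) (hW : Wᴴ * W = 1) :
    (V ⊗ₖ W)ᴴ * (V ⊗ₖ W) = 1 := by
  rw [conjTranspose_kronecker, ← mul_kronecker_mul, hV, hW, one_kronecker_one]

lemma mpow_kron {A B : Type*} [Fintype A] [DecidableEq A] [Fintype B] [DecidableEq B]
    {X : Matrix A A ℂ} {Y : Matrix B B ℂ} (hX : X.PosSemidef) (hY : Y.PosSemidef) (p : ℝ) :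
    mpow (X ⊗ₖ Y) p = mpow X p ⊗ₖ mpow Y p := by
  obtain ⟨V, d, h1, h2, h3, h4, h5⟩ := psd_spec hX
  obtain ⟨W, e, g1, g2, g3, g4, g5⟩ := psd_spec hY
  rw [h5, g5, ud_kron]
  conv_lhs => rw [h4, g4, ud_kron, mpow_ud (kron_unit h1 g1) (kron_unit' h2 g2)]
  congr 1; ext i; exact pw_mul (h3 _) (g3 _) p

lemma ud_reindex {A B : Type*} [Fintype A] [DecidableEq A] [Fintype B] [DecidableEq B]
    (e : A ≃ B) (V : Matrix A A ℂ) (d : A → ℝ) :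
    Matrix.reindex e e (ud V d) = ud (Matrix.reindex e e V) (fun i => d (e.symm i)) := by
  unfold ud
  simp only [reindex_apply]
  rw [conjTranspose_submatrix, ← submatrix_mul_equiv _ _ _ e.symm _,
    ← submatrix_mul_equiv _ _ _ e.symm _, submatrix_diagonal_equiv]
  rfl

lemma mpow_reindex {A B : Type*} [Fintype A] [DecidableEq A] [Fintype B] [DecidableEq B]
    (e : A ≃ B) {X : Matrix A A ℂ} (hX : X.PosSemidef) (p : ℝ) :
    mpow (Matrix.reindex e e X) p = Matrix.reindex e e (mpow X p) := by
  obtain ⟨V, d, h1, h2, h3, h4, h5⟩ := psd_spec hX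
  rw [h5]
  conv_lhs => rw [h4]
  rw [ud_reindex, ud_reindex, mpow_ud]
  · simp only [reindex_apply]
    rw [conjTranspose_submatrix, submatrix_mul_equiv, h1, submatrix_one_equiv]
  · simp only [reindex_apply]
    rw [conjTranspose_submatrix, submatrix_mul_equiv, h2, submatrix_one_equiv]

/-- trace of product of PSD is nonnegative. -/
lemma trace_mul_nonneg {A : Type*} [Fintype A] [DecidableEq A] {X Y : Matrix A A ℂ}
    (hX : X.PosSemidef) (hY : Y.PosSemidef) : 0 ≤ (X * Y).trace := by
  have h : X = mpow X (1/2) * mpow X (1/2) := by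
    rw [mpow_mul hX]; norm_num; exact (mpow_one' hX).symm
  have hh := (mpow_psd hX (1/2)).1
  rw [h, mul_assoc, trace_mul_comm]
  have := hY.mul_mul_conjTranspose_same (mpow X (1/2))
  rw [hh.eq] at this
  exact this.trace_nonneg
/-! ### Young inequality -/

lemma trace_ud_ud {A : Type*} [Fintype A] [DecidableEq A] (V W : Matrix A A ℂ) (d e : A → ℝ) :
    (ud V d * ud W e).trace.re = ∑ i, ∑ j, Complex.normSq ((Vᴴ * W) i j) * (d i * e j) := by
  have h1 : (ud V d * ud W e).trace =
      (diagonal (fun i => (d i : ℂ)) * (Vᴴ * W) * (diagonal (fun i => (e i : ℂ)) *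
        (Vᴴ * W)ᴴ)).trace := by
    unfold ud
    rw [conjTranspose_mul, conjTranspose_conjTranspose]
    have : V * diagonal (fun i => (d i : ℂ)) * Vᴴ * (W * diagonal (fun i => (e i : ℂ)) * Wᴴ)
      = V * (diagonal (fun i => (d i : ℂ)) * Vᴴ * W * diagonal (fun i => (e i : ℂ)) * Wᴴ) := by
      simp only [mul_assoc]
    rw [this, trace_mul_comm]
    simp only [mul_assoc]
  rw [h1, trace, Complex.re_sum]
  refine Finset.sum_congr rfl fun i _ => ?_
  rw [diag_apply, mul_apply, Complex.re_sum]
  refine Finset.sum_congr rfl fun j _ => ?_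
  rw [diagonal_mul, diagonal_mul, conjTranspose_apply]
  generalize (Vᴴ * W) i j = z
  simp [Complex.normSq_apply]
  ring

lemma unit_sum_row {A : Type*} [Fintype A] [DecidableEq A] {W : Matrix A A ℂ}
    (hW : W * Wᴴ = 1) (i : A) : ∑ j, Complex.normSq (W i j) = 1 := by
  have := congrArg Complex.re (congrFun (congrFun hW i) i)
  rw [mul_apply, Complex.re_sum] at this
  simp at this
  rw [← this]
  refine Finset.sum_congr rfl fun j _ => ?_
  simp [Complex.normSq_apply]

lemma unit_sum_col {A : Type*} [Fintype A] [DecidableEq A] {W : Matrix A A ℂ}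
    (hW : Wᴴ * W = 1) (j : A) : ∑ i, Complex.normSq (W i j) = 1 := by
  have := congrArg Complex.re (congrFun (congrFun hW j) j)
  rw [mul_apply, Complex.re_sum] at this
  simp at this
  rw [← this]
  refine Finset.sum_congr rfl fun j _ => ?_
  simp [Complex.normSq_apply]

lemma pw_young {s x y : ℝ} (hs : 0 ≤ s) (hs1 : s ≤ 1) (hx : 0 ≤ x) (hy : 0 ≤ y) :
    pw x s * pw y (1 - s) ≤ s * x + (1 - s) * y := by
  have h1 : pw x s ≤ x ^ s := by
    unfold pw; split_ifs
    · positivity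
    · exact le_rfl
  have h2 : pw y (1 - s) ≤ y ^ (1 - s) := by
    unfold pw; split_ifs
    · positivity
    · exact le_rfl
  calc _ ≤ x ^ s * y ^ (1 - s) := mul_le_mul h1 h2 (pw_nonneg hy _) (by positivity)
    _ ≤ _ := Real.geom_mean_le_arith_mean2_weighted hs (by linarith) hx hy (by ring)

lemma young_gap {A : Type*} [Fintype A] [DecidableEq A] {V W : Matrix A A ℂ} {d e : A → ℝ}
    (hV : V * Vᴴ = 1) (hV' : Vᴴ * V = 1) (hW : W * Wᴴ = 1) (hW' : Wᴴ * W = 1)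
    (hd : ∑ i, d i = 1) (he : ∑ i, e i = 1) (s : ℝ) :
    1 - (ud V (fun i => pw (d i) s) * ud W (fun i => pw (e i) (1 - s))).trace.re =
      ∑ i, ∑ j, Complex.normSq ((Vᴴ * W) i j) *
        (s * d i + (1 - s) * e j - pw (d i) s * pw (e j) (1 - s)) := by
  rw [trace_ud_ud]
  have hu : (Vᴴ * W) * (Vᴴ * W)ᴴ = 1 := by
    rw [conjTranspose_mul, conjTranspose_conjTranspose]
    calc _ = Vᴴ * (W * Wᴴ) * V := by simp only [mul_assoc]
      _ = 1 := by rw [hW, mul_one, hV']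
  have hu' : (Vᴴ * W)ᴴ * (Vᴴ * W) = 1 := by
    rw [conjTranspose_mul, conjTranspose_conjTranspose]
    calc _ = Wᴴ * (V * Vᴴ) * W := by simp only [mul_assoc]
      _ = 1 := by rw [hV, mul_one, hW']
  have h1 : ∑ i, ∑ j, Complex.normSq ((Vᴴ * W) i j) * (s * d i) = s := by
    simp_rw [← Finset.sum_mul, unit_sum_row hu, one_mul, ← Finset.mul_sum, hd, mul_one]
  have h2 : ∑ i, ∑ j, Complex.normSq ((Vᴴ * W) i j) * ((1 - s) * e j) = 1 - s := by
    rw [Finset.sum_comm]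
    simp_rw [← Finset.sum_mul, unit_sum_col hu', one_mul, ← Finset.mul_sum, he, mul_one]
  simp_rw [mul_sub, mul_add, Finset.sum_sub_distrib, Finset.sum_add_distrib]
  rw [h1, h2]; ring

lemma state_spec {A : Type*} [Fintype A] [DecidableEq A] (σ : MState A) :
    ∃ (V : Matrix A A ℂ) (d : A → ℝ), V * Vᴴ = 1 ∧ Vᴴ * V = 1 ∧ (∀ i, 0 ≤ d i) ∧ σ.mat = ud V d ∧
      (∀ p, mpow σ.mat p = ud V (fun i => pw (d i) p)) ∧ ∑ i, d i = 1 := by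
  obtain ⟨V, d, h1, h2, h3, h4, h5⟩ := psd_spec σ.posSemidef
  refine ⟨V, d, h1, h2, h3, h4, h5, ?_⟩
  have := σ.trace_one
  rw [h4, ud_trace h2] at this
  exact_mod_cast this

lemma young_le {A : Type*} [Fintype A] [DecidableEq A] (σ ω : MState A) {s : ℝ} (hs : 0 ≤ s)
    (hs1 : s ≤ 1) : (mpow σ.mat s * mpow ω.mat (1 - s)).trace.re ≤ 1 := by
  obtain ⟨V, d, h1, h2, h3, h4, h5, h6⟩ := state_spec σ
  obtain ⟨W, e, g1, g2, g3, g4, g5, g6⟩ := state_spec ω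
  have := young_gap h1 h2 g1 g2 h6 g6 s
  rw [h5, g5]
  have h : 0 ≤ ∑ i, ∑ j, Complex.normSq ((Vᴴ * W) i j) *
        (s * d i + (1 - s) * e j - pw (d i) s * pw (e j) (1 - s)) :=
    Finset.sum_nonneg fun i _ => Finset.sum_nonneg fun j _ =>
      mul_nonneg (Complex.normSq_nonneg _) (sub_nonneg.2 (pw_young hs hs1 (h3 i) (g3 j)))
  linarith

lemma young_eq {A : Type*} [Fintype A] [DecidableEq A] (σ ω : MState A) {s : ℝ} (hs : 0 < s)
    (hs1 : s < 1) (h : 1 ≤ (mpow σ.mat s * mpow ω.mat (1 - s)).trace.re) : σ.mat = ω.mat := by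
  obtain ⟨V, d, h1, h2, h3, h4, h5, h6⟩ := state_spec σ
  obtain ⟨W, e, g1, g2, g3, g4, g5, g6⟩ := state_spec ω
  have hgap := young_gap h1 h2 g1 g2 h6 g6 s
  rw [h5, g5] at h
  have hn : ∀ i j, 0 ≤ Complex.normSq ((Vᴴ * W) i j) *
        (s * d i + (1 - s) * e j - pw (d i) s * pw (e j) (1 - s)) := fun i j =>
      mul_nonneg (Complex.normSq_nonneg _) (sub_nonneg.2 (pw_young hs.le hs1.le (h3 i) (g3 j)))
  have h0 : ∑ i, ∑ j, Complex.normSq ((Vᴴ * W) i j) *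
        (s * d i + (1 - s) * e j - pw (d i) s * pw (e j) (1 - s)) = 0 :=
    le_antisymm (by linarith) (Finset.sum_nonneg fun i _ => Finset.sum_nonneg fun j _ => hn i j)
  have key : diagonal (fun i => (d i : ℂ)) * (Vᴴ * W)
      = (Vᴴ * W) * diagonal (fun i => (e i : ℂ)) := by
    ext i j
    rw [diagonal_mul, mul_diagonal]
    have hi := (Finset.sum_eq_zero_iff_of_nonneg
      (fun i _ => Finset.sum_nonneg fun j _ => hn i j)).1 h0 i (Finset.mem_univ _)
    have hij := (Finset.sum_eq_zero_iff_of_nonneg (fun j _ => hn i j)).1 hi j (Finset.mem_univ _)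
    rcases mul_eq_zero.1 hij with hz | hz
    · rw [Complex.normSq_eq_zero.1 hz]; simp
    · rw [pw_eq hs.ne', pw_eq (by linarith : (1 - s) ≠ 0)] at hz
      have := (Real.geom_mean_eq_arith_mean2_weighted_iff_of_pos hs (by linarith : 0 < 1 - s)
        (h3 i) (g3 j) (by ring)).1 (by linarith)
      rw [this, mul_comm]
  rw [h4, g4]
  unfold ud
  calc V * diagonal (fun i => (d i : ℂ)) * Vᴴ
      = V * (diagonal (fun i => (d i : ℂ)) * (Vᴴ * W)) * Wᴴ := by
        simp only [mul_assoc]; rw [g1, mul_one]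
    _ = (V * Vᴴ) * W * diagonal (fun i => (e i : ℂ)) * Wᴴ := by
        rw [key]; simp only [mul_assoc]
    _ = _ := by rw [h1, one_mul]

/-! ### L2 contraction -/

lemma trace_abab {A : Type*} [Fintype A] [DecidableEq A] {X Y : Matrix A A ℂ}
    (hX : X.IsHermitian) (hY : Y.IsHermitian) :
    (X * Y * X * Y).trace.re ≤ (X * X * (Y * Y)).trace.re := by
  have h := (posSemidef_self_mul_conjTranspose (X * Y - Y * X)).trace_nonneg
  have h' := (Complex.le_def.1 h).1
  rw [conjTranspose_sub, conjTranspose_mul, conjTranspose_mul, hX.eq, hY.eq] at h'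
  simp only [sub_mul, mul_sub, trace_sub, Complex.sub_re, Complex.zero_re] at h'
  have e1 : (X * Y * (Y * X)).trace = (X * X * (Y * Y)).trace := by
    rw [← mul_assoc, trace_mul_comm]; simp only [mul_assoc]
  have e2 : (Y * X * (X * Y)).trace = (X * X * (Y * Y)).trace := by
    rw [mul_assoc, trace_mul_comm]; simp only [mul_assoc]
  have e3 : (X * Y * (X * Y)).trace = (X * Y * X * Y).trace := by simp only [mul_assoc]
  have e4 : (Y * X * (Y * X)).trace = (X * Y * X * Y).trace := by
    rw [mul_assoc, trace_mul_comm]; simp only [mul_assoc]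
  rw [e1, e2, e3, e4] at h'
  linarith

lemma am_gm_trace {A : Type*} [Fintype A] [DecidableEq A] {X Y : Matrix A A ℂ}
    (hX : X.IsHermitian) (hY : Y.IsHermitian) :
    2 * (X * Y).trace.re ≤ (X * X).trace.re + (Y * Y).trace.re := by
  have h := (posSemidef_self_mul_conjTranspose (X - Y)).trace_nonneg
  have h' := (Complex.le_def.1 h).1
  rw [conjTranspose_sub, hX.eq, hY.eq] at h'
  simp only [sub_mul, mul_sub, trace_sub, Complex.sub_re, Complex.zero_re] at h'
  rw [trace_mul_comm Y X] at h'
  linarith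

lemma convex_bounded {n : ℕ → ℝ} {C : ℝ} (h : ∀ k, 2 * n (k + 1) ≤ n k + n (k + 2))
    (hC : ∀ k, n k ≤ C) : n 1 ≤ n 0 := by
  by_contra hlt
  push Not at hlt
  have h1 : ∀ k, n 1 - n 0 ≤ n (k + 1) - n k := by
    intro k
    induction k with
    | zero => exact le_rfl
    | succ k ih => have := h k; have e : n (k + 1 + 1) = n (k + 2) := rfl; linarith
  have h2 : ∀ k : ℕ, n 0 + k * (n 1 - n 0) ≤ n k := by
    intro k
    induction k with
    | zero => simp
    | succ k ih => have := h1 k; push_cast; linarith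
  obtain ⟨k, hk⟩ := exists_nat_gt ((C - n 0) / (n 1 - n 0))
  rw [div_lt_iff₀ (by linarith)] at hk
  have := h2 k
  have := hC k
  linarith

lemma herm_le_pd {A : Type*} [Fintype A] [DecidableEq A] {X P : Matrix A A ℂ}
    (hX : X.IsHermitian) (hP : P.PosDef) :
    ∃ c : ℝ, (c • P - X).PosSemidef ∧ (c • P + X).PosSemidef := by
  obtain ⟨V, h1, h2, h3, -⟩ := herm_spec hX
  obtain ⟨W, e, g1, g2, g3, g4, -⟩ := pd_spec hP
  set d := hX.eigenvalues
  -- m bounds d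
  obtain ⟨m, hm0, hm⟩ : ∃ m : ℝ, 0 ≤ m ∧ ∀ i, |d i| ≤ m :=
    ⟨∑ i, |d i|, Finset.sum_nonneg fun i _ => abs_nonneg _, fun i =>
      Finset.single_le_sum (f := fun i => |d i|) (fun i _ => abs_nonneg _) (Finset.mem_univ i)⟩
  obtain ⟨k, hk⟩ : ∃ k : ℝ, ∀ i, 1 ≤ k * e i := by
    refine ⟨∑ i, (e i)⁻¹, fun i => ?_⟩
    have : (e i)⁻¹ ≤ ∑ i, (e i)⁻¹ :=
      Finset.single_le_sum (f := fun i => (e i)⁻¹) (fun i _ => inv_nonneg.2 (g3 i).le)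
        (Finset.mem_univ i)
    calc 1 = (e i)⁻¹ * e i := by rw [inv_mul_cancel₀ (g3 i).ne']
      _ ≤ _ := mul_le_mul_of_nonneg_right this (g3 i).le
  have a1 : ((m * k) • P - m • (1 : Matrix A A ℂ)).PosSemidef := by
    rw [g4, ← ud_one g1, ud_smul, ud_smul, ud_sub]
    apply ud_psd; intro i; nlinarith [hk i]
  have a2 : (m • (1 : Matrix A A ℂ) - X).PosSemidef := by
    rw [h3, ← ud_one h1, ud_smul, ud_sub]
    apply ud_psd; intro i; linarith [le_abs_self (d i), hm i]
  have a3 : (m • (1 : Matrix A A ℂ) - (-1 : ℝ) • X).PosSemidef := by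
    rw [h3, ← ud_one h1, ud_smul, ud_smul, ud_sub]
    apply ud_psd; intro i; linarith [neg_abs_le (d i), hm i]
  refine ⟨m * k, ?_, ?_⟩
  · have := a1.add a2
    rwa [sub_add_sub_cancel] at this
  · have := a1.add a3
    rw [sub_add_sub_cancel] at this
    simpa using this

lemma pos_selfadj_contr {A : Type*} [Fintype A] [DecidableEq A]
    (S : Matrix A A ℂ → Matrix A A ℂ) (hadd : ∀ X Y, S (X + Y) = S X + S Y)
    (hsub : ∀ X Y, S (X - Y) = S X - S Y)
    (hsmul : ∀ (c : ℝ) X, S (c • X) = c • S X) (hpos : ∀ X, X.PosSemidef → (S X).PosSemidef)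
    (hadj : ∀ X Y, (X * S Y).trace = (S X * Y).trace)
    {P : Matrix A A ℂ} (hP : P.PosDef) (hfix : S P = P) {X : Matrix A A ℂ} (hX : X.IsHermitian) :
    (X * S X).trace.re ≤ (X * X).trace.re := by
  obtain ⟨c, hc1, hc2⟩ := herm_le_pd hX hP
  have hit : ∀ k, (c • P - S^[k] X).PosSemidef ∧ (c • P + S^[k] X).PosSemidef ∧
      (S^[k] X).IsHermitian := by
    intro k
    induction k with
    | zero => exact ⟨hc1, hc2, hX⟩
    | succ k ih =>
      have b1 := hpos _ ih.1
      have b2 := hpos _ ih.2.1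
      rw [hsub, hsmul, hfix] at b1
      rw [hadd, hsmul, hfix] at b2
      rw [Function.iterate_succ_apply']
      refine ⟨b1, b2, ?_⟩
      have hPh : (c • P).IsHermitian := by
        have := hP.1
        unfold IsHermitian at *
        rw [conjTranspose_smul, this]; simp
      have := b2.1.sub hPh
      rwa [add_sub_cancel_left] at this
  set n : ℕ → ℝ := fun k => (S^[k] X * S^[k] X).trace.re with hn
  have hconv : ∀ k, 2 * n (k + 1) ≤ n k + n (k + 2) := by
    intro k
    have e : n (k + 1) = (S^[k] X * S^[k + 2] X).trace.re := by
      simp only [hn]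
      rw [Function.iterate_succ_apply' S (k + 1), hadj, ← Function.iterate_succ_apply' S k]
    rw [e]
    exact am_gm_trace (hit k).2.2 (hit (k + 2)).2.2
  have hbd : ∀ k, n k ≤ ((c • P) * (c • P)).trace.re := by
    intro k
    have h := trace_mul_nonneg (hit k).1 (hit k).2.1
    have h' := (Complex.le_def.1 h).1
    simp only [sub_mul, mul_add, trace_sub, trace_add, Complex.sub_re, Complex.add_re,
      Complex.zero_re] at h'
    rw [trace_mul_comm (c • P) (S^[k] X)] at h'
    simp only [hn]
    linarith
  have h10 := convex_bounded hconv hbd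
  have := am_gm_trace hX (hit 1).2.2
  simp only [hn, Function.iterate_one, Function.iterate_zero, id] at h10 this
  linarith

lemma l2_contr {A B : Type*} [Fintype A] [DecidableEq A] [Fintype B] [DecidableEq B]
    (F : Matrix A A ℂ → Matrix B B ℂ) (G : Matrix B B ℂ → Matrix A A ℂ)
    (Fadd : ∀ X Y, F (X + Y) = F X + F Y) (Gadd : ∀ X Y, G (X + Y) = G X + G Y)
    (Fsmul : ∀ (c : ℝ) X, F (c • X) = c • F X) (Gsmul : ∀ (c : ℝ) X, G (c • X) = c • G X)
    (Fpos : ∀ X, X.PosSemidef → (F X).PosSemidef) (Gpos : ∀ X, X.PosSemidef → (G X).PosSemidef)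
    (Fherm : ∀ X, X.IsHermitian → (F X).IsHermitian)
    (hadj : ∀ X Y, (Y * F X).trace = (G Y * X).trace)
    {P : Matrix A A ℂ} {R : Matrix B B ℂ} (hP : P.PosDef) (hF : F P = R) (hG : G R = P)
    {X : Matrix A A ℂ} (hX : X.IsHermitian) {Y : Matrix B B ℂ} (hY : Y.IsHermitian) :
    2 * (Y * F X).trace.re ≤ (X * X).trace.re + (Y * Y).trace.re := by
  have h1 := pos_selfadj_contr (fun X => G (F X)) (fun X Y => by simp only [Fadd, Gadd])
    (fun X Y => by
      have : X - Y = X + (-1 : ℝ) • Y := by simp [sub_eq_add_neg]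
      simp only [this, Fadd, Gadd, Fsmul, Gsmul]; simp [sub_eq_add_neg])
    (fun c X => by simp only [Fsmul, Gsmul])
    (fun X h => Gpos _ (Fpos _ h))
    (fun X Y => by
      rw [← hadj, trace_mul_comm, ← hadj, trace_mul_comm])
    hP (by simp only [hF, hG]) hX
  have h2 := am_gm_trace hY (Fherm _ hX)
  have h3 : (F X * F X).trace = (X * G (F X)).trace := by
    rw [hadj, trace_mul_comm]
  rw [h3] at h2
  linarith
/-! ### The map induced by a bipartite matrix -/

/-- Partial trace of `(P ⊗ 1) M` over the first factor. -/
def phi {A B : Type*} [Fintype A] (M : Matrix (A × B) (A × B) ℂ) (P : Matrix A A ℂ) :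
    Matrix B B ℂ :=
  Matrix.of fun b b' => ∑ a, ∑ a', P a a' * M (a', b) (a, b')

/-- Swap of the tensor factors. -/
def sw {A B : Type*} (M : Matrix (A × B) (A × B) ℂ) : Matrix (B × A) (B × A) ℂ :=
  M.submatrix Prod.swap Prod.swap

section phi
set_option linter.unusedSectionVars false
variable {A B : Type*} [Fintype A] [DecidableEq A] [Fintype B] [DecidableEq B]

lemma phi_trace (M : Matrix (A × B) (A × B) ℂ) (X : Matrix A A ℂ) (Y : Matrix B B ℂ) :
    (Y * phi M X).trace = ((X ⊗ₖ Y) * M).trace := by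
  simp only [trace, diag_apply, mul_apply, phi, of_apply, Fintype.sum_prod_type, kroneckerMap_apply,
    Finset.mul_sum]
  rw [Finset.sum_comm_cycle]
  rw [Finset.sum_comm_cycle]
  rw [Finset.sum_comm]
  refine Finset.sum_congr rfl fun a _ => ?_
  rw [Finset.sum_comm]
  refine Finset.sum_congr rfl fun b _ => ?_
  rw [Finset.sum_comm]
  refine Finset.sum_congr rfl fun a' _ => ?_
  refine Finset.sum_congr rfl fun b' _ => ?_
  ring

lemma sw_trace (M : Matrix (A × B) (A × B) ℂ) (X : Matrix A A ℂ) (Y : Matrix B B ℂ) :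
    ((Y ⊗ₖ X) * sw M).trace = ((X ⊗ₖ Y) * M).trace := by
  have : (Y ⊗ₖ X) = (X ⊗ₖ Y).submatrix (Equiv.prodComm B A) (Equiv.prodComm B A) := by
    ext i j; simp [kroneckerMap_apply, mul_comm]
  have h2 : sw M = M.submatrix (Equiv.prodComm B A) (Equiv.prodComm B A) := rfl
  rw [this, h2, submatrix_mul_equiv]
  exact Fintype.sum_equiv (Equiv.prodComm B A) _ _ (fun i => rfl)

lemma phi_adj (M : Matrix (A × B) (A × B) ℂ) (X : Matrix A A ℂ) (Y : Matrix B B ℂ) :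
    (Y * phi M X).trace = (phi (sw M) Y * X).trace := by
  rw [trace_mul_comm _ X, phi_trace, phi_trace, sw_trace]

lemma phi_add (M : Matrix (A × B) (A × B) ℂ) (X Y : Matrix A A ℂ) :
    phi M (X + Y) = phi M X + phi M Y := by
  ext b b'
  simp [phi, add_mul, Finset.sum_add_distrib]

lemma phi_smul (M : Matrix (A × B) (A × B) ℂ) (c : ℝ) (X : Matrix A A ℂ) :
    phi M (c • X) = c • phi M X := by
  ext b b'
  simp [phi, Finset.mul_sum, mul_assoc]

lemma phi_add_left (M N : Matrix (A × B) (A × B) ℂ) (X : Matrix A A ℂ) :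
    phi (M + N) X = phi M X + phi N X := by
  ext b b'
  simp [phi, mul_add, Finset.sum_add_distrib]

lemma phi_smul_one (c : ℝ) (X : Matrix A A ℂ) :
    phi (B := B) (c • 1) X = (c • X.trace) • (1 : Matrix B B ℂ) := by
  ext b b'
  by_cases h : b = b'
  · subst h
    simp [phi, one_apply, trace, Finset.mul_sum, mul_comm]
  · simp [phi, one_apply, h]

lemma phi_herm {M : Matrix (A × B) (A × B) ℂ} (hM : M.IsHermitian) {X : Matrix A A ℂ}
    (hX : X.IsHermitian) : (phi M X).IsHermitian := by
  ext b b'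
  simp only [phi, conjTranspose_apply, of_apply, star_sum, star_mul']
  rw [Finset.sum_comm]
  refine Finset.sum_congr rfl fun a _ => Finset.sum_congr rfl fun a' _ => ?_
  rw [hX.apply, hM.apply]

lemma phi_psd {M : Matrix (A × B) (A × B) ℂ} (hM : M.PosSemidef) {X : Matrix A A ℂ}
    (hX : X.PosSemidef) : (phi M X).PosSemidef := by
  refine PosSemidef.of_dotProduct_mulVec_nonneg (phi_herm hM.1 hX.1) fun v => ?_
  have h := trace_mul_nonneg (hX.kronecker (posSemidef_vecMulVec_self_star v)) hM
  rw [← phi_trace, vecMulVec_mul, trace_vecMulVec, dotProduct_comm, ← dotProduct_mulVec] at h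
  exact h

lemma phi_pd {M : Matrix (A × B) (A × B) ℂ} (hM : M.PosSemidef) {ε : ℝ} (hε : 0 < ε)
    {X : Matrix A A ℂ} (hX : X.PosSemidef) (hX0 : 0 < X.trace.re) :
    (phi (M + ε • 1) X).PosDef := by
  rw [phi_add_left, phi_smul_one]
  refine PosDef.posSemidef_add (phi_psd hM hX) ?_
  refine PosDef.smul PosDef.one ?_
  have h1 := hX.trace_nonneg
  have h2 := (Complex.le_def.1 h1).2
  rw [Complex.lt_def]
  simp at h2 ⊢
  exact ⟨by positivity, Or.inr h2.symm⟩

lemma sw_psd {M : Matrix (A × B) (A × B) ℂ} (hM : M.PosSemidef) : (sw M).PosSemidef :=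
  hM.submatrix _

lemma sw_sw (M : Matrix (A × B) (A × B) ℂ) : sw (sw M) = M := by
  ext i j; rfl

end phi

lemma half_bound {A : Type*} [Fintype A] [DecidableEq A] {α : ℝ} (hα : α ∈ Set.Ioc (0 : ℝ) (1 / 2))
    (σ σ' : MState A) (hσ : σ.mat.PosDef) :
    ∃ X : Matrix A A ℂ, X.IsHermitian ∧ (X * X).trace.re ≤ 1 ∧
      X = mpow σ.mat ((1 - 2 * α) / 4) * mpow σ'.mat α * mpow σ.mat ((1 - 2 * α) / 4) ∧
      mpow σ.mat (-((1 - 2 * α) / 4)) * X * mpow σ.mat (-((1 - 2 * α) / 4)) = mpow σ'.mat α := by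
  set c := (1 - 2 * α) / 4 with hc
  have hS := σ.posSemidef
  have hS' := σ'.posSemidef
  refine ⟨_, ?_, ?_, rfl, ?_⟩
  · have h := (mpow_psd hS' α).mul_mul_conjTranspose_same (mpow σ.mat c)
    rw [(mpow_psd hS c).1.eq] at h
    exact h.1
  · have e1 : (mpow σ.mat c * mpow σ'.mat α * mpow σ.mat c *
        (mpow σ.mat c * mpow σ'.mat α * mpow σ.mat c)).trace =
        (mpow σ.mat (c + c) * mpow σ'.mat α * mpow σ.mat (c + c) * mpow σ'.mat α).trace := by
      rw [← mpow_mul hS c c]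
      rw [← mul_assoc, trace_mul_comm]
      simp only [mul_assoc]
    have e2 := trace_abab (mpow_psd hS (c + c)).1 (mpow_psd hS' α).1
    rw [mpow_mul hS, mpow_mul hS', trace_mul_comm (mpow σ.mat (c + c + (c + c)))] at e2
    have e3 := young_le σ' σ (s := α + α) (by linarith [hα.1]) (by linarith [hα.2])
    have e4 : 1 - (α + α) = c + c + (c + c) := by rw [hc]; ring
    rw [e4] at e3
    rw [e1]
    linarith
  · have h1 : mpow σ.mat (-c) * mpow σ.mat c = 1 := by
      rw [mpow_mul hS]; simp [mpow_zero' hσ]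
    have h2 : mpow σ.mat c * mpow σ.mat (-c) = 1 := by
      rw [mpow_mul hS]; simp [mpow_zero' hσ]
    calc _ = (mpow σ.mat (-c) * mpow σ.mat c) * mpow σ'.mat α *
          (mpow σ.mat c * mpow σ.mat (-c)) := by simp only [mul_assoc]
      _ = _ := by rw [h1, h2, one_mul, mul_one]

/-- A positive definite stationary pair is a global maximizer. -/
lemma stat_bound {A B : Type*} [Fintype A] [DecidableEq A] [Fintype B] [DecidableEq B]
    {α : ℝ} (hα : α ∈ Set.Ioc (0 : ℝ) (1 / 2))
    {M : Matrix (A × B) (A × B) ℂ} (hM : M.PosSemidef) (σ : MState A) (τ : MState B)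
    (hσ : σ.mat.PosDef) (hτ : τ.mat.PosDef) {l : ℝ} (hl : 0 < l)
    (h1 : phi M (mpow σ.mat α) = l • mpow τ.mat (1 - α))
    (h2 : phi (sw M) (mpow τ.mat α) = l • mpow σ.mat (1 - α))
    (σ' : MState A) (τ' : MState B) :
    ((mpow σ'.mat α ⊗ₖ mpow τ'.mat α) * M).trace.re ≤ l := by
  obtain ⟨X, hX, hX1, hX2, hX3⟩ := half_bound hα σ σ' hσ
  obtain ⟨Y, hY, hY1, hY2, hY3⟩ := half_bound hα τ τ' hτ
  set c := (1 - 2 * α) / 4 with hc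
  have hS := σ.posSemidef
  have hT := τ.posSemidef
  set s := mpow σ.mat (-c) with hs
  set t := mpow τ.mat (-c) with ht
  have hsh : sᴴ = s := (mpow_psd hS (-c)).1.eq
  have hth : tᴴ = t := (mpow_psd hT (-c)).1.eq
  have main := l2_contr (fun X => l⁻¹ • (t * phi M (s * X * s) * t))
    (fun Y => l⁻¹ • (s * phi (sw M) (t * Y * t) * s))
    (fun X Y => by simp only [mul_add, add_mul, phi_add, smul_add])
    (fun X Y => by simp only [mul_add, add_mul, phi_add, smul_add])
    (fun k X => by
      simp only [Matrix.mul_smul, Matrix.smul_mul, phi_smul]; rw [smul_comm])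
    (fun k X => by
      simp only [Matrix.mul_smul, Matrix.smul_mul, phi_smul]; rw [smul_comm])
    (fun X hX => by
      have a1 := hX.mul_mul_conjTranspose_same s
      have a2 := (phi_psd hM a1).mul_mul_conjTranspose_same t
      rw [hsh, hth] at a2
      exact a2.smul (inv_pos.2 hl).le)
    (fun X hX => by
      have a1 := hX.mul_mul_conjTranspose_same t
      have a2 := (phi_psd (sw_psd hM) a1).mul_mul_conjTranspose_same s
      rw [hsh, hth] at a2
      exact a2.smul (inv_pos.2 hl).le)
    (fun X hX => by
      have a1 := isHermitian_mul_mul_conjTranspose s hX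
      have a2 := isHermitian_mul_mul_conjTranspose t (phi_herm hM.1 a1)
      rw [hsh, hth] at a2
      unfold IsHermitian at *
      rw [conjTranspose_smul, a2]; simp)
    (fun X Y => by
      simp only [Matrix.mul_smul, Matrix.smul_mul, trace_smul]
      congr 1
      have b1 : (Y * (t * phi M (s * X * s) * t)).trace =
          ((t * Y * t) * phi M (s * X * s)).trace := by
        rw [← mul_assoc, trace_mul_comm]; simp only [mul_assoc]
      have b2 : (s * phi (sw M) (t * Y * t) * s * X).trace =
          (phi (sw M) (t * Y * t) * (s * X * s)).trace := by
        rw [mul_assoc, mul_assoc, trace_mul_comm]; simp only [mul_assoc]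
      rw [b1, b2, phi_adj])
    (P := mpow σ.mat (1/2)) (R := mpow τ.mat (1/2)) (mpow_pd hσ _)
    (by
      have b1 : s * mpow σ.mat (1/2) * s = mpow σ.mat α := by
        rw [hs, mpow_mul hS, mpow_mul hS]; congr 1; rw [hc]; ring
      have b2 : t * mpow τ.mat (1 - α) * t = mpow τ.mat (1/2) := by
        rw [ht, mpow_mul hT, mpow_mul hT]; congr 1; rw [hc]; ring
      simp only [b1, h1, Matrix.mul_smul, Matrix.smul_mul, b2]
      rw [smul_smul, inv_mul_cancel₀ hl.ne', one_smul])
    (by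
      have b1 : t * mpow τ.mat (1/2) * t = mpow τ.mat α := by
        rw [ht, mpow_mul hT, mpow_mul hT]; congr 1; rw [hc]; ring
      have b2 : s * mpow σ.mat (1 - α) * s = mpow σ.mat (1/2) := by
        rw [hs, mpow_mul hS, mpow_mul hS]; congr 1; rw [hc]; ring
      simp only [b1, h2, Matrix.mul_smul, Matrix.smul_mul, b2]
      rw [smul_smul, inv_mul_cancel₀ hl.ne', one_smul])
    hX hY
  simp only [hX3] at main
  have b1 : (Y * (t * phi M (mpow σ'.mat α) * t)).trace =
      ((t * Y * t) * phi M (mpow σ'.mat α)).trace := by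
    rw [← mul_assoc, trace_mul_comm]; simp only [mul_assoc]
  rw [Matrix.mul_smul, trace_smul, b1, hY3, phi_trace, Complex.smul_re, smul_eq_mul] at main
  have : l⁻¹ * ((mpow σ'.mat α ⊗ₖ mpow τ'.mat α) * M).trace.re ≤ 1 := by linarith
  rwa [inv_mul_le_iff₀ hl, mul_one] at this
/-! ### Maximizers -/

/-- State from a spectral representation. -/
def mkSt {A : Type*} [Fintype A] [DecidableEq A] (V : Matrix A A ℂ) (d : A → ℝ)
    (hV' : Vᴴ * V = 1) (hd : ∀ i, 0 ≤ d i) (hs : ∑ i, d i = 1) : MState A where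
  mat := ud V d
  posSemidef := ud_psd V hd
  trace_one := by rw [ud_trace hV', hs]; simp

lemma isCompact_unit (A : Type*) [Fintype A] [DecidableEq A] :
    IsCompact {V : Matrix A A ℂ | V * Vᴴ = 1} := by
  have hc : IsCompact (Set.univ.pi fun _ : A => Set.univ.pi fun _ : A =>
      Metric.closedBall (0 : ℂ) 1) :=
    isCompact_univ_pi fun _ => isCompact_univ_pi fun _ => isCompact_closedBall _ _
  refine IsCompact.of_isClosed_subset (s := (Set.univ.pi fun _ : A => Set.univ.pi fun _ : A =>
      Metric.closedBall (0 : ℂ) 1 : Set (Matrix A A ℂ))) hc ?_ ?_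
  · exact isClosed_eq (by fun_prop) continuous_const
  · intro V hV i _ j _
    have : V ∈ Matrix.unitaryGroup A ℂ := mem_unitaryGroup_iff.2 hV
    simpa using entry_norm_bound_of_unitary this i j

lemma exists_max {A B : Type*} [Fintype A] [DecidableEq A] [Fintype B] [DecidableEq B]
    [Nonempty A] [Nonempty B] {α : ℝ} (hα : 0 < α) (M : Matrix (A × B) (A × B) ℂ) :
    ∃ (σ : MState A) (τ : MState B), ∀ (σ' : MState A) (τ' : MState B),
      ((mpow σ'.mat α ⊗ₖ mpow τ'.mat α) * M).trace.re ≤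
        ((mpow σ.mat α ⊗ₖ mpow τ.mat α) * M).trace.re := by
  classical
  set K : Set ((Matrix A A ℂ × (A → ℝ)) × (Matrix B B ℂ × (B → ℝ))) :=
    ({V : Matrix A A ℂ | V * Vᴴ = 1} ×ˢ stdSimplex ℝ A) ×ˢ
    ({V : Matrix B B ℂ | V * Vᴴ = 1} ×ˢ stdSimplex ℝ B) with hK
  have hKc : IsCompact K := ((isCompact_unit A).prod (isCompact_stdSimplex ℝ A)).prod
    ((isCompact_unit B).prod (isCompact_stdSimplex ℝ B))
  have hKn : K.Nonempty := by
    refine ⟨((1, Pi.single (Classical.arbitrary A) 1), (1, Pi.single (Classical.arbitrary B) 1)),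
      ⟨?_, ?_⟩, ?_, ?_⟩
    · simp
    · exact single_mem_stdSimplex ℝ _
    · simp
    · exact single_mem_stdSimplex ℝ _
  set g : ((Matrix A A ℂ × (A → ℝ)) × (Matrix B B ℂ × (B → ℝ))) → ℝ := fun x =>
    ((ud x.1.1 (fun i => x.1.2 i ^ α) ⊗ₖ ud x.2.1 (fun i => x.2.2 i ^ α)) * M).trace.re with hg
  have hcd : ∀ {C : Type _} [Fintype C] [DecidableEq C],
      Continuous fun x : Matrix C C ℂ × (C → ℝ) => ud x.1 (fun i => x.2 i ^ α) := by
    intro C _ _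
    unfold ud
    refine Continuous.matrix_mul (Continuous.matrix_mul continuous_fst ?_) (by fun_prop)
    refine Continuous.matrix_diagonal ?_
    refine continuous_pi fun i => ?_
    refine Complex.continuous_ofReal.comp ?_
    exact Continuous.rpow_const (by fun_prop) (fun _ => Or.inr hα.le)
  have hcd' : ∀ {C : Type _} [Fintype C] [DecidableEq C],
      Continuous fun x : Matrix C C ℂ × (C → ℝ) => ud x.1 (fun i => x.2 i ^ α) := by
    intro C _ _
    unfold ud
    refine Continuous.matrix_mul (Continuous.matrix_mul continuous_fst ?_) (by fun_prop)
    refine Continuous.matrix_diagonal ?_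
    refine continuous_pi fun i => ?_
    refine Complex.continuous_ofReal.comp ?_
    exact Continuous.rpow_const (by fun_prop) (fun _ => Or.inr hα.le)
  have hgc : Continuous g := by
    refine Complex.continuous_re.comp ?_
    refine Continuous.matrix_trace ?_
    refine Continuous.matrix_mul ?_ continuous_const
    refine continuous_matrix fun i j => ?_
    simp only [kroneckerMap_apply]
    exact ((hcd.comp continuous_fst).matrix_elem _ _).mul
      ((hcd'.comp continuous_snd).matrix_elem _ _)
  obtain ⟨⟨⟨V, d⟩, ⟨W, e⟩⟩, hmem, hmax⟩ := hKc.exists_isMaxOn hKn hgc.continuousOn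
  obtain ⟨⟨hV, hd⟩, ⟨hW, he⟩⟩ := hmem
  simp only [Set.mem_ofPred_eq] at hV hW
  have hV' : Vᴴ * V = 1 := mul_eq_one_comm.1 hV
  have hW' : Wᴴ * W = 1 := mul_eq_one_comm.1 hW
  refine ⟨mkSt V d hV' hd.1 hd.2, mkSt W e hW' he.1 he.2, fun σ' τ' => ?_⟩
  obtain ⟨V', d', h1, h2, h3, h4, h5, h6⟩ := state_spec σ'
  obtain ⟨W', e', g1, g2, g3, g4, g5, g6⟩ := state_spec τ'
  have hh := hmax (show ((V', d'), (W', e')) ∈ K from ⟨⟨h1, h3, h6⟩, ⟨g1, g3, g6⟩⟩)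
  simp only [hg, Set.mem_ofPred_eq] at hh
  rw [h5, g5]
  show _ ≤ ((mpow (ud V d) α ⊗ₖ mpow (ud W e) α) * M).trace.re
  rw [mpow_ud hV hV', mpow_ud hW hW']
  simp only [pw_eq hα.ne']
  exact hh

lemma trace_mpow_pos {A : Type*} [Fintype A] [DecidableEq A] (σ : MState A) (p : ℝ) :
    0 < (mpow σ.mat p).trace.re := by
  have hp := mpow_psd σ.posSemidef p
  have h0 := Complex.le_def.1 hp.trace_nonneg
  refine lt_of_le_of_ne h0.1 fun h => ?_
  have : (mpow σ.mat p).trace = 0 := Complex.ext h.symm h0.2.symm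
  rw [hp.trace_eq_zero_iff] at this
  have h2 := mpow_mul σ.posSemidef p (1 - p)
  rw [this, zero_mul, add_sub_cancel, mpow_one' σ.posSemidef] at h2
  have := σ.trace_one
  rw [← h2] at this
  simp at this

lemma opt_stat {A : Type*} [Fintype A] [DecidableEq A] [Nonempty A] {α : ℝ} (hα : 0 < α)
    (hα1 : α < 1) {Z : Matrix A A ℂ} (hZ : Z.PosDef) (σ : MState A)
    (hmax : ∀ σ' : MState A, (mpow σ'.mat α * Z).trace.re ≤ (mpow σ.mat α * Z).trace.re) :
    σ.mat.PosDef ∧ 0 < (mpow σ.mat α * Z).trace.re ∧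
      Z = (mpow σ.mat α * Z).trace.re • mpow σ.mat (1 - α) := by
  obtain ⟨V, z, h1, h2, h3, h4, -⟩ := pd_spec hZ
  have hb : 0 < 1 - α := by linarith
  set q := (1 - α)⁻¹ with hq
  set t := ∑ i, z i ^ q with ht
  have htp : 0 < t := Finset.sum_pos (fun i _ => Real.rpow_pos_of_pos (h3 i) _)
    Finset.univ_nonempty
  set d : A → ℝ := fun i => z i ^ q / t with hd
  have hdp : ∀ i, 0 < d i := fun i => div_pos (Real.rpow_pos_of_pos (h3 i) _) htp
  have hds : ∑ i, d i = 1 := by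
    simp only [hd]; rw [← Finset.sum_div]; exact div_self htp.ne'
  set ω := mkSt V d h2 (fun i => (hdp i).le) hds with hω
  have hωm : ω.mat = ud V d := rfl
  have hl : 0 < t ^ (1 - α) := Real.rpow_pos_of_pos htp _
  have hZω : Z = t ^ (1 - α) • mpow ω.mat (1 - α) := by
    rw [hωm, mpow_ud h1 h2, ud_smul, h4]
    congr 1; ext i
    rw [pw_eq hb.ne', ← Real.mul_rpow htp.le (hdp i).le]
    simp only [hd]
    rw [mul_div_cancel₀ _ htp.ne', ← Real.rpow_mul (h3 i).le, hq, inv_mul_cancel₀ hb.ne',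
      Real.rpow_one]
  have e1 : ∀ σ' : MState A, (mpow σ'.mat α * Z).trace.re =
      t ^ (1 - α) * (mpow σ'.mat α * mpow ω.mat (1 - α)).trace.re := by
    intro σ'
    conv_lhs => rw [hZω]
    rw [Matrix.mul_smul, trace_smul, Complex.smul_re, smul_eq_mul]
  have e2 : (mpow ω.mat α * mpow ω.mat (1 - α)).trace.re = 1 := by
    rw [mpow_mul ω.posSemidef, add_sub_cancel, mpow_one' ω.posSemidef, ω.trace_one]; simp
  have h := hmax ω
  rw [e1, e1, e2, mul_one] at h
  have h' : 1 ≤ (mpow σ.mat α * mpow ω.mat (1 - α)).trace.re :=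
    le_of_mul_le_mul_left (by linarith) hl
  have heq := young_eq σ ω hα hα1 h'
  have e3 : (mpow σ.mat α * Z).trace.re = t ^ (1 - α) := by
    rw [e1, heq, e2, mul_one]
  rw [e3, heq]
  exact ⟨ud_pd h1 hdp, hl, hZω⟩

lemma max_stat {A B : Type*} [Fintype A] [DecidableEq A] [Fintype B] [DecidableEq B]
    [Nonempty A] [Nonempty B] {α : ℝ} (hα : 0 < α) (hα1 : α < 1)
    {M : Matrix (A × B) (A × B) ℂ} (hM : M.PosSemidef) {ε : ℝ} (hε : 0 < ε) :
    ∃ (σ : MState A) (τ : MState B) (l : ℝ), σ.mat.PosDef ∧ τ.mat.PosDef ∧ 0 < l ∧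
      phi (M + ε • 1) (mpow σ.mat α) = l • mpow τ.mat (1 - α) ∧
      phi (sw (M + ε • 1)) (mpow τ.mat α) = l • mpow σ.mat (1 - α) ∧
      l = ((mpow σ.mat α ⊗ₖ mpow τ.mat α) * (M + ε • 1)).trace.re := by
  obtain ⟨σ, τ, hmax⟩ := exists_max (A := A) (B := B) hα (M + ε • 1)
  have hsw : sw (M + ε • 1) = sw M + ε • (1 : Matrix (B × A) (B × A) ℂ) := by
    ext i j
    simp [sw, one_apply, Prod.swap_inj]
  have z1 : (phi (M + ε • 1) (mpow σ.mat α)).PosDef :=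
    phi_pd hM hε (mpow_psd σ.posSemidef α) (trace_mpow_pos σ α)
  have z2 : (phi (sw (M + ε • 1)) (mpow τ.mat α)).PosDef := by
    rw [hsw]
    exact phi_pd (sw_psd hM) hε (mpow_psd τ.posSemidef α) (trace_mpow_pos τ α)
  obtain ⟨a1, a2, a3⟩ := opt_stat hα hα1 z1 τ (fun τ' => by
    rw [phi_trace, phi_trace]; exact hmax σ τ')
  obtain ⟨b1, b2, b3⟩ := opt_stat hα hα1 z2 σ (fun σ' => by
    rw [phi_trace, phi_trace, sw_trace, sw_trace]; exact hmax σ' τ)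
  rw [phi_trace] at a2 a3
  rw [phi_trace, sw_trace] at b2 b3
  exact ⟨σ, τ, _, b1, a1, a2, a3, b3, rfl⟩
/-! ### Products -/

/-- Reindexed tensor product. -/
def tp {A₁ B₁ A₂ B₂ : Type*} (M : Matrix (A₁ × B₁) (A₁ × B₁) ℂ)
    (N : Matrix (A₂ × B₂) (A₂ × B₂) ℂ) :
    Matrix ((A₁ × A₂) × (B₁ × B₂)) ((A₁ × A₂) × (B₁ × B₂)) ℂ :=
  Matrix.reindex (Equiv.prodProdProdComm A₁ B₁ A₂ B₂)
            (Equiv.prodProdProdComm A₁ B₁ A₂ B₂) (M ⊗ₖ N)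

section tp
variable {A₁ B₁ A₂ B₂ : Type*}
    [Fintype A₁] [DecidableEq A₁] [Fintype B₁] [DecidableEq B₁]
    [Fintype A₂] [DecidableEq A₂] [Fintype B₂] [DecidableEq B₂]
set_option linter.unusedSectionVars false

lemma tp_psd {M : Matrix (A₁ × B₁) (A₁ × B₁) ℂ} {N : Matrix (A₂ × B₂) (A₂ × B₂) ℂ}
    (hM : M.PosSemidef) (hN : N.PosSemidef) : (tp M N).PosSemidef :=
  (hM.kronecker hN).submatrix _

lemma sw_tp (M : Matrix (A₁ × B₁) (A₁ × B₁) ℂ) (N : Matrix (A₂ × B₂) (A₂ × B₂) ℂ) :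
    sw (tp M N) = tp (sw M) (sw N) := by
  ext i j; rfl

lemma phi_tp (M : Matrix (A₁ × B₁) (A₁ × B₁) ℂ) (N : Matrix (A₂ × B₂) (A₂ × B₂) ℂ)
    (X : Matrix A₁ A₁ ℂ) (Y : Matrix A₂ A₂ ℂ) :
    phi (tp M N) (X ⊗ₖ Y) = phi M X ⊗ₖ phi N Y := by
  ext ⟨b1, b2⟩ ⟨b1', b2'⟩
  simp only [phi, of_apply, kroneckerMap_apply, Fintype.sum_prod_type, Finset.sum_mul_sum]
  refine Finset.sum_congr rfl fun a _ => Finset.sum_congr rfl fun a' _ =>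
    Finset.sum_congr rfl fun c _ => Finset.sum_congr rfl fun c' _ => ?_
  show X a c * Y a' c' * (M (c, b1) (a, b1') * N (c', b2) (a', b2')) = _
  ring

lemma tp_trace (M : Matrix (A₁ × B₁) (A₁ × B₁) ℂ) (N : Matrix (A₂ × B₂) (A₂ × B₂) ℂ)
    (X : Matrix A₁ A₁ ℂ) (Y : Matrix A₂ A₂ ℂ) (X' : Matrix B₁ B₁ ℂ) (Y' : Matrix B₂ B₂ ℂ) :
    (((X ⊗ₖ Y) ⊗ₖ (X' ⊗ₖ Y')) * tp M N).trace
      = ((X ⊗ₖ X') * M).trace * ((Y ⊗ₖ Y') * N).trace := by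
  rw [← phi_trace, phi_tp, ← mul_kronecker_mul, trace_kronecker, phi_trace, phi_trace]

/-- Product state. -/
def prodSt {A B : Type*} [Fintype A] [DecidableEq A] [Fintype B] [DecidableEq B]
    (σ : MState A) (τ : MState B) : MState (A × B) where
  mat := σ.mat ⊗ₖ τ.mat
  posSemidef := σ.posSemidef.kronecker τ.posSemidef
  trace_one := by rw [trace_kronecker, σ.trace_one, τ.trace_one, one_mul]

lemma tp_trace_st {α : ℝ} {M : Matrix (A₁ × B₁) (A₁ × B₁) ℂ} {N : Matrix (A₂ × B₂) (A₂ × B₂) ℂ}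
    (hM : M.PosSemidef)
    (σ : MState A₁) (σ' : MState A₂) (τ : MState B₁) (τ' : MState B₂) :
    ((mpow (prodSt σ σ').mat α ⊗ₖ mpow (prodSt τ τ').mat α) * tp M N).trace.re =
      ((mpow σ.mat α ⊗ₖ mpow τ.mat α) * M).trace.re *
      ((mpow σ'.mat α ⊗ₖ mpow τ'.mat α) * N).trace.re := by
  have e1 : mpow (prodSt σ σ').mat α = mpow σ.mat α ⊗ₖ mpow σ'.mat α :=
    mpow_kron σ.posSemidef σ'.posSemidef α
  have e2 : mpow (prodSt τ τ').mat α = mpow τ.mat α ⊗ₖ mpow τ'.mat α :=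
    mpow_kron τ.posSemidef τ'.posSemidef α
  rw [e1, e2, tp_trace, Complex.mul_re]
  have h := trace_mul_nonneg ((mpow_psd σ.posSemidef α).kronecker (mpow_psd τ.posSemidef α)) hM
  have h' := (Complex.le_def.1 h).2
  rw [← h']; simp

lemma trace_mono {C : Type*} [Fintype C] [DecidableEq C] {X M N : Matrix C C ℂ}
    (hX : X.PosSemidef) (h : (N - M).PosSemidef) :
    (X * M).trace.re ≤ (X * N).trace.re := by
  have := (Complex.le_def.1 (trace_mul_nonneg hX h)).1
  rw [mul_sub, trace_sub, Complex.sub_re, Complex.zero_re] at this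
  linarith

lemma tp_bound_eps [Nonempty A₁] [Nonempty B₁] [Nonempty A₂] [Nonempty B₂]
    {α : ℝ} (hα : α ∈ Set.Ioc (0 : ℝ) (1 / 2))
    {M : Matrix (A₁ × B₁) (A₁ × B₁) ℂ} {N : Matrix (A₂ × B₂) (A₂ × B₂) ℂ}
    (hM : M.PosSemidef) (hN : N.PosSemidef) {F G K L : ℝ}
    (hF : ∀ (σ : MState A₁) (τ : MState B₁),
      ((mpow σ.mat α ⊗ₖ mpow τ.mat α) * M).trace.re ≤ F)
    (hG : ∀ (σ : MState A₂) (τ : MState B₂),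
      ((mpow σ.mat α ⊗ₖ mpow τ.mat α) * N).trace.re ≤ G)
    (hK : ∀ (σ : MState A₁) (τ : MState B₁),
      ((mpow σ.mat α ⊗ₖ mpow τ.mat α) * 1).trace.re ≤ K)
    (hL : ∀ (σ : MState A₂) (τ : MState B₂),
      ((mpow σ.mat α ⊗ₖ mpow τ.mat α) * 1).trace.re ≤ L)
    (σ : MState (A₁ × A₂)) (τ : MState (B₁ × B₂)) {ε : ℝ} (hε : 0 < ε) :
    ((mpow σ.mat α ⊗ₖ mpow τ.mat α) * tp M N).trace.re ≤ (F + ε * K) * (G + ε * L) := by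
  have hα1 : α < 1 := by linarith [hα.2]
  obtain ⟨σ₁, τ₁, l, a1, a2, a3, a4, a5, a6⟩ := max_stat (A := A₁) (B := B₁) hα.1 hα1 hM hε
  obtain ⟨σ₂, τ₂, m, b1, b2, b3, b4, b5, b6⟩ := max_stat (A := A₂) (B := B₂) hα.1 hα1 hN hε
  have hε1 : (ε • (1 : Matrix (A₁ × B₁) (A₁ × B₁) ℂ)).PosSemidef := PosSemidef.one.smul hε.le
  have hε2 : (ε • (1 : Matrix (A₂ × B₂) (A₂ × B₂) ℂ)).PosSemidef := PosSemidef.one.smul hε.le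
  have hM' := hM.add hε1
  have hN' := hN.add hε2
  have k1 : ∀ p, mpow (prodSt σ₁ σ₂).mat p = mpow σ₁.mat p ⊗ₖ mpow σ₂.mat p :=
    mpow_kron σ₁.posSemidef σ₂.posSemidef
  have k2 : ∀ p, mpow (prodSt τ₁ τ₂).mat p = mpow τ₁.mat p ⊗ₖ mpow τ₂.mat p :=
    mpow_kron τ₁.posSemidef τ₂.posSemidef
  have hst := stat_bound hα (tp_psd hM' hN') (prodSt σ₁ σ₂) (prodSt τ₁ τ₂)
    (a1.kronecker b1) (a2.kronecker b2) (mul_pos a3 b3)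
    (by rw [k1, k2, phi_tp, a4, b4, smul_kronecker, kronecker_smul, smul_smul])
    (by rw [k1, k2, sw_tp, phi_tp, a5, b5, smul_kronecker, kronecker_smul, smul_smul]) σ τ
  have hl : l ≤ F + ε * K := by
    rw [a6, mul_add, Matrix.mul_smul, trace_add, trace_smul, Complex.add_re, Complex.smul_re,
      smul_eq_mul]
    have := hF σ₁ τ₁
    have := mul_le_mul_of_nonneg_left (hK σ₁ τ₁) hε.le
    linarith
  have hm : m ≤ G + ε * L := by
    rw [b6, mul_add, Matrix.mul_smul, trace_add, trace_smul, Complex.add_re, Complex.smul_re,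
      smul_eq_mul]
    have := hG σ₂ τ₂
    have := mul_le_mul_of_nonneg_left (hL σ₂ τ₂) hε.le
    linarith
  have hmono : ((mpow σ.mat α ⊗ₖ mpow τ.mat α) * tp M N).trace.re ≤
      ((mpow σ.mat α ⊗ₖ mpow τ.mat α) * tp (M + ε • 1) (N + ε • 1)).trace.re := by
    apply trace_mono ((mpow_psd σ.posSemidef α).kronecker (mpow_psd τ.posSemidef α))
    have : tp (M + ε • 1) (N + ε • 1) - tp M N = tp (ε • 1) (N + ε • 1) + tp M (ε • 1) := by
      ext i j
      simp only [tp, reindex_apply, submatrix_apply, Matrix.sub_apply, Matrix.add_apply, kroneckerMap_apply]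
      ring
    rw [this]
    exact (tp_psd hε1 hN').add (tp_psd hM hε2)
  calc _ ≤ _ := hmono
    _ ≤ l * m := hst
    _ ≤ _ := mul_le_mul hl hm b3.le (a3.le.trans hl)

lemma tp_bound [Nonempty A₁] [Nonempty B₁] [Nonempty A₂] [Nonempty B₂]
    {α : ℝ} (hα : α ∈ Set.Ioc (0 : ℝ) (1 / 2))
    {M : Matrix (A₁ × B₁) (A₁ × B₁) ℂ} {N : Matrix (A₂ × B₂) (A₂ × B₂) ℂ}
    (hM : M.PosSemidef) (hN : N.PosSemidef) {F G : ℝ}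
    (hF : ∀ (σ : MState A₁) (τ : MState B₁),
      ((mpow σ.mat α ⊗ₖ mpow τ.mat α) * M).trace.re ≤ F)
    (hG : ∀ (σ : MState A₂) (τ : MState B₂),
      ((mpow σ.mat α ⊗ₖ mpow τ.mat α) * N).trace.re ≤ G)
    (σ : MState (A₁ × A₂)) (τ : MState (B₁ × B₂)) :
    ((mpow σ.mat α ⊗ₖ mpow τ.mat α) * tp M N).trace.re ≤ F * G := by
  obtain ⟨s1, t1, hK⟩ := exists_max (A := A₁) (B := B₁) hα.1 1
  obtain ⟨s2, t2, hL⟩ := exists_max (A := A₂) (B := B₂) hα.1 1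
  set K := ((mpow s1.mat α ⊗ₖ mpow t1.mat α) * 1).trace.re
  set L := ((mpow s2.mat α ⊗ₖ mpow t2.mat α) * 1).trace.re
  have hc : Filter.Tendsto (fun ε : ℝ => (F + ε * K) * (G + ε * L)) (nhdsWithin 0 (Set.Ioi 0))
      (nhds (F * G)) := by
    have : Continuous (fun ε : ℝ => (F + ε * K) * (G + ε * L)) := by fun_prop
    have h := this.tendsto 0
    simp only [zero_mul, add_zero] at h
    exact h.mono_left nhdsWithin_le_nhds
  refine ge_of_tendsto hc ?_
  filter_upwards [self_mem_nhdsWithin] with ε hε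
  exact tp_bound_eps hα hM hN hF hG hK hL σ τ hε

end tp

/-! ### Values of the infimum -/

lemma iInf_value {A B : Type*} [Fintype A] [DecidableEq A] [Fintype B] [DecidableEq B]
    {α : ℝ} (hα1 : α < 1) (R : Matrix (A × B) (A × B) ℂ) (hR : R.PosSemidef) {F : ℝ} (hF : 0 < F)
    (hb : ∀ (σ : MState A) (τ : MState B),
      ((mpow σ.mat α ⊗ₖ mpow τ.mat α) * mpow R (1 - α)).trace.re ≤ F)
    (he : ∃ (σ : MState A) (τ : MState B),
      ((mpow σ.mat α ⊗ₖ mpow τ.mat α) * mpow R (1 - α)).trace.re = F) :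
    (⨅ (σ : MState A) (τ : MState B), DRenyi α (σ.mat ⊗ₖ τ.mat) R)
      = (((α - 1)⁻¹ * Real.log F : ℝ) : EReal) := by
  have hQ : ∀ (σ : MState A) (τ : MState B), QRenyi α (σ.mat ⊗ₖ τ.mat) R =
      ((mpow σ.mat α ⊗ₖ mpow τ.mat α) * mpow R (1 - α)).trace.re := fun σ τ => by
    unfold QRenyi
    rw [mpow_kron σ.posSemidef τ.posSemidef]
  apply le_antisymm
  · obtain ⟨σ, τ, h⟩ := he
    refine (iInf₂_le σ τ).trans ?_
    unfold DRenyi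
    rw [hQ, h, if_neg hF.ne']
  · refine le_iInf₂ fun σ τ => ?_
    unfold DRenyi
    rw [hQ]
    split_ifs with h0
    · exact le_top
    · rw [EReal.coe_le_coe_iff]
      have hn := (Complex.le_def.1 (trace_mul_nonneg ((mpow_psd σ.posSemidef α).kronecker
        (mpow_psd τ.posSemidef α)) (mpow_psd hR (1 - α)))).1
      have hp := lt_of_le_of_ne hn (Ne.symm h0)
      have hlog := Real.log_le_log hp (hb σ τ)
      exact mul_le_mul_of_nonpos_left hlog (inv_nonpos.2 (by linarith))

lemma exists_mixed (A : Type*) [Fintype A] [DecidableEq A] [Nonempty A] (α : ℝ) :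
    ∃ (σ : MState A) (c : ℝ), 0 < c ∧ mpow σ.mat α = c • 1 := by
  have hn : (0 : ℝ) < Fintype.card A := by exact_mod_cast Fintype.card_pos
  refine ⟨mkSt 1 (fun _ => (Fintype.card A : ℝ)⁻¹) (by simp) (fun _ => by positivity) ?_,
    pw (Fintype.card A : ℝ)⁻¹ α, pw_pos (by positivity) _, ?_⟩
  · simp
  · show mpow (ud 1 _) α = _
    have h1 := ud_one (V := (1 : Matrix A A ℂ)) (by simp)
    rw [mpow_ud (by simp) (by simp)]
    conv_rhs => rw [← h1, ud_smul]
    simp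

lemma exists_value {A B : Type*} [Fintype A] [DecidableEq A] [Fintype B] [DecidableEq B]
    [Nonempty A] [Nonempty B] {α : ℝ} (hα : 0 < α) (ρ : MState (A × B)) :
    ∃ F : ℝ, 0 < F ∧ (∀ (σ : MState A) (τ : MState B),
      ((mpow σ.mat α ⊗ₖ mpow τ.mat α) * mpow ρ.mat (1 - α)).trace.re ≤ F) ∧
     (∃ (σ : MState A) (τ : MState B),
      ((mpow σ.mat α ⊗ₖ mpow τ.mat α) * mpow ρ.mat (1 - α)).trace.re = F) := by
  obtain ⟨σ, τ, h⟩ := exists_max (A := A) (B := B) hα (mpow ρ.mat (1 - α))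
  refine ⟨_, ?_, h, σ, τ, rfl⟩
  obtain ⟨s, c, hc, hs⟩ := exists_mixed A α
  obtain ⟨t, d, hd, ht⟩ := exists_mixed B α
  refine lt_of_lt_of_le ?_ (h s t)
  rw [hs, ht, smul_kronecker, kronecker_smul, one_kronecker_one, smul_smul, Matrix.smul_mul,
    one_mul, trace_smul, Complex.smul_re, smul_eq_mul]
  exact mul_pos (mul_pos hc hd) (trace_mpow_pos ρ _)

/-- Additivity of the doubly minimized Petz Rényi lautum information (Theorem 1(c)). -/
theorem Ldd_additive {A₁ B₁ A₂ B₂ : Type*}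
    [Fintype A₁] [DecidableEq A₁] [Nonempty A₁] [Fintype B₁] [DecidableEq B₁] [Nonempty B₁]
    [Fintype A₂] [DecidableEq A₂] [Nonempty A₂] [Fintype B₂] [DecidableEq B₂] [Nonempty B₂]
    (α : ℝ) (hα : α ∈ Set.Ioc (0 : ℝ) (1 / 2))
    (ρ : MState (A₁ × B₁)) (ρ' : MState (A₂ × B₂)) :
    (⨅ (σ : MState (A₁ × A₂)) (τ : MState (B₁ × B₂)),
        DRenyi α (σ.mat ⊗ₖ τ.mat)
          (Matrix.reindex (Equiv.prodProdProdComm A₁ B₁ A₂ B₂)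
            (Equiv.prodProdProdComm A₁ B₁ A₂ B₂) (ρ.mat ⊗ₖ ρ'.mat)))
      = Ldd α ρ.mat + Ldd α ρ'.mat := by
  obtain ⟨F, hF, hFb, σ₁, τ₁, hFe⟩ := exists_value hα.1 ρ
  obtain ⟨G, hG, hGb, σ₂, τ₂, hGe⟩ := exists_value hα.1 ρ'
  have hα1 : α < 1 := by linarith [hα.2]
  have hM := mpow_psd ρ.posSemidef (1 - α)
  have hN := mpow_psd ρ'.posSemidef (1 - α)
  have hpow : mpow (Matrix.reindex (Equiv.prodProdProdComm A₁ B₁ A₂ B₂)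
            (Equiv.prodProdProdComm A₁ B₁ A₂ B₂) (ρ.mat ⊗ₖ ρ'.mat)) (1 - α) =
      tp (mpow ρ.mat (1 - α)) (mpow ρ'.mat (1 - α)) := by
    rw [mpow_reindex _ (ρ.posSemidef.kronecker ρ'.posSemidef),
      mpow_kron ρ.posSemidef ρ'.posSemidef]
    rfl
  unfold Ldd
  rw [iInf_value hα1 ρ.mat ρ.posSemidef hF hFb ⟨σ₁, τ₁, hFe⟩,
    iInf_value hα1 ρ'.mat ρ'.posSemidef hG hGb ⟨σ₂, τ₂, hGe⟩,
    iInf_value hα1 (Matrix.reindex (Equiv.prodProdProdComm A₁ B₁ A₂ B₂)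
      (Equiv.prodProdProdComm A₁ B₁ A₂ B₂) (ρ.mat ⊗ₖ ρ'.mat)) (tp_psd ρ.posSemidef ρ'.posSemidef) (mul_pos hF hG)
      (fun σ τ => by
        rw [hpow]
        exact tp_bound hα hM hN hFb hGb σ τ)
      ⟨prodSt σ₁ σ₂, prodSt τ₁ τ₂, by
        rw [hpow, tp_trace_st hM, hFe, hGe]⟩,
    ← EReal.coe_add, Real.log_mul hF.ne' hG.ne', mul_add]

end
end

section
/- Joint concavity of Q_α (Theorem 1(d)): Let A and B be nonempty finite types, α ∈ (0, 1/2], λ ∈ [0,1], λ' := 1 − λ, σ_A and σ_A' states on A, τ_B and τ_B' states on B, and ρ_AB a bipartite state on A × B. Then Q_α((λ·σ_A + λ'·σ_A') ⊗ (λ·τ_B + λ'·τ_B') ‖ ρ_AB) ≥ λ · Q_α(σ_A ⊗ τ_B ‖ ρ_AB) + λ' · Q_α(σ_A' ⊗ τ_B' ‖ ρ_AB). -/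
open scoped BigOperators Kronecker ComplexOrder

noncomputable section

open Polynomial in
theorem aux_aeval_diag {A : Type*} [Fintype A] [DecidableEq A]
    (U : Matrix.unitaryGroup A ℂ) (d : A → ℝ) (q : ℝ[X]) :
    aeval ((U : Matrix A A ℂ) * Matrix.diagonal (fun i => (d i : ℂ)) * star (U : Matrix A A ℂ)) q =
      (U : Matrix A A ℂ) * Matrix.diagonal (fun i => ((q.eval (d i) : ℝ) : ℂ))
        * star (U : Matrix A A ℂ) := by
  have h1 := Unitary.conjStarAlgAut_apply (S := ℝ) (R := Matrix A A ℂ) U (Matrix.diagonal (fun i => (d i : ℂ)))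
  rw [← h1, ← Unitary.conjStarAlgAut_apply (S := ℝ) (R := Matrix A A ℂ)]
  rw [Polynomial.aeval_algHom_apply]
  congr 1
  have h2 : Matrix.diagonal (fun i => (d i : ℂ)) = Matrix.diagonalAlgHom ℝ (fun i => (d i : ℂ)) := rfl
  rw [h2, Polynomial.aeval_algHom_apply]
  simp only [Matrix.diagonalAlgHom_apply]
  congr 1
  funext i
  rw [Polynomial.aeval_pi_apply]
  exact Polynomial.aeval_algebraMap_apply ℂ (d i) q

theorem aux_mpow_diag {A : Type*} [Fintype A] [DecidableEq A]
    (U : Matrix.unitaryGroup A ℂ) (d : A → ℝ) (p : ℝ) :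
    mpow ((U : Matrix A A ℂ) * Matrix.diagonal (fun i => (d i : ℂ)) * star (U : Matrix A A ℂ)) p =
      (U : Matrix A A ℂ) * Matrix.diagonal (fun i => ((if d i = 0 then (0:ℝ) else d i ^ p : ℝ) : ℂ))
        * star (U : Matrix A A ℂ) := by
  have hH : ((U : Matrix A A ℂ) * Matrix.diagonal (fun i => (d i : ℂ)) * star (U : Matrix A A ℂ)).IsHermitian := by
    rw [Matrix.star_eq_conjTranspose]
    apply Matrix.isHermitian_mul_mul_conjTranspose
    rw [Matrix.isHermitian_diagonal_iff]
    intro i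
    simp [IsSelfAdjoint]
  set X := (U : Matrix A A ℂ) * Matrix.diagonal (fun i => (d i : ℂ)) * star (U : Matrix A A ℂ) with hX
  set f : ℝ → ℝ := fun x => if x = 0 then 0 else x ^ p with hf
  set S : Finset ℝ := Finset.univ.image d ∪ Finset.univ.image hH.eigenvalues with hS
  set q := Lagrange.interpolate S id f with hq
  have hq' : ∀ x ∈ S, q.eval x = f x := fun x hx =>
    Lagrange.eval_interpolate_at_node (v := id) f (Function.injective_id.injOn) hx
  have e1 := aux_aeval_diag U d q
  have e2 := aux_aeval_diag hH.eigenvectorUnitary hH.eigenvalues q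
  have e3 := hH.spectral_theorem
  rw [Unitary.conjStarAlgAut_apply] at e3
  have e4 : (hH.eigenvectorUnitary : Matrix A A ℂ) * Matrix.diagonal (fun i => (hH.eigenvalues i : ℂ))
      * star (hH.eigenvectorUnitary : Matrix A A ℂ) = X := e3.symm
  rw [e4] at e2
  rw [← hX, e2] at e1
  have h1 : ∀ i, q.eval (d i) = f (d i) := fun i => hq' _ (by simp [hS])
  have h2 : ∀ i, q.eval (hH.eigenvalues i) = f (hH.eigenvalues i) := fun i => hq' _ (by simp [hS])
  simp only [h1, h2] at e1
  unfold mpow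
  rw [dif_pos hH]
  exact e1

theorem aux_mpow_kron {A B : Type*} [Fintype A] [DecidableEq A] [Fintype B] [DecidableEq B]
    (X : Matrix A A ℂ) (Y : Matrix B B ℂ) (hX : X.PosSemidef) (hY : Y.PosSemidef) (p : ℝ) :
    mpow (X ⊗ₖ Y) p = mpow X p ⊗ₖ mpow Y p := by
  have hu : (hX.1.eigenvectorUnitary : Matrix A A ℂ) ⊗ₖ (hY.1.eigenvectorUnitary : Matrix B B ℂ) ∈
      Matrix.unitaryGroup (A × B) ℂ := 
    Matrix.kronecker_mem_unitary (hX.1.eigenvectorUnitary).2 (hY.1.eigenvectorUnitary).2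
  have e := aux_mpow_diag ⟨_, hu⟩ (fun i => hX.1.eigenvalues i.1 * hY.1.eigenvalues i.2) p
  simp only [Matrix.star_eq_conjTranspose, Matrix.conjTranspose_kronecker] at e
  have k : ∀ (f : A → ℝ) (g : B → ℝ), Matrix.diagonal (fun i : A × B => ((f i.1 * g i.2 : ℝ) : ℂ)) =
      Matrix.diagonal (fun i => (f i : ℂ)) ⊗ₖ Matrix.diagonal (fun i => (g i : ℂ)) := by
    intro f g
    rw [Matrix.diagonal_kronecker_diagonal]
    congr 1; funext i; push_cast; rfl
  have k2 : ∀ i : A × B, (if hX.1.eigenvalues i.1 * hY.1.eigenvalues i.2 = 0 then (0:ℝ) else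
      (hX.1.eigenvalues i.1 * hY.1.eigenvalues i.2) ^ p) =
      (if hX.1.eigenvalues i.1 = 0 then (0:ℝ) else (hX.1.eigenvalues i.1) ^ p) *
      (if hY.1.eigenvalues i.2 = 0 then (0:ℝ) else (hY.1.eigenvalues i.2) ^ p) := by
    intro i
    rw [Real.mul_rpow (hX.eigenvalues_nonneg _) (hY.eigenvalues_nonneg _)]
    split_ifs <;> simp_all
  simp only [k2] at e
  rw [k, k (fun i => if hX.1.eigenvalues i = 0 then (0:ℝ) else (hX.1.eigenvalues i) ^ p)
    (fun i => if hY.1.eigenvalues i = 0 then (0:ℝ) else (hY.1.eigenvalues i) ^ p)] at e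
  simp only [← Matrix.mul_kronecker_mul] at e
  have eX := hX.1.spectral_theorem
  have eY := hY.1.spectral_theorem
  rw [Unitary.conjStarAlgAut_apply] at eX eY
  rw [mpow.eq_1 X, mpow.eq_1 Y, dif_pos hX.1, dif_pos hY.1]
  have eX' : (hX.1.eigenvectorUnitary : Matrix A A ℂ) * Matrix.diagonal (fun i => (hX.1.eigenvalues i : ℂ))
      * (hX.1.eigenvectorUnitary : Matrix A A ℂ).conjTranspose = X := eX.symm
  have eY' : (hY.1.eigenvectorUnitary : Matrix B B ℂ) * Matrix.diagonal (fun i => (hY.1.eigenvalues i : ℂ))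
      * (hY.1.eigenvectorUnitary : Matrix B B ℂ).conjTranspose = Y := eY.symm
  rw [eX', eY'] at e
  exact e
open scoped MatrixOrder Matrix.Norms.L2Operator NNReal in
theorem aux_mpow_eq_nnrpow {A : Type*} [Fintype A] [DecidableEq A] (X : Matrix A A ℂ)
    (hX : X.PosSemidef) (p : ℝ≥0) (hp : 0 < p) : mpow X p = X ^ p := by
  rw [CFC.nnrpow_eq_rpow hp, CFC.rpow_eq_cfc_real (hX.nonneg), hX.1.cfc_eq]
  unfold mpow Matrix.IsHermitian.cfc
  rw [dif_pos hX.1, Unitary.conjStarAlgAut_apply]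
  congr 3
  funext i
  simp only [Function.comp]
  congr 1
  split_ifs with h
  · have hp2 : (p : ℝ) ≠ 0 := by exact_mod_cast hp.ne'
    rw [h, Real.zero_rpow hp2]
    simp
  · rfl

open scoped MatrixOrder Matrix.Norms.L2Operator in
theorem aux_gm_inv {n : Type*} [Fintype n] [DecidableEq n] (P R G : Matrix n n ℂ)
    (hP : P.PosSemidef) (hR : R.PosDef) (hc : Commute P R) (hG : G.IsHermitian)
    (hb : (Matrix.fromBlocks (P * P) G G (R * R)).PosSemidef) : G ≤ P * R := by
  have hRu : IsUnit R := hR.isUnit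
  have hdet : IsUnit R.det := (Matrix.isUnit_iff_isUnit_det R).1 hRu
  have hRR : (R * R).PosDef := by
    have h : (R * R).PosSemidef := by
      have := Matrix.posSemidef_conjTranspose_mul_self R
      rwa [hR.1.eq] at this
    exact h.posDef_iff_isUnit.2 (hRu.mul hRu)
  have h1 : (P * P - G * (R * R)⁻¹ * G).PosSemidef := by
    have := hRR.isUnit.invertible
    have := (Matrix.PosDef.fromBlocks₂₂ (P*P) G hRR).1 (by rwa [hG.eq])
    rwa [hG.eq] at this
  have hRi : (R⁻¹).IsHermitian := hR.1.inv
  have h2 := h1.mul_mul_conjTranspose_same R⁻¹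
  rw [hRi.eq] at h2
  have i1 : R * R⁻¹ = 1 := Matrix.mul_nonsing_inv R hdet
  have i2 : R⁻¹ * R = 1 := Matrix.nonsing_inv_mul R hdet
  have hPc : R⁻¹ * P = P * R⁻¹ := by
    calc R⁻¹ * P = R⁻¹ * (P * R) * R⁻¹ := by rw [mul_assoc, mul_assoc, i1, mul_one]
      _ = P * R⁻¹ := by rw [hc.eq, ← mul_assoc, i2, one_mul]
  set H := R⁻¹ * G * R⁻¹ with hH
  set C := P * R⁻¹ with hC
  have hC0 : 0 ≤ C := Commute.mul_nonneg hP.nonneg hR.inv.posSemidef.nonneg hPc.symm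
  have hHH : IsSelfAdjoint H := by
    have := Matrix.isHermitian_mul_mul_conjTranspose R⁻¹ hG
    rwa [hRi.eq] at this
  have h3 : H * H ≤ C * C := by
    rw [Matrix.le_iff]
    have e0 : C * C - H * H = R⁻¹ * (P * P - G * (R * R)⁻¹ * G) * R⁻¹ := by
      rw [hH, Matrix.mul_inv_rev]
      nth_rewrite 1 [← hPc]
      rw [hC]
      simp only [mul_sub, sub_mul, mul_assoc]
    rw [e0]
    exact h2
  have h4 : H ≤ C := by
    calc H ≤ CFC.abs H := by
          rw [← sub_nonneg, CFC.abs_sub_self H hHH]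
          exact nsmul_nonneg (CFC.negPart_nonneg _) 2
      _ ≤ CFC.sqrt (C * C) := by
          unfold CFC.abs
          rw [hHH.star_eq]
          exact CFC.sqrt_le_sqrt _ _ h3
      _ = C := CFC.sqrt_mul_self C hC0
  have h5 := conjugate_le_conjugate_of_nonneg h4 hR.posSemidef.nonneg
  have e1 : R * H * R = G := by
    rw [hH]; simp only [mul_assoc, i2, mul_one]; rw [← mul_assoc, i1, one_mul]
  have e2 : R * C * R = P * R := by
    rw [hC]; simp only [mul_assoc, i2, mul_one]; exact hc.eq.symm
  rwa [e1, e2] at h5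
open scoped MatrixOrder Matrix.Norms.L2Operator in
theorem aux_psd_fact {n : Type*} [Fintype n] [DecidableEq n] (X : Matrix n n ℂ)
    (hX : X.PosSemidef) : ∃ S : Matrix n n ℂ, X = S.conjTranspose * S :=
  CStarAlgebra.nonneg_iff_eq_star_mul_self.1 hX.nonneg

theorem aux_blockdiag {n : Type*} [Fintype n] [DecidableEq n] (X Y : Matrix n n ℂ)
    (hX : X.PosSemidef) (hY : Y.PosSemidef) : (Matrix.fromBlocks X 0 0 Y).PosSemidef := by
  obtain ⟨S, rfl⟩ := aux_psd_fact X hX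
  obtain ⟨T, rfl⟩ := aux_psd_fact Y hY
  have := Matrix.posSemidef_conjTranspose_mul_self (Matrix.fromBlocks S 0 0 T)
  simpa [Matrix.fromBlocks_conjTranspose, Matrix.fromBlocks_multiply] using this

theorem aux_block {n : Type*} [Fintype n] [DecidableEq n] (p r : Matrix n n ℂ)
    (hp : p.IsHermitian) (hr : r.IsHermitian) (hc : Commute p r) :
    (Matrix.fromBlocks (p * p) (p * r) (p * r) (r * r)).PosSemidef := by
  have := Matrix.posSemidef_self_mul_conjTranspose (Matrix.fromBlocks p (0 : Matrix n n ℂ) r (0 : Matrix n n ℂ))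
  simp only [Matrix.fromBlocks_conjTranspose, Matrix.fromBlocks_multiply, hp.eq, hr.eq] at this
  simpa [← hc.eq] using this

open scoped MatrixOrder in
theorem aux_trace_mono {n : Type*} [Fintype n] [DecidableEq n] (X Y M : Matrix n n ℂ)
    (h : X ≤ Y) (hM : M.PosSemidef) : (X * M).trace.re ≤ (Y * M).trace.re := by
  obtain ⟨S, rfl⟩ := aux_psd_fact M hM
  have h1 := ((Matrix.le_iff.1 h).mul_mul_conjTranspose_same S).trace_nonneg
  have h2 : (S * (Y - X) * S.conjTranspose).trace =
      (Y * (S.conjTranspose * S)).trace - (X * (S.conjTranspose * S)).trace := by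
    rw [Matrix.trace_mul_cycle, Matrix.trace_mul_comm, sub_mul, Matrix.trace_sub]
  rw [h2] at h1
  have := (Complex.le_def.1 h1).1
  simpa using this

open scoped MatrixOrder Matrix.Norms.L2Operator in
theorem aux_gm {n : Type*} [Fintype n] [DecidableEq n] (P R G : Matrix n n ℂ)
    (hP : P.PosSemidef) (hR : R.PosSemidef) (hc : Commute P R) (hG : G.IsHermitian)
    (hb : (Matrix.fromBlocks (P * P) G G (R * R)).PosSemidef) : G ≤ P * R := by
  have key : ∀ e : ℝ, 0 < e → G ≤ P * (R + e • 1) := by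
    intro e he
    have h1 : (e • (1 : Matrix n n ℂ)).PosDef := Matrix.PosDef.one.smul he
    refine aux_gm_inv P (R + e • 1) G hP ?_ ?_ hG ?_
    · exact Matrix.PosDef.posSemidef_add hR h1
    · exact hc.add_right ((Commute.one_right P).smul_right e)
    · have h2 : ((2 * e) • R + (e * e) • (1 : Matrix n n ℂ)).PosSemidef :=
        (hR.smul (by positivity)).add (Matrix.PosSemidef.one.smul (by positivity))
      have h3 := hb.add (aux_blockdiag 0 _ Matrix.PosSemidef.zero h2)
      rw [Matrix.fromBlocks_add] at h3
      convert h3 using 2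
      · simp
      · simp
      · simp
      · simp only [mul_add, add_mul, smul_mul_assoc, mul_smul_comm, mul_one, one_mul]
        module
  have ht : Filter.Tendsto (fun e : ℝ => P * (R + e • 1)) (nhdsWithin 0 (Set.Ioi 0))
      (nhds (P * (R + (0:ℝ) • 1))) := by
    apply Filter.Tendsto.mono_left _ nhdsWithin_le_nhds
    apply Continuous.tendsto
    fun_prop
  rw [zero_smul, add_zero] at ht
  exact ge_of_tendsto ht (Filter.eventually_of_mem self_mem_nhdsWithin (fun e he => key e he))

open scoped MatrixOrder Matrix.Norms.L2Operator NNReal in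
theorem aux_main {A B : Type*} [Fintype A] [DecidableEq A] [Fintype B] [DecidableEq B]
    (α : ℝ≥0) (h0 : 0 < α) (h1 : α + α ≤ 1) (l : ℝ) (hl : l ∈ Set.Icc (0:ℝ) 1)
    (s s' : Matrix A A ℂ) (t t' : Matrix B B ℂ) (hs : 0 ≤ s) (hs' : 0 ≤ s')
    (ht : 0 ≤ t) (ht' : 0 ≤ t') :
    l • ((s ^ α) ⊗ₖ (t ^ α)) + (1 - l) • ((s' ^ α) ⊗ₖ (t' ^ α)) ≤
      ((l • s + (1 - l) • s') ^ α) ⊗ₖ ((l • t + (1 - l) • t') ^ α) := by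
  have hl0 := hl.1
  have hl1 : 0 ≤ 1 - l := sub_nonneg.2 hl.2
  have cA : l • (s ^ α * s ^ α) + (1 - l) • (s' ^ α * s' ^ α) ≤ 
      (l • s + (1 - l) • s') ^ α * (l • s + (1 - l) • s') ^ α := by
    simp only [← CFC.nnrpow_add h0 h0]
    exact (CFC.concaveOn_nnrpow (A := Matrix A A ℂ) (p := α + α) ⟨by positivity, h1⟩).2 hs hs' hl0 hl1 (by ring)
  have cB : l • (t ^ α * t ^ α) + (1 - l) • (t' ^ α * t' ^ α) ≤ 
      (l • t + (1 - l) • t') ^ α * (l • t + (1 - l) • t') ^ α := by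
    simp only [← CFC.nnrpow_add h0 h0]
    exact (CFC.concaveOn_nnrpow (A := Matrix B B ℂ) (p := α + α) ⟨by positivity, h1⟩).2 ht ht' hl0 hl1 (by ring)
  have pA : (s ^ α).PosSemidef := Matrix.nonneg_iff_posSemidef.1 (CFC.nnrpow_nonneg (a := s) (x := α))
  have pA' : (s' ^ α).PosSemidef := Matrix.nonneg_iff_posSemidef.1 (CFC.nnrpow_nonneg (a := s') (x := α))
  have pB : (t ^ α).PosSemidef := Matrix.nonneg_iff_posSemidef.1 (CFC.nnrpow_nonneg (a := t) (x := α))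
  have pB' : (t' ^ α).PosSemidef := Matrix.nonneg_iff_posSemidef.1 (CFC.nnrpow_nonneg (a := t') (x := α))
  have pAm : ((l • s + (1 - l) • s') ^ α).PosSemidef := Matrix.nonneg_iff_posSemidef.1 (CFC.nnrpow_nonneg (x := α))
  have pBm : ((l • t + (1 - l) • t') ^ α).PosSemidef := Matrix.nonneg_iff_posSemidef.1 (CFC.nnrpow_nonneg (x := α))
  generalize (l • s + (1 - l) • s') ^ α = am at *
  generalize (l • t + (1 - l) • t') ^ α = bm at *
  generalize s ^ α = a at *
  generalize s' ^ α = a' at *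
  generalize t ^ α = b at *
  generalize t' ^ α = b' at *
  have kk : ∀ (x : Matrix A A ℂ) (y : Matrix B B ℂ), x ⊗ₖ y = (x ⊗ₖ (1 : Matrix B B ℂ)) * ((1 : Matrix A A ℂ) ⊗ₖ y) := by
    intro x y
    rw [← Matrix.mul_kronecker_mul, mul_one, one_mul]
  have kc : ∀ (x : Matrix A A ℂ) (y : Matrix B B ℂ), Commute (x ⊗ₖ (1 : Matrix B B ℂ)) ((1 : Matrix A A ℂ) ⊗ₖ y) := by
    intro x y
    rw [commute_iff_eq, ← Matrix.mul_kronecker_mul, ← Matrix.mul_kronecker_mul, mul_one, one_mul, mul_one, one_mul]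
  have bl := aux_block (a ⊗ₖ (1 : Matrix B B ℂ)) ((1 : Matrix A A ℂ) ⊗ₖ b)
    (pA.kronecker .one).1 (Matrix.PosSemidef.one.kronecker pB).1 (kc a b)
  have bl' := aux_block (a' ⊗ₖ (1 : Matrix B B ℂ)) ((1 : Matrix A A ℂ) ⊗ₖ b')
    (pA'.kronecker .one).1 (Matrix.PosSemidef.one.kronecker pB').1 (kc a' b')
  have bs := (bl.smul hl0).add (bl'.smul hl1)
  have bd := aux_blockdiag _ _ ((Matrix.le_iff.1 cA).kronecker (Matrix.PosSemidef.one (n := B)))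
    ((Matrix.PosSemidef.one (n := A)).kronecker (Matrix.le_iff.1 cB))
  have bt := bs.add bd
  rw [kk am bm]
  refine aux_gm _ _ _ (pAm.kronecker .one) (Matrix.PosSemidef.one.kronecker pBm) (kc am bm) ?_ ?_
  · exact (((pA.kronecker pB).smul hl0).add ((pA'.kronecker pB').smul hl1)).1
  · convert bt using 1
    simp only [Matrix.fromBlocks_smul, Matrix.fromBlocks_add, ← kk, ← Matrix.mul_kronecker_mul, mul_one, add_zero]
    congr 1
    · ext i j
      simp only [Matrix.kroneckerMap_apply, Matrix.add_apply, Matrix.sub_apply, Matrix.smul_apply,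
        Complex.real_smul]
      ring
    · ext i j
      simp only [Matrix.kroneckerMap_apply, Matrix.add_apply, Matrix.sub_apply, Matrix.smul_apply,
        Complex.real_smul]
      ring

open scoped MatrixOrder Matrix.Norms.L2Operator NNReal in
/-- Joint concavity of `Q_α` (Theorem 1(d)). -/
theorem QRenyi_jointly_concave {A B : Type*} [Fintype A] [DecidableEq A] [Nonempty A]
    [Fintype B] [DecidableEq B] [Nonempty B]
    (α : ℝ) (hα : α ∈ Set.Ioc (0 : ℝ) (1 / 2))
    (lam : ℝ) (hlam : lam ∈ Set.Icc (0 : ℝ) 1)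
    (σ σ' : MState A) (τ τ' : MState B) (ρ : MState (A × B)) :
    lam * QRenyi α (σ.mat ⊗ₖ τ.mat) ρ.mat
        + (1 - lam) * QRenyi α (σ'.mat ⊗ₖ τ'.mat) ρ.mat
      ≤ QRenyi α ((lam • σ.mat + (1 - lam) • σ'.mat) ⊗ₖ (lam • τ.mat + (1 - lam) • τ'.mat))
          ρ.mat := by
  obtain ⟨h0, h1⟩ := hα
  have hl0 := hlam.1
  have hl1 : 0 ≤ 1 - lam := sub_nonneg.2 hlam.2
  have hS := (σ.posSemidef.smul hl0).add (σ'.posSemidef.smul hl1)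
  have hT := (τ.posSemidef.smul hl0).add (τ'.posSemidef.smul hl1)
  have hρ : (mpow ρ.mat (1 - α)).PosSemidef := by
    have h2 : 0 < 1 - α := by linarith
    generalize 1 - α = β at *
    lift β to ℝ≥0 using h2.le
    rw [aux_mpow_eq_nnrpow ρ.mat ρ.posSemidef β (by exact_mod_cast h2)]
    exact Matrix.nonneg_iff_posSemidef.1 CFC.nnrpow_nonneg
  unfold QRenyi
  generalize mpow ρ.mat (1 - α) = M at *
  lift α to ℝ≥0 using h0.le
  have h0' : 0 < α := by exact_mod_cast h0
  have h1' : α + α ≤ 1 := by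
    have : (α : ℝ) + α ≤ 1 := by linarith
    exact_mod_cast this
  have key := aux_main α h0' h1' lam hlam σ.mat σ'.mat τ.mat τ'.mat σ.posSemidef.nonneg
    σ'.posSemidef.nonneg τ.posSemidef.nonneg τ'.posSemidef.nonneg
  have k2 := aux_trace_mono _ _ M key hρ
  rw [aux_mpow_kron _ _ σ.posSemidef τ.posSemidef, aux_mpow_kron _ _ σ'.posSemidef τ'.posSemidef,
    aux_mpow_kron _ _ hS hT, aux_mpow_eq_nnrpow _ σ.posSemidef α h0',
    aux_mpow_eq_nnrpow _ σ'.posSemidef α h0', aux_mpow_eq_nnrpow _ τ.posSemidef α h0',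
    aux_mpow_eq_nnrpow _ τ'.posSemidef α h0', aux_mpow_eq_nnrpow _ hS α h0',
    aux_mpow_eq_nnrpow _ hT α h0']
  refine le_trans (le_of_eq ?_) k2
  simp [add_mul, Matrix.trace_add, Matrix.trace_smul]

end
end

section
/- Monotonicity in the Rényi order (Theorem 1(h)): Let A and B be nonempty finite types, ρ_AB a bipartite state on A × B, and 0 < α ≤ β < 1. Then L_α^↓↓(A:B)_ρ ≤ L_β^↓↓(A:B)_ρ, and moreover L_β^↓↓(A:B)_ρ ≤ T(A:B)_ρ (an inequality in [0,+∞], where the left-hand side is finite). -/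
open scoped BigOperators Kronecker ComplexOrder

noncomputable section

section Helpers

open Matrix

variable {C : Type*} [Fintype C] [DecidableEq C]

/-- Overlaps of the eigenvectors of two Hermitian matrices. -/
def ovl {X Y : Matrix C C ℂ} (hX : X.IsHermitian) (hY : Y.IsHermitian) (i j : C) : ℝ :=
  Complex.normSq ((star (hX.eigenvectorUnitary : Matrix C C ℂ) *
    (hY.eigenvectorUnitary : Matrix C C ℂ)) i j)

theorem trace_two_spectral (U V : Matrix C C ℂ) (f g : C → ℝ) :
    ((U * diagonal (fun i => (f i : ℂ)) * star U *
      (V * diagonal (fun i => (g i : ℂ)) * star V)).trace).re =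
      ∑ i, ∑ j, f i * g j * Complex.normSq ((star U * V) i j) := by
  have h : (U * diagonal (fun i => (f i : ℂ)) * star U *
      (V * diagonal (fun i => (g i : ℂ)) * star V)).trace =
      (diagonal (fun i => (f i : ℂ)) * (star U * V) * diagonal (fun i => (g i : ℂ)) *
        star (star U * V)).trace := by
    have e1 : U * diagonal (fun i => (f i : ℂ)) * star U *
      (V * diagonal (fun i => (g i : ℂ)) * star V) =
      U * (diagonal (fun i => (f i : ℂ)) * (star U * V) * diagonal (fun i => (g i : ℂ)) *
        star V) := by simp only [Matrix.mul_assoc]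
    rw [e1, Matrix.trace_mul_comm]
    simp only [star_mul, star_star, Matrix.mul_assoc]
  rw [h]
  simp only [Matrix.trace, Matrix.diag, Complex.re_sum]
  refine Finset.sum_congr rfl fun i _ => ?_
  rw [Matrix.mul_apply, Complex.re_sum]
  refine Finset.sum_congr rfl fun j _ => ?_
  rw [Matrix.mul_diagonal, Matrix.diagonal_mul, Matrix.star_apply]
  generalize (star U * V) i j = z
  have : (f i : ℂ) * z * (g j : ℂ) * star z = ((f i * g j * Complex.normSq z : ℝ) : ℂ) := by
    push_cast
    rw [← Complex.mul_conj]
    simp only [Complex.star_def]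
    ring
  rw [this, Complex.ofReal_re]

variable {X Y : Matrix C C ℂ} (hX : X.IsHermitian) (hY : Y.IsHermitian)

theorem ovl_nonneg (i j : C) : 0 ≤ ovl hX hY i j := Complex.normSq_nonneg _

theorem unitary_row_sum (W : Matrix C C ℂ) (h : W * star W = 1) (i : C) :
    ∑ j, Complex.normSq (W i j) = 1 := by
  have h1 := congrFun (congrFun h i) i
  rw [Matrix.mul_apply, Matrix.one_apply_eq] at h1
  have h2 : ((∑ j, Complex.normSq (W i j) : ℝ) : ℂ) = 1 := by
    rw [← h1]
    push_cast
    refine Finset.sum_congr rfl fun j _ => ?_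
    rw [← Complex.mul_conj, Matrix.star_apply, Complex.star_def]
  exact_mod_cast h2

theorem ovl_row_sum (i : C) : ∑ j, ovl hX hY i j = 1 := by
  apply unitary_row_sum
  have h1 : (hX.eigenvectorUnitary : Matrix C C ℂ)ᴴ * (hX.eigenvectorUnitary : Matrix C C ℂ) = 1 :=
    Unitary.coe_star_mul_self hX.eigenvectorUnitary
  have h2 : (hY.eigenvectorUnitary : Matrix C C ℂ) * star (hY.eigenvectorUnitary : Matrix C C ℂ) = 1 :=
    Unitary.coe_mul_star_self hY.eigenvectorUnitary
  rw [star_mul, star_star, Matrix.mul_assoc, ← Matrix.mul_assoc _ (star _), h2, Matrix.one_mul]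
  exact h1

theorem ovl_comm (i j : C) : ovl hX hY i j = ovl hY hX j i := by
  unfold ovl
  have : (star (hY.eigenvectorUnitary : Matrix C C ℂ) * (hX.eigenvectorUnitary : Matrix C C ℂ)) j i
      = star ((star (hX.eigenvectorUnitary : Matrix C C ℂ) *
        (hY.eigenvectorUnitary : Matrix C C ℂ)) i j) := by
    rw [← Matrix.star_apply, star_mul, star_star]
  rw [this, Complex.star_def, Complex.normSq_conj]

theorem spectral_eq : X = (hX.eigenvectorUnitary : Matrix C C ℂ) *
    diagonal (fun i => ((hX.eigenvalues i : ℝ) : ℂ)) *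
    star (hX.eigenvectorUnitary : Matrix C C ℂ) := by
  conv_lhs => rw [hX.spectral_theorem]
  rfl

theorem QRenyi_formula (hXp : X.PosSemidef) (hYp : Y.PosSemidef) {α : ℝ} (h0 : 0 < α) (h1 : α < 1) :
    QRenyi α X Y = ∑ i, ∑ j, hXp.1.eigenvalues i ^ α * hYp.1.eigenvalues j ^ (1 - α) *
      ovl hXp.1 hYp.1 i j := by
  have e : ∀ (p : ℝ) (x : ℝ), 0 < p → (if x = 0 then (0 : ℝ) else x ^ p) = x ^ p := by
    intro p x hp
    split_ifs with h
    · rw [h, Real.zero_rpow hp.ne']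
    · rfl
  unfold QRenyi mpow
  rw [dif_pos hXp.1, dif_pos hYp.1, trace_two_spectral]
  simp only [e _ _ h0, e _ _ (sub_pos.2 h1)]
  rfl

theorem relEnt_formula (hX : X.IsHermitian) (hY : Y.IsHermitian) :
    ((X * (mlog X - mlog Y)).trace).re = ∑ i, ∑ j, hX.eigenvalues i * ovl hX hY i j *
      (Real.log (hX.eigenvalues i) - Real.log (hY.eigenvalues j)) := by
  have a : ((X * mlog Y).trace).re = ∑ i, ∑ j, hX.eigenvalues i * Real.log (hY.eigenvalues j) *
      ovl hX hY i j := by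
    unfold mlog
    rw [dif_pos hY]
    conv_lhs => rw [spectral_eq hX]
    rw [trace_two_spectral]
    rfl
  have b : ((X * mlog X).trace).re = ∑ i, hX.eigenvalues i * Real.log (hX.eigenvalues i) := by
    have h1 : star (hX.eigenvectorUnitary : Matrix C C ℂ) * (hX.eigenvectorUnitary : Matrix C C ℂ) = 1 :=
      Unitary.coe_star_mul_self hX.eigenvectorUnitary
    have : X * mlog X = (hX.eigenvectorUnitary : Matrix C C ℂ) *
        diagonal (fun i => ((hX.eigenvalues i : ℝ) : ℂ)) *
        star (hX.eigenvectorUnitary : Matrix C C ℂ) * mlog X := by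
      rw [← spectral_eq hX]
    rw [this]
    unfold mlog
    rw [dif_pos hX, trace_two_spectral, h1]
    refine Finset.sum_congr rfl fun i _ => ?_
    rw [Finset.sum_eq_single i]
    · simp
    · intro j _ hj
      simp [Matrix.one_apply_ne hj.symm]
    · simp
  rw [mul_sub, Matrix.trace_sub, Complex.sub_re, a, b, ← Finset.sum_sub_distrib]
  refine Finset.sum_congr rfl fun i _ => ?_
  have : hX.eigenvalues i * Real.log (hX.eigenvalues i) =
      ∑ j, hX.eigenvalues i * Real.log (hX.eigenvalues i) * ovl hX hY i j := by
    rw [← Finset.mul_sum, ovl_row_sum, mul_one]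
  rw [this, ← Finset.sum_sub_distrib]
  refine Finset.sum_congr rfl fun j _ => ?_
  ring

theorem sum_eig_s5 (ρ : MState C) : ∑ i, ρ.posSemidef.1.eigenvalues i = 1 := by
  have h := ρ.posSemidef.1.trace_eq_sum_eigenvalues
  rw [ρ.trace_one] at h
  have h2 : ((∑ i, ρ.posSemidef.1.eigenvalues i : ℝ) : ℂ) = 1 := by
    rw [h]; push_cast; rfl
  exact_mod_cast h2

/-- The first Nussbaum–Szkoła weight. -/
def wt (ρ σ : MState C) (x : C × C) : ℝ :=
  ρ.posSemidef.1.eigenvalues x.1 * ovl ρ.posSemidef.1 σ.posSemidef.1 x.1 x.2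

/-- The likelihood ratio. -/
def rat (ρ σ : MState C) (x : C × C) : ℝ :=
  σ.posSemidef.1.eigenvalues x.2 / ρ.posSemidef.1.eigenvalues x.1

theorem wt_nonneg (ρ σ : MState C) (x : C × C) : 0 ≤ wt ρ σ x :=
  mul_nonneg (ρ.posSemidef.eigenvalues_nonneg _) (ovl_nonneg _ _ _ _)

theorem rat_nonneg (ρ σ : MState C) (x : C × C) : 0 ≤ rat ρ σ x :=
  div_nonneg (σ.posSemidef.eigenvalues_nonneg _) (ρ.posSemidef.eigenvalues_nonneg _)

theorem wt_sum (ρ σ : MState C) : ∑ x, wt ρ σ x = 1 := by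
  rw [Fintype.sum_prod_type, ← sum_eig_s5 ρ]
  refine Finset.sum_congr rfl fun i _ => ?_
  simp only [wt]
  rw [← Finset.mul_sum, ovl_row_sum, mul_one]

theorem QRenyi_classical (ρ σ : MState C) {α : ℝ} (h0 : 0 < α) (h1 : α < 1) :
    QRenyi α ρ.mat σ.mat = ∑ x, wt ρ σ x * rat ρ σ x ^ (1 - α) := by
  rw [QRenyi_formula ρ.posSemidef σ.posSemidef h0 h1, Fintype.sum_prod_type]
  refine Finset.sum_congr rfl fun i _ => Finset.sum_congr rfl fun j _ => ?_
  have hi := ρ.posSemidef.eigenvalues_nonneg i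
  have hj := σ.posSemidef.eigenvalues_nonneg j
  simp only [wt, rat]
  rcases hi.eq_or_lt with h | h
  · rw [← h, Real.zero_rpow h0.ne']; ring
  · rw [Real.div_rpow hj hi]
    have e : ρ.posSemidef.1.eigenvalues i ^ α * ρ.posSemidef.1.eigenvalues i ^ (1 - α) =
        ρ.posSemidef.1.eigenvalues i := by
      rw [← Real.rpow_add h]; simp
    have hp : 0 < ρ.posSemidef.1.eigenvalues i ^ (1 - α) := Real.rpow_pos_of_pos h _
    rw [eq_comm]
    nth_rw 1 [← e]
    field_simp

theorem QRenyi_nonneg (ρ σ : MState C) {α : ℝ} (h0 : 0 < α) (h1 : α < 1) :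
    0 ≤ QRenyi α ρ.mat σ.mat := by
  rw [QRenyi_classical ρ σ h0 h1]
  exact Finset.sum_nonneg fun x _ =>
    mul_nonneg (wt_nonneg _ _ _) (Real.rpow_nonneg (rat_nonneg _ _ _) _)

theorem QRenyi_pow_le (ρ σ : MState C) {α β : ℝ} (h0 : 0 < α) (hαβ : α ≤ β) (h1 : β < 1) :
    QRenyi β ρ.mat σ.mat ^ ((1 - α) / (1 - β)) ≤ QRenyi α ρ.mat σ.mat := by
  have hb : 0 < 1 - β := by linarith
  rw [QRenyi_classical ρ σ h0 (by linarith), QRenyi_classical ρ σ (by linarith) h1]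
  have hp : 1 ≤ (1 - α) / (1 - β) := by rw [le_div_iff₀ hb]; linarith
  have := Real.rpow_arith_mean_le_arith_mean_rpow Finset.univ (wt ρ σ)
    (fun x => rat ρ σ x ^ (1 - β)) (fun x _ => wt_nonneg ρ σ x) (wt_sum ρ σ)
    (fun x _ => Real.rpow_nonneg (rat_nonneg _ _ _) _) hp
  refine this.trans_eq ?_
  refine Finset.sum_congr rfl fun x _ => ?_
  rw [← Real.rpow_mul (rat_nonneg _ _ _), mul_div_cancel₀ _ hb.ne']

theorem DRenyi_mono (ρ σ : MState C) {α β : ℝ} (h0 : 0 < α) (hαβ : α ≤ β) (h1 : β < 1) :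
    DRenyi α ρ.mat σ.mat ≤ DRenyi β ρ.mat σ.mat := by
  have hle := QRenyi_pow_le ρ σ h0 hαβ h1
  have hb : 0 < 1 - β := by linarith
  have ha : 0 < 1 - α := by linarith
  unfold DRenyi
  by_cases hq : QRenyi β ρ.mat σ.mat = 0
  · rw [if_pos hq]; exact le_top
  have hqp := lt_of_le_of_ne (QRenyi_nonneg ρ σ (h0.trans_le hαβ) h1) (Ne.symm hq)
  have hpp : 0 < QRenyi β ρ.mat σ.mat ^ ((1 - α) / (1 - β)) := Real.rpow_pos_of_pos hqp _
  have hqa := hpp.trans_le hle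
  rw [if_neg hq, if_neg hqa.ne']
  have hl := Real.log_le_log hpp hle
  rw [Real.log_rpow hqp] at hl
  rw [EReal.coe_le_coe_iff]
  have e1 : (α - 1)⁻¹ = -(1 - α)⁻¹ := by rw [← inv_neg]; ring_nf
  have e2 : (β - 1)⁻¹ = -(1 - β)⁻¹ := by rw [← inv_neg]; ring_nf
  rw [e1, e2, neg_mul, neg_mul, neg_le_neg_iff]
  calc (1 - β)⁻¹ * Real.log (QRenyi β ρ.mat σ.mat)
      = (1 - α)⁻¹ * ((1 - α) / (1 - β) * Real.log (QRenyi β ρ.mat σ.mat)) := by field_simp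
    _ ≤ _ := mul_le_mul_of_nonneg_left hl (inv_nonneg.2 ha.le)

theorem wt_zero_of_ker (ρ σ : MState C)
    (hk : LinearMap.ker (Matrix.toLin' σ.mat) ≤ LinearMap.ker (Matrix.toLin' ρ.mat))
    (x : C × C) (hx : σ.posSemidef.1.eigenvalues x.2 = 0) : wt ρ σ x = 0 := by
  obtain ⟨i, j⟩ := x
  simp only at hx
  set U := (ρ.posSemidef.1.eigenvectorUnitary : Matrix C C ℂ) with hU
  set V := (σ.posSemidef.1.eigenvectorUnitary : Matrix C C ℂ) with hV
  have hU1 : star U * U = 1 := Unitary.coe_star_mul_self ρ.posSemidef.1.eigenvectorUnitary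
  have hV1 : star V * V = 1 := Unitary.coe_star_mul_self σ.posSemidef.1.eigenvectorUnitary
  have hσ : σ.mat * V = V * diagonal (fun i => ((σ.posSemidef.1.eigenvalues i : ℝ) : ℂ)) := by
    conv_lhs => rw [spectral_eq σ.posSemidef.1]
    rw [Matrix.mul_assoc, ← hV, hV1, Matrix.mul_one]
  have hρ : star U * ρ.mat = diagonal (fun i => ((ρ.posSemidef.1.eigenvalues i : ℝ) : ℂ)) * star U := by
    conv_lhs => rw [spectral_eq ρ.posSemidef.1]
    rw [← hU, ← Matrix.mul_assoc, ← Matrix.mul_assoc, hU1, Matrix.one_mul]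
  have hv : σ.mat *ᵥ (fun k => V k j) = 0 := by
    funext k
    have := congrFun (congrFun hσ k) j
    rw [Matrix.mul_diagonal, hx, Complex.ofReal_zero, mul_zero] at this
    exact this
  have hv2 : ρ.mat *ᵥ (fun k => V k j) = 0 := by
    have : (fun k => V k j) ∈ LinearMap.ker (Matrix.toLin' σ.mat) := by
      rw [LinearMap.mem_ker, Matrix.toLin'_apply]; exact hv
    have := hk this
    rwa [LinearMap.mem_ker, Matrix.toLin'_apply] at this
  have h3 : (star U * ρ.mat * V) i j = 0 := by
    rw [Matrix.mul_assoc, Matrix.mul_apply]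
    refine Finset.sum_eq_zero fun k _ => ?_
    have : (ρ.mat * V) k j = 0 := congrFun hv2 k
    rw [this, mul_zero]
  rw [hρ, Matrix.mul_assoc, Matrix.diagonal_mul] at h3
  unfold wt ovl
  rcases mul_eq_zero.1 h3 with h | h
  · have h' : ρ.posSemidef.1.eigenvalues i = 0 := by exact_mod_cast h
    simp [h']
  · simp only [← hU, ← hV, h, map_zero, mul_zero]

theorem DRenyi_le_relEnt (ρ σ : MState C) {β : ℝ} (h0 : 0 < β) (h1 : β < 1) :
    DRenyi β ρ.mat σ.mat ≤ relEnt ρ.mat σ.mat := by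
  unfold relEnt
  split_ifs with hk
  swap
  · exact le_top
  have hb : 0 < 1 - β := by linarith
  set z : C × C → ℝ := fun x => if 0 < rat ρ σ x then rat ρ σ x ^ (1 - β) else 1 with hz
  have hzpos : ∀ x, 0 < z x := by
    intro x
    simp only [hz]
    split_ifs with h
    · exact Real.rpow_pos_of_pos h _
    · exact one_pos
  have hw0 : ∀ x, ¬ 0 < rat ρ σ x → wt ρ σ x = 0 := by
    intro x hx
    have : rat ρ σ x = 0 := le_antisymm (not_lt.1 hx) (rat_nonneg _ _ _)
    rcases div_eq_zero_iff.1 this with h | h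
    · exact wt_zero_of_ker ρ σ hk x h
    · simp [wt, h]
  have hQ : QRenyi β ρ.mat σ.mat = ∑ x, wt ρ σ x * z x := by
    rw [QRenyi_classical ρ σ h0 h1]
    refine Finset.sum_congr rfl fun x _ => ?_
    by_cases h : 0 < rat ρ σ x
    · simp only [hz, if_pos h]
    · rw [hw0 x h]; ring
  have hQpos : 0 < QRenyi β ρ.mat σ.mat := by
    rw [hQ]
    have := (convex_Ioi (0 : ℝ)).sum_mem (t := Finset.univ) (w := wt ρ σ) (z := z)
      (fun x _ => wt_nonneg ρ σ x) (wt_sum ρ σ) (fun x _ => hzpos x)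
    simpa using this
  have hJ : ∑ x, wt ρ σ x * Real.log (z x) ≤ Real.log (QRenyi β ρ.mat σ.mat) := by
    rw [hQ]
    have := strictConcaveOn_log_Ioi.concaveOn.le_map_sum (t := Finset.univ) (w := wt ρ σ) (p := z)
      (fun x _ => wt_nonneg ρ σ x) (wt_sum ρ σ) (fun x _ => hzpos x)
    simpa using this
  have hR : ((ρ.mat * (mlog ρ.mat - mlog σ.mat)).trace).re =
      -((1 - β)⁻¹ * ∑ x, wt ρ σ x * Real.log (z x)) := by
    rw [relEnt_formula ρ.posSemidef.1 σ.posSemidef.1, ← Fintype.sum_prod_type'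
      (f := fun i j => ρ.posSemidef.1.eigenvalues i * ovl ρ.posSemidef.1 σ.posSemidef.1 i j *
      (Real.log (ρ.posSemidef.1.eigenvalues i) - Real.log (σ.posSemidef.1.eigenvalues j))),
      Finset.mul_sum, ← Finset.sum_neg_distrib]
    refine Finset.sum_congr rfl fun x _ => ?_
    change wt ρ σ x * _ = _
    by_cases h : 0 < rat ρ σ x
    · simp only [hz, if_pos h]
      have hne := h.ne'
      unfold rat at hne
      rw [Real.log_rpow h, rat, Real.log_div (div_ne_zero_iff.1 hne).1 (div_ne_zero_iff.1 hne).2]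
      field_simp
      ring
    · rw [hw0 x h]; ring
  unfold DRenyi
  rw [if_neg hQpos.ne', EReal.coe_le_coe_iff, hR]
  have e2 : (β - 1)⁻¹ = -(1 - β)⁻¹ := by rw [← inv_neg]; ring_nf
  rw [e2, neg_mul, neg_le_neg_iff]
  exact mul_le_mul_of_nonneg_left hJ (inv_nonneg.2 hb.le)

theorem DRenyi_lt_top (ρ σ : MState C) (hρ : ρ.mat.PosDef) {β : ℝ} (h0 : 0 < β) (h1 : β < 1) :
    DRenyi β ρ.mat σ.mat < ⊤ := by
  have hpos : ∀ i, 0 < ρ.posSemidef.1.eigenvalues i := fun i => hρ.eigenvalues_pos i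
  have hne : QRenyi β ρ.mat σ.mat ≠ 0 := by
    rw [QRenyi_formula ρ.posSemidef σ.posSemidef h0 h1]
    intro h
    have hn : ∀ i j, 0 ≤ ρ.posSemidef.1.eigenvalues i ^ β *
        σ.posSemidef.1.eigenvalues j ^ (1 - β) * ovl ρ.posSemidef.1 σ.posSemidef.1 i j :=
      fun i j => mul_nonneg (mul_nonneg (Real.rpow_nonneg (hpos i).le _)
        (Real.rpow_nonneg (σ.posSemidef.eigenvalues_nonneg j) _)) (ovl_nonneg _ _ _ _)
    have hz : ∀ i j, ρ.posSemidef.1.eigenvalues i ^ β *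
        σ.posSemidef.1.eigenvalues j ^ (1 - β) * ovl ρ.posSemidef.1 σ.posSemidef.1 i j = 0 := by
      intro i j
      have := (Finset.sum_eq_zero_iff_of_nonneg
        (fun i _ => Finset.sum_nonneg fun j _ => hn i j)).1 h i (Finset.mem_univ _)
      exact (Finset.sum_eq_zero_iff_of_nonneg (fun j _ => hn i j)).1 this j (Finset.mem_univ _)
    obtain ⟨j, hj⟩ : ∃ j, σ.posSemidef.1.eigenvalues j ≠ 0 := by
      by_contra! hc
      have := sum_eig_s5 σ
      simp [hc] at this
    have hj' := lt_of_le_of_ne (σ.posSemidef.eigenvalues_nonneg j) (Ne.symm hj)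
    have ho : ∀ i, ovl ρ.posSemidef.1 σ.posSemidef.1 i j = 0 := fun i =>
      (mul_eq_zero.1 (hz i j)).resolve_left
        (mul_pos (Real.rpow_pos_of_pos (hpos i) _) (Real.rpow_pos_of_pos hj' _)).ne'
    have := ovl_row_sum σ.posSemidef.1 ρ.posSemidef.1 j
    simp only [ovl_comm σ.posSemidef.1 ρ.posSemidef.1, ho] at this
    simp at this
  unfold DRenyi
  rw [if_neg hne]
  exact EReal.coe_lt_top _

/-- The product state. -/
def prodState {A B : Type*} [Fintype A] [DecidableEq A] [Fintype B] [DecidableEq B]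
    (σ : MState A) (τ : MState B) : MState (A × B) where
  mat := σ.mat ⊗ₖ τ.mat
  posSemidef := σ.posSemidef.kronecker τ.posSemidef
  trace_one := by rw [Matrix.trace_kronecker, σ.trace_one, τ.trace_one, one_mul]

theorem mixed_posDef (A : Type*) [Fintype A] [DecidableEq A] [Nonempty A] :
    (((Fintype.card A : ℂ)⁻¹) • (1 : Matrix A A ℂ)).PosDef := by
  refine Matrix.PosDef.one.smul ?_
  have : (0 : ℝ) < (Fintype.card A : ℝ)⁻¹ := inv_pos.2 (by exact_mod_cast Fintype.card_pos)
  have h2 : (0 : ℂ) < (((Fintype.card A : ℝ)⁻¹ : ℝ) : ℂ) := Complex.zero_lt_real.2 this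
  rwa [Complex.ofReal_inv, Complex.ofReal_natCast] at h2

/-- The maximally mixed state. -/
def mixed (A : Type*) [Fintype A] [DecidableEq A] [Nonempty A] : MState A where
  mat := ((Fintype.card A : ℂ)⁻¹) • (1 : Matrix A A ℂ)
  posSemidef := (mixed_posDef A).posSemidef
  trace_one := by
    rw [Matrix.trace_smul, Matrix.trace_one, smul_eq_mul, inv_mul_cancel₀]
    exact_mod_cast Fintype.card_ne_zero

end Helpers

/-- Monotonicity of the doubly minimized Petz Rényi lautum information in the Rényi
order, and comparison with the tumula information (Theorem 1(h)). -/
theorem Ldd_mono_in_order {A B : Type*} [Fintype A] [DecidableEq A] [Nonempty A]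
    [Fintype B] [DecidableEq B] [Nonempty B]
    (α β : ℝ) (hα : 0 < α) (hαβ : α ≤ β) (hβ : β < 1) (ρ : MState (A × B)) :
    Ldd α ρ.mat ≤ Ldd β ρ.mat ∧ Ldd β ρ.mat < ⊤ ∧ Ldd β ρ.mat ≤ Tum ρ.mat := by
  refine ⟨?_, ?_, ?_⟩
  · exact iInf_mono fun σ => iInf_mono fun τ => DRenyi_mono (prodState σ τ) ρ hα hαβ hβ
  · refine lt_of_le_of_lt (iInf_le_of_le (mixed A) (iInf_le _ (mixed B))) ?_
    exact DRenyi_lt_top (prodState (mixed A) (mixed B)) ρ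
      ((mixed_posDef A).kronecker (mixed_posDef B)) (hα.trans_le hαβ) hβ
  · exact iInf_mono fun σ => iInf_mono fun τ =>
      DRenyi_le_relEnt (prodState σ τ) ρ (hα.trans_le hαβ) hβ

end
end

section
/- Limit of the doubly minimized Petz Rényi lautum information at order 1: Let A and B be nonempty finite types and ρ_AB a bipartite state on A × B. Then, as α tends to 1 from the left within (0,1), L_α^↓↓(A:B)_ρ (viewed with values in [0,+∞]) tends to the tumula information T(A:B)_ρ; in particular, if T(A:B)_ρ = +∞ then L_α^↓↓(A:B)_ρ tends to +∞ as α → 1⁻. -/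
open scoped BigOperators Kronecker ComplexOrder

noncomputable section

namespace LddAux

section Scalar

variable {ι : Type*} [Fintype ι]

lemma scalar_mono (w z : ι → ℝ) (hw : ∀ i, 0 ≤ w i) (hw1 : ∑ i, w i = 1) (hz : ∀ i, 0 ≤ z i)
    {s t : ℝ} (hs : 0 < s) (hst : s ≤ t) :
    (∑ i, w i * z i ^ s) ^ (t / s) ≤ ∑ i, w i * z i ^ t := by
  have h := Real.rpow_arith_mean_le_arith_mean_rpow Finset.univ w (fun i => z i ^ s)
    (fun i _ => hw i) hw1 (fun i _ => Real.rpow_nonneg (hz i) s) (p := t / s)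
    ((one_le_div hs).2 hst)
  refine h.trans (le_of_eq (Finset.sum_congr rfl fun i _ => ?_))
  rw [← Real.rpow_mul (hz i)]
  congr 2
  field_simp

lemma scalar_lt_mono (w z : ι → ℝ) (hw : ∀ i, 0 ≤ w i) (hw1 : ∑ i, w i = 1) (hz : ∀ i, 0 ≤ z i)
    {s t c : ℝ} (hs : 0 < s) (hst : s ≤ t) (h : ∑ i, w i * z i ^ t < Real.exp (-(t * c))) :
    ∑ i, w i * z i ^ s < Real.exp (-(s * c)) := by
  by_contra hcon
  push Not at hcon
  have h1 := scalar_mono w z hw hw1 hz hs hst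
  have h2 : Real.exp (-(s * c)) ^ (t / s) ≤ (∑ i, w i * z i ^ s) ^ (t / s) :=
    Real.rpow_le_rpow (Real.exp_nonneg _) hcon (div_nonneg (hs.le.trans hst) hs.le)
  rw [← Real.exp_mul] at h2
  have h3 : -(s * c) * (t / s) = -(t * c) := by field_simp
  rw [h3] at h2
  linarith

lemma scalar_jensen (w z : ι → ℝ) (hw : ∀ i, 0 ≤ w i) (hw1 : ∑ i, w i = 1) (hz : ∀ i, 0 ≤ z i)
    (hwz : ∀ i, z i = 0 → w i = 0) (s : ℝ) :
    Real.exp (s * ∑ i, w i * Real.log (z i)) ≤ ∑ i, w i * z i ^ s := by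
  have h := convexOn_exp.map_sum_le (t := Finset.univ) (w := w)
    (p := fun i => s * Real.log (z i)) (fun i _ => hw i) hw1 (fun i _ => Set.mem_univ _)
  simp only [smul_eq_mul] at h
  have e1 : s * ∑ i, w i * Real.log (z i) = ∑ i, w i * (s * Real.log (z i)) := by
    rw [Finset.mul_sum]
    exact Finset.sum_congr rfl fun i _ => by ring
  rw [e1]
  refine h.trans (le_of_eq (Finset.sum_congr rfl fun i _ => ?_))
  by_cases h0 : z i = 0
  · simp [hwz i h0]
  · rw [Real.rpow_def_of_pos (lt_of_le_of_ne (hz i) (Ne.symm h0)), mul_comm s]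

lemma scalar_exists (w z : ι → ℝ) (hw : ∀ i, 0 ≤ w i) (hw1 : ∑ i, w i = 1) (hz : ∀ i, 0 ≤ z i)
    (c : ℝ) (hc : (∀ i, z i = 0 → w i = 0) → c < -∑ i, w i * Real.log (z i)) :
    ∃ s : ℝ, 0 < s ∧ s < 1 ∧ ∑ i, w i * z i ^ s < Real.exp (-(s * c)) := by
  set g : ℝ → ℝ := fun s => ∑ i, w i * (if z i = 0 then 0 else Real.exp (s * Real.log (z i)))
    with hg
  set h : ℝ → ℝ := fun s => g s - Real.exp (-(s * c)) with hh
  have hgs : ∀ s, 0 < s → ∑ i, w i * z i ^ s = g s := by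
    intro s hs
    refine Finset.sum_congr rfl fun i _ => ?_
    by_cases h0 : z i = 0
    · simp [h0, Real.zero_rpow hs.ne']
    · rw [if_neg h0, Real.rpow_def_of_pos (lt_of_le_of_ne (hz i) (Ne.symm h0)), mul_comm s]
  have hder : HasDerivAt h ((∑ i, w i * Real.log (z i)) + c) 0 := by
    have hgd : HasDerivAt g (∑ i, w i * Real.log (z i)) 0 := by
      refine HasDerivAt.fun_sum fun i _ => HasDerivAt.const_mul _ ?_
      by_cases h0 : z i = 0
      · simp only [h0, if_true, Real.log_zero]
        exact hasDerivAt_const _ _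
      · simp only [h0, if_false]
        have := ((hasDerivAt_id (0:ℝ)).mul_const (Real.log (z i))).exp
        simpa using this
    have h2 : HasDerivAt (fun s : ℝ => Real.exp (-(s * c))) (-c) 0 := by
      have := (((hasDerivAt_id (0:ℝ)).mul_const c).neg).exp
      simpa using this
    have := hgd.sub h2
    rw [sub_neg_eq_add] at this
    exact this
  suffices hev : ∀ᶠ s in nhdsWithin (0:ℝ) (Set.Ioi 0), h s < 0 by
    have h1 : ∀ᶠ s in nhdsWithin (0:ℝ) (Set.Ioi 0), s ∈ Set.Ioo (0:ℝ) 1 :=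
      Ioo_mem_nhdsGT one_pos
    obtain ⟨s, hs, hs1⟩ := (hev.and h1).exists
    refine ⟨s, hs1.1, hs1.2, ?_⟩
    rw [hgs s hs1.1]
    simpa [hh] using hs
  by_cases hwz : ∀ i, z i = 0 → w i = 0
  · have hneg : (∑ i, w i * Real.log (z i)) + c < 0 := by linarith [hc hwz]
    have h0 : h 0 = 0 := by
      have : g 0 = 1 := by
        rw [← hw1]
        refine Finset.sum_congr rfl fun i _ => ?_
        by_cases h0 : z i = 0
        · simp [hwz i h0]
        · simp [h0]
      simp [hh, this]
    have hsl := hasDerivAt_iff_tendsto_slope.1 hder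
    have hsl' := hsl.mono_left (nhdsWithin_mono (0:ℝ)
      (show Set.Ioi (0:ℝ) ⊆ {0}ᶜ from fun x hx => ne_of_gt hx))
    filter_upwards [hsl'.eventually (gt_mem_nhds hneg), self_mem_nhdsWithin] with s hs hs0
    rw [slope_def_field, h0, sub_zero, sub_zero] at hs
    have hs0' : (0:ℝ) < s := hs0
    by_contra hcon
    push Not at hcon
    exact absurd hs (not_lt.2 (div_nonneg hcon hs0'.le))
  · push Not at hwz
    obtain ⟨j, hj, hwj⟩ := hwz
    have h0 : h 0 < 0 := by
      have : g 0 < 1 := by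
        rw [← hw1]
        refine Finset.sum_lt_sum (fun i _ => ?_) ⟨j, Finset.mem_univ _, ?_⟩
        · by_cases h0 : z i = 0
          · simp [h0, hw i]
          · simp [h0]
        · simpa [hj] using lt_of_le_of_ne (hw j) (Ne.symm hwj)
      simp [hh, this]
    exact (hder.continuousAt.eventually (gt_mem_nhds h0)).filter_mono nhdsWithin_le_nhds

end Scalar

section Mat

open Matrix

variable {n : Type*} [Fintype n] [DecidableEq n]

lemma trace_diag (U V : Matrix n n ℂ) (f g : n → ℝ) :
    ((U * diagonal (fun i => (f i : ℂ)) * star U *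
      (V * diagonal (fun i => (g i : ℂ)) * star V)).trace).re =
    ∑ q : n × n, f q.1 * g q.2 * ‖(star U * V) q.1 q.2‖ ^ 2 := by
  have e : (U * diagonal (fun i => (f i : ℂ)) * star U *
      (V * diagonal (fun i => (g i : ℂ)) * star V)).trace =
      (diagonal (fun i => (f i : ℂ)) * (star U * V) *
        (diagonal (fun i => (g i : ℂ)) * star (star U * V))).trace := by
    rw [star_mul, star_star]
    rw [show U * diagonal (fun i => (f i : ℂ)) * star U *
      (V * diagonal (fun i => (g i : ℂ)) * star V) =
      U * (diagonal (fun i => (f i : ℂ)) * star U *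
      (V * diagonal (fun i => (g i : ℂ)) * star V)) by simp only [Matrix.mul_assoc],
      Matrix.trace_mul_comm]
    simp only [Matrix.mul_assoc]
  rw [e]
  generalize star U * V = W
  rw [Fintype.sum_prod_type, Matrix.trace, Complex.re_sum]
  refine Finset.sum_congr rfl fun i _ => ?_
  rw [Matrix.diag_apply, Matrix.mul_apply, Complex.re_sum]
  refine Finset.sum_congr rfl fun j _ => ?_
  rw [Matrix.diagonal_mul, Matrix.diagonal_mul, Matrix.star_apply]
  have : (f i : ℂ) * W i j * ((g j : ℂ) * star (W i j)) =
      ((f i * g j * ‖W i j‖ ^ 2 : ℝ) : ℂ) := by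
    have h := Complex.mul_conj' (W i j)
    push_cast
    rw [← h]
    simp only [Complex.star_def]
    ring
  rw [this, Complex.ofReal_re]

lemma sum_sq_row {W : Matrix n n ℂ} (hW : W * star W = 1) (i : n) :
    ∑ j, ‖W i j‖ ^ 2 = 1 := by
  have h := congrFun (congrFun hW i) i
  rw [Matrix.mul_apply, Matrix.one_apply_eq] at h
  have h2 : (((∑ j, ‖W i j‖ ^ 2 : ℝ)) : ℂ) = 1 := by
    rw [← h]
    push_cast
    refine Finset.sum_congr rfl fun j _ => ?_
    rw [Matrix.star_apply, Complex.star_def, Complex.mul_conj']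
  exact_mod_cast h2

lemma spectral {X : Matrix n n ℂ} (h : X.IsHermitian) :
    X = (h.eigenvectorUnitary : Matrix n n ℂ) *
      diagonal (fun i => ((h.eigenvalues i : ℝ) : ℂ)) *
      star (h.eigenvectorUnitary : Matrix n n ℂ) := by
  conv_lhs => rw [h.spectral_theorem]
  rw [Unitary.conjStarAlgAut_apply]
  rfl

/-- Data of the Nussbaum-Szkola distribution. -/
lemma exists_NS {X Y : Matrix n n ℂ} (hX : X.PosSemidef) (hX1 : X.trace = 1)
    (hY : Y.PosSemidef) :
    ∃ w z : n × n → ℝ, (∀ i, 0 ≤ w i) ∧ (∑ i, w i = 1) ∧ (∀ i, 0 ≤ z i) ∧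
      (∀ α : ℝ, α < 1 → QRenyi α X Y = ∑ i, w i * z i ^ (1 - α)) ∧
      (relEnt X Y = if (∀ i, z i = 0 → w i = 0) then
        ((-∑ i, w i * Real.log (z i) : ℝ) : EReal) else ⊤) := by
  classical
  have hXh := hX.isHermitian
  have hYh := hY.isHermitian
  set U : Matrix n n ℂ := (hXh.eigenvectorUnitary : Matrix n n ℂ) with hU
  set V : Matrix n n ℂ := (hYh.eigenvectorUnitary : Matrix n n ℂ) with hV
  set p := hXh.eigenvalues with hp
  set r := hYh.eigenvalues with hr
  have hp0 : ∀ i, 0 ≤ p i := hX.eigenvalues_nonneg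
  have hr0 : ∀ i, 0 ≤ r i := hY.eigenvalues_nonneg
  have hUU : star U * U = 1 := by simp [hU]
  have hUU' : U * star U = 1 := by simp [hU]
  have hVV : star V * V = 1 := by simp [hV]
  have hVV' : V * star V = 1 := by simp [hV]
  have hXs : X = U * diagonal (fun i => (p i : ℂ)) * star U := spectral hXh
  have hYs : Y = V * diagonal (fun i => (r i : ℂ)) * star V := spectral hYh
  set W := star U * V with hW
  have hWW : W * star W = 1 := by
    rw [hW, star_mul, star_star, Matrix.mul_assoc, ← Matrix.mul_assoc V, hVV', Matrix.one_mul, hUU]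
  have hp1 : ∑ i, p i = 1 := by
    have := hXh.trace_eq_sum_eigenvalues
    rw [hX1] at this
    have h2 : ((∑ i, p i : ℝ) : ℂ) = 1 := by
      push_cast
      exact this.symm
    exact_mod_cast h2
  have hker : LinearMap.ker (Matrix.toLin' Y) ≤ LinearMap.ker (Matrix.toLin' X) ↔
      ∀ i j, r j = 0 → p i * ‖W i j‖ ^ 2 = 0 := by
    constructor
    · intro hle i j hj
      have hx : V.col j ∈ LinearMap.ker (Matrix.toLin' Y) := by
        rw [LinearMap.mem_ker, Matrix.toLin'_apply]
        have : (Y * V).col j = 0 := by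
          rw [hYs, Matrix.mul_assoc, hVV, Matrix.mul_one]
          ext k
          simp [hj]
        rw [← this]
        ext k
        simp [Matrix.mulVec, Matrix.mul_apply, dotProduct]
      have hx2 := hle hx
      rw [LinearMap.mem_ker, Matrix.toLin'_apply] at hx2
      have h3 : (star U * (X * V)) i j = 0 := by
        have : ∀ k, (X * V) k j = 0 := by
          intro k
          have := congrFun hx2 k
          simpa [Matrix.mulVec, Matrix.mul_apply, dotProduct] using this
        rw [Matrix.mul_apply]
        simp [this]
      have h4 : star U * (X * V) = diagonal (fun i => (p i : ℂ)) * W := by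
        rw [hXs, hW]
        simp only [← Matrix.mul_assoc]
        rw [hUU, Matrix.one_mul]
      rw [h4, Matrix.diagonal_mul] at h3
      rcases mul_eq_zero.1 h3 with h | h
      · have : p i = 0 := by exact_mod_cast h
        simp [this]
      · simp [h]
    · intro hall x hx
      rw [LinearMap.mem_ker, Matrix.toLin'_apply] at hx ⊢
      have hy : ∀ j, r j ≠ 0 → (star V *ᵥ x) j = 0 := by
        intro j hj
        have h1 : star V *ᵥ (Y *ᵥ x) = diagonal (fun i => (r i : ℂ)) *ᵥ (star V *ᵥ x) := by
          rw [Matrix.mulVec_mulVec, Matrix.mulVec_mulVec]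
          congr 1
          conv_lhs => rw [hYs]
          simp only [← Matrix.mul_assoc]
          rw [hVV, Matrix.one_mul]
        rw [hx, Matrix.mulVec_zero] at h1
        have h2 := congrFun h1 j
        rw [Matrix.mulVec_diagonal] at h2
        rcases mul_eq_zero.1 h2.symm with h | h
        · exact absurd (by exact_mod_cast h) hj
        · exact h
      have h1 : X *ᵥ x = U *ᵥ ((diagonal (fun i => (p i : ℂ)) * W) *ᵥ (star V *ᵥ x)) := by
        rw [Matrix.mulVec_mulVec, Matrix.mulVec_mulVec]
        congr 1
        conv_lhs => rw [hXs]
        rw [hW]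
        simp only [Matrix.mul_assoc]
        rw [hVV', Matrix.mul_one]
      have h2 : (diagonal (fun i => (p i : ℂ)) * W) *ᵥ (star V *ᵥ x) = 0 := by
        ext i
        rw [Matrix.mulVec, dotProduct, Pi.zero_apply]
        refine Finset.sum_eq_zero fun j _ => ?_
        rw [Matrix.diagonal_mul]
        by_cases hj : r j = 0
        · rcases mul_eq_zero.1 (hall i j hj) with h | h
          · simp [h]
          · have : W i j = 0 := by simpa using h
            simp [this]
        · rw [hy j hj, mul_zero]
      rw [h1, h2, Matrix.mulVec_zero]
  refine ⟨fun q => p q.1 * ‖W q.1 q.2‖ ^ 2, fun q => r q.2 / p q.1, ?_, ?_, ?_, ?_, ?_⟩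
  · exact fun q => mul_nonneg (hp0 _) (sq_nonneg _)
  · rw [Fintype.sum_prod_type]
    simp only [← Finset.mul_sum, sum_sq_row hWW, mul_one]
    exact hp1
  · exact fun q => div_nonneg (hr0 _) (hp0 _)
  · intro α hα
    rw [QRenyi, mpow, mpow, dif_pos hXh, dif_pos hYh, trace_diag]
    refine Finset.sum_congr rfl fun q _ => ?_
    change (if p q.1 = 0 then 0 else p q.1 ^ α) *
      (if r q.2 = 0 then 0 else r q.2 ^ (1 - α)) * ‖W q.1 q.2‖ ^ 2 =
      p q.1 * ‖W q.1 q.2‖ ^ 2 * (r q.2 / p q.1) ^ (1 - α)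
    have hα' : 1 - α ≠ 0 := by linarith
    by_cases h1 : p q.1 = 0
    · simp [h1]
    by_cases h2 : r q.2 = 0
    · simp [h2, Real.zero_rpow hα']
    rw [if_neg h1, if_neg h2, Real.div_rpow (hr0 _) (hp0 _)]
    have hpp : 0 < p q.1 := lt_of_le_of_ne (hp0 _) (Ne.symm h1)
    have e : p q.1 = p q.1 ^ α * p q.1 ^ (1 - α) := by
      rw [← Real.rpow_add hpp]; simp
    have hne : p q.1 ^ (1 - α) ≠ 0 := (Real.rpow_pos_of_pos hpp _).ne'
    rw [show p q.1 * ‖W q.1 q.2‖ ^ 2 * (r q.2 ^ (1 - α) / p q.1 ^ (1 - α)) =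
      (p q.1 ^ α * p q.1 ^ (1 - α)) * ‖W q.1 q.2‖ ^ 2 * (r q.2 ^ (1 - α) / p q.1 ^ (1 - α)) by
        rw [← e]]
    field_simp
  · have hiff : (∀ i j, r j = 0 → p i * ‖W i j‖ ^ 2 = 0) ↔
        (∀ q : n × n, r q.2 / p q.1 = 0 → p q.1 * ‖W q.1 q.2‖ ^ 2 = 0) := by
      constructor
      · intro h q hq
        rcases div_eq_zero_iff.1 hq with h1 | h1
        · exact h _ _ h1
        · simp [h1]
      · intro h i j hj
        exact h (i, j) (by simp [hj])
    rw [relEnt]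
    by_cases hk : LinearMap.ker (Matrix.toLin' Y) ≤ LinearMap.ker (Matrix.toLin' X)
    · rw [if_pos hk, if_pos (hiff.1 (hker.1 hk))]
      have hall := hker.1 hk
      congr 1
      rw [Matrix.mul_sub, Matrix.trace_sub, Complex.sub_re, mlog, mlog, dif_pos hXh, dif_pos hYh]
      have t1 := trace_diag U U p (fun i => Real.log (p i))
      have t2 := trace_diag U V p (fun i => Real.log (r i))
      rw [← hXs] at t1 t2
      have t1' : ∑ q : n × n, p q.1 * Real.log (p q.2) * ‖(star U * U) q.1 q.2‖ ^ 2 =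
          ∑ q : n × n, p q.1 * ‖W q.1 q.2‖ ^ 2 * Real.log (p q.1) := by
        rw [Fintype.sum_prod_type, Fintype.sum_prod_type, hUU]
        refine Finset.sum_congr rfl fun i _ => ?_
        have : ∀ j, p i * ‖W i j‖ ^ 2 * Real.log (p i) =
          (p i * Real.log (p i)) * ‖W i j‖ ^ 2 := fun j => by ring
        simp only [this, ← Finset.mul_sum, sum_sq_row hWW, mul_one]
        rw [Finset.sum_eq_single i]
        · simp
        · intro j _ hj
          simp [Matrix.one_apply_ne (Ne.symm hj)]
        · simp
      rw [t1'] at t1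
      rw [← hW] at t2
      refine (congrArg₂ (· - ·) t1 t2).trans ?_
      simp only
      rw [← Finset.sum_sub_distrib, ← Finset.sum_neg_distrib]
      refine Finset.sum_congr rfl fun q _ => ?_
      by_cases h1 : p q.1 = 0
      · simp [h1]
      by_cases h2 : r q.2 = 0
      · have := hall q.1 q.2 h2
        rw [this, mul_right_comm, this]; simp
      rw [Real.log_div h2 h1]
      ring
    · rw [if_neg hk, if_neg (fun h => hk (hker.2 (hiff.2 h)))]

lemma lt_iff_Q {X Y : Matrix n n ℂ} (hX : X.PosSemidef) (hX1 : X.trace = 1)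
    (hY : Y.PosSemidef) {α : ℝ} (hα : α < 1) (c : ℝ) :
    (c : EReal) < DRenyi α X Y ↔ QRenyi α X Y < Real.exp (-((1 - α) * c)) := by
  obtain ⟨w, z, hw, -, hz, hQ, -⟩ := exists_NS hX hX1 hY
  have hQ0 : 0 ≤ QRenyi α X Y := by
    rw [hQ α hα]
    exact Finset.sum_nonneg fun i _ => mul_nonneg (hw i) (Real.rpow_nonneg (hz i) _)
  rw [DRenyi]
  split_ifs with h
  · simp [h, Real.exp_pos, EReal.coe_lt_top]
  · have hpos : 0 < QRenyi α X Y := lt_of_le_of_ne hQ0 (Ne.symm h)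
    rw [EReal.coe_lt_coe_iff, ← Real.log_lt_iff_lt_exp hpos]
    have hs : 0 < 1 - α := by linarith
    rw [show (α - 1)⁻¹ * Real.log (QRenyi α X Y) = (- Real.log (QRenyi α X Y)) / (1 - α) by
      rw [show α - 1 = -(1 - α) by ring, inv_neg]; field_simp, lt_div_iff₀ hs]
    constructor <;> intro h <;> linarith

lemma DRenyi_le_relEnt {X Y : Matrix n n ℂ} (hX : X.PosSemidef) (hX1 : X.trace = 1)
    (hY : Y.PosSemidef) {α : ℝ} (hα : α < 1) : DRenyi α X Y ≤ relEnt X Y := by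
  classical
  obtain ⟨w, z, hw, hw1, hz, hQ, hD⟩ := exists_NS hX hX1 hY
  rw [hD]
  split_ifs with h
  · by_contra hcon
    rw [not_le, lt_iff_Q hX hX1 hY hα, hQ α hα] at hcon
    have := scalar_jensen w z hw hw1 hz h (1 - α)
    rw [mul_neg, neg_neg] at hcon
    linarith
  · exact le_top

lemma exists_lt_DRenyi {X Y : Matrix n n ℂ} (hX : X.PosSemidef) (hX1 : X.trace = 1)
    (hY : Y.PosSemidef) {c : ℝ} (hc : (c : EReal) < relEnt X Y) :
    ∃ α : ℝ, 0 < α ∧ α < 1 ∧ (c : EReal) < DRenyi α X Y := by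
  classical
  obtain ⟨w, z, hw, hw1, hz, hQ, hD⟩ := exists_NS hX hX1 hY
  obtain ⟨s, hs, hs1, h⟩ := scalar_exists w z hw hw1 hz c (fun h => by
    rw [hD, if_pos h] at hc
    exact_mod_cast hc)
  refine ⟨1 - s, by linarith, by linarith, ?_⟩
  rw [lt_iff_Q hX hX1 hY (by linarith), hQ _ (by linarith), sub_sub_cancel]
  exact h

lemma lt_DRenyi_mono {X Y : Matrix n n ℂ} (hX : X.PosSemidef) (hX1 : X.trace = 1)
    (hY : Y.PosSemidef) {c α β : ℝ} (hαβ : α ≤ β) (hβ : β < 1)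
    (hc : (c : EReal) < DRenyi α X Y) : (c : EReal) < DRenyi β X Y := by
  obtain ⟨w, z, hw, hw1, hz, hQ, -⟩ := exists_NS hX hX1 hY
  have hα : α < 1 := by linarith
  rw [lt_iff_Q hX hX1 hY hα, hQ _ hα] at hc
  rw [lt_iff_Q hX hX1 hY hβ, hQ _ hβ]
  exact scalar_lt_mono w z hw hw1 hz (by linarith) (by linarith) hc

/-- The set of density matrices. -/
def states (n : Type*) [Fintype n] [DecidableEq n] : Set (Matrix n n ℂ) :=
  {X | X.PosSemidef ∧ X.trace = 1}

lemma eig_mem {X : Matrix n n ℂ} (hX : X ∈ states n) (i : n) :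
    hX.1.isHermitian.eigenvalues i ∈ Set.Icc (0:ℝ) 1 := by
  refine ⟨hX.1.eigenvalues_nonneg i, ?_⟩
  have := hX.2.symm.trans hX.1.isHermitian.trace_eq_sum_eigenvalues
  have h2 : ((∑ i, hX.1.isHermitian.eigenvalues i : ℝ) : ℂ) = 1 := by
    push_cast
    exact this.symm
  have h3 : ∑ i, hX.1.isHermitian.eigenvalues i = 1 := by exact_mod_cast h2
  rw [← h3]
  exact Finset.single_le_sum (f := hX.1.isHermitian.eigenvalues)
    (fun j _ => hX.1.eigenvalues_nonneg j) (Finset.mem_univ i)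

lemma mpow_eq_cfc {X : Matrix n n ℂ} (hX : X.IsHermitian) {α : ℝ} (hα : 0 < α) :
    mpow X α = cfc (fun x : ℝ => x ^ α) X := by
  rw [mpow, dif_pos hX, hX.cfc_eq, Matrix.IsHermitian.cfc, Unitary.conjStarAlgAut_apply]
  congr 3
  ext i
  by_cases h : hX.eigenvalues i = 0
  · simp [h, Real.zero_rpow hα.ne']
  · simp [h]

open scoped Matrix.Norms.L2Operator in
lemma continuousOn_mpow {α : ℝ} (hα : 0 < α) :
    ContinuousOn (fun X : Matrix n n ℂ => mpow X α) (states n) := by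
  have h : ContinuousOn (cfc (fun x : ℝ => x ^ α))
      {a : Matrix n n ℂ | IsSelfAdjoint a ∧ spectrum ℝ a ⊆ Set.Icc (0:ℝ) 1} :=
    continuousOn_cfc (Matrix n n ℂ) isCompact_Icc _
      (Real.continuous_rpow_const hα.le).continuousOn
  refine (h.mono ?_).congr (fun X hX => mpow_eq_cfc hX.1.isHermitian hα)
  intro X hX
  refine ⟨hX.1.isHermitian, ?_⟩
  rw [hX.1.isHermitian.spectrum_real_eq_range_eigenvalues]
  rintro _ ⟨i, rfl⟩
  exact eig_mem hX i

lemma continuousOn_Q (Y : Matrix n n ℂ) {α : ℝ} (hα : 0 < α) :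
    ContinuousOn (fun X : Matrix n n ℂ => QRenyi α X Y) (states n) := by
  have h := continuousOn_mpow (n := n) hα
  have h2 : Continuous (fun M : Matrix n n ℂ => ((M * mpow Y (1 - α)).trace).re) := by
    fun_prop
  exact h2.comp_continuousOn h

lemma isCompact_states : IsCompact (states n) := by
  have hsub : states n ⊆ Set.pi Set.univ
      (fun _ : n => Set.pi Set.univ (fun _ : n => Metric.closedBall (0:ℂ) (Fintype.card n))) := by
    intro X hX i _ j _
    rw [mem_closedBall_zero_iff]
    have hs := spectral hX.1.isHermitian
    rw [hs, Matrix.mul_apply]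
    refine (norm_sum_le _ _).trans ?_
    rw [show (Fintype.card n : ℝ) = ∑ _k : n, (1:ℝ) by simp]
    refine Finset.sum_le_sum fun k _ => ?_
    rw [Matrix.mul_diagonal, norm_mul, norm_mul, Matrix.star_apply, norm_star]
    have h1 := entry_norm_bound_of_unitary hX.1.isHermitian.eigenvectorUnitary.2 i k
    have h2 := entry_norm_bound_of_unitary hX.1.isHermitian.eigenvectorUnitary.2 j k
    have h3 := eig_mem hX k
    have h4 : ‖((hX.1.isHermitian.eigenvalues k : ℝ) : ℂ)‖ ≤ 1 := by
      rw [Complex.norm_real, Real.norm_of_nonneg h3.1]; exact h3.2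
    exact mul_le_one₀ (mul_le_one₀ h1 (norm_nonneg _) h4) (norm_nonneg _) h2
  have hcl : IsClosed (states n) := by
    have e : states n = {X : Matrix n n ℂ | Xᴴ = X} ∩
        ({X | ∀ x : n → ℂ, 0 ≤ star x ⬝ᵥ (X *ᵥ x)} ∩ {X | X.trace = 1}) := by
      ext X
      simp only [states, Set.mem_ofPred_eq, Set.mem_inter_iff,
        Matrix.posSemidef_iff_dotProduct_mulVec, Matrix.IsHermitian]
      tauto
    rw [e]
    refine IsClosed.inter (isClosed_eq (by fun_prop) continuous_id) (IsClosed.inter ?_ ?_)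
    · simp only [Set.ofPred_forall]
      refine isClosed_iInter fun x => isClosed_le continuous_const ?_
      fun_prop
    · exact isClosed_eq (by fun_prop) continuous_const
  refine IsCompact.of_isClosed_subset ?_ hcl hsub
  exact isCompact_univ_pi fun _ => isCompact_univ_pi fun _ => isCompact_closedBall _ _

end Mat

section Main

open Matrix

variable {A B : Type*} [Fintype A] [DecidableEq A] [Fintype B] [DecidableEq B]

lemma kron_mem {σ : Matrix A A ℂ} {τ : Matrix B B ℂ} (hσ : σ ∈ states A) (hτ : τ ∈ states B) :
    σ ⊗ₖ τ ∈ states (A × B) := by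
  refine ⟨hσ.1.kronecker hτ.1, ?_⟩
  rw [Matrix.trace_kronecker, hσ.2, hτ.2, one_mul]

lemma continuous_kron :
    Continuous (fun x : Matrix A A ℂ × Matrix B B ℂ => x.1 ⊗ₖ x.2) := by
  refine continuous_matrix fun i j => ?_
  simp only [Matrix.kroneckerMap_apply]
  fun_prop

lemma eventually_forall (ρ : MState (A × B)) {c : ℝ} (hc : (c : EReal) < Tum ρ.mat) :
    ∀ᶠ α in nhdsWithin (1:ℝ) (Set.Ioo 0 1), ∀ x ∈ states A ×ˢ states B,
      (c : EReal) < DRenyi α (x.1 ⊗ₖ x.2) ρ.mat := by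
  have hK : IsCompact (states A ×ˢ states B) := isCompact_states.prod isCompact_states
  refine hK.induction_on (p := fun S => ∀ᶠ α in nhdsWithin (1:ℝ) (Set.Ioo 0 1),
    ∀ x ∈ S, x ∈ states A ×ˢ states B → (c : EReal) < DRenyi α (x.1 ⊗ₖ x.2) ρ.mat)
    ?_ ?_ ?_ ?_ |>.mono fun α h x hx => h x hx hx
  · simp
  · intro S T hST hT
    exact hT.mono fun α h x hx => h x (hST hx)
  · intro S T hS hT
    filter_upwards [hS, hT] with α h1 h2 x hx
    exact hx.elim (h1 x) (h2 x)
  · intro x hx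
    have hkx := kron_mem hx.1 hx.2
    have hcx : (c : EReal) < relEnt (x.1 ⊗ₖ x.2) ρ.mat := by
      refine hc.trans_le ?_
      rw [Tum]
      exact (iInf_le _ (MState.mk x.1 hx.1.1 hx.1.2)).trans
        (iInf_le _ (MState.mk x.2 hx.2.1 hx.2.2))
    obtain ⟨β, hβ0, hβ1, hβ⟩ := exists_lt_DRenyi hkx.1 hkx.2 ρ.posSemidef hcx
    rw [lt_iff_Q hkx.1 hkx.2 ρ.posSemidef hβ1] at hβ
    have hcont : ContinuousOn
        (fun y : Matrix A A ℂ × Matrix B B ℂ => QRenyi β (y.1 ⊗ₖ y.2) ρ.mat)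
        (states A ×ˢ states B) :=
      (continuousOn_Q ρ.mat hβ0).comp continuous_kron.continuousOn
        (fun y hy => kron_mem hy.1 hy.2)
    have hev := (hcont x hx).eventually (gt_mem_nhds hβ)
    refine ⟨_, hev, ?_⟩
    have hβα : ∀ᶠ α in nhdsWithin (1:ℝ) (Set.Ioo 0 1), β < α :=
      nhdsWithin_le_nhds (lt_mem_nhds hβ1)
    filter_upwards [hβα, self_mem_nhdsWithin] with α hα hα1 y hy hyK
    have hky := kron_mem hyK.1 hyK.2
    exact lt_DRenyi_mono hky.1 hky.2 ρ.posSemidef hα.le hα1.2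
      ((lt_iff_Q hky.1 hky.2 ρ.posSemidef hβ1 c).2 hy)

end Main

end LddAux

/-- The doubly minimized Petz Rényi lautum information tends to the tumula information
as the order tends to `1` from the left within `(0,1)`. -/
theorem Ldd_tendsto_Tum {A B : Type*} [Fintype A] [DecidableEq A] [Nonempty A]
    [Fintype B] [DecidableEq B] [Nonempty B] (ρ : MState (A × B)) :
    Filter.Tendsto (fun α : ℝ => Ldd α ρ.mat)
      (nhdsWithin 1 (Set.Ioo (0 : ℝ) 1)) (nhds (Tum ρ.mat)) := by
  refine tendsto_order.2 ⟨fun a ha => ?_, fun a ha => ?_⟩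
  · obtain ⟨c, hac, hc⟩ := EReal.lt_iff_exists_real_btwn.1 ha
    filter_upwards [LddAux.eventually_forall ρ hc] with α h
    refine hac.trans_le (le_iInf₂ fun σ τ => ?_)
    exact (h (σ.mat, τ.mat) ⟨⟨σ.posSemidef, σ.trace_one⟩, ⟨τ.posSemidef, τ.trace_one⟩⟩).le
  · filter_upwards [self_mem_nhdsWithin] with α hα
    refine lt_of_le_of_lt (iInf₂_mono fun σ τ => ?_) ha
    have hk := LddAux.kron_mem (σ := σ.mat) (τ := τ.mat)
      ⟨σ.posSemidef, σ.trace_one⟩ ⟨τ.posSemidef, τ.trace_one⟩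
    exact LddAux.DRenyi_le_relEnt hk.1 hk.2 ρ.posSemidef hα.2

end
end

section
/- Faithfulness of the doubly minimized Petz Rényi lautum information (Theorem 1(n)): Let A and B be nonempty finite types, α ∈ (0,1), and ρ_AB a bipartite state on A × B with marginals ρ_A (partial trace over B) and ρ_B (partial trace over A). Then L_α^↓↓(A:B)_ρ = 0 if and only if ρ_AB = ρ_A ⊗ ρ_B (the Kronecker product of its marginals). -/
open scoped BigOperators Kronecker ComplexOrder

noncomputable section

namespace LddProof

lemma young_refined (α a b : ℝ) (h0 : 0 < α) (h1 : α < 1) (ha : 0 ≤ a) (hb : 0 ≤ b) :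
    min α (1 - α) * (√a - √b) ^ 2 ≤ α * a + (1 - α) * b - a ^ α * b ^ (1 - α) := by
  have key : ∀ (α a b : ℝ), 0 < α → α ≤ 1 / 2 → 0 ≤ a → 0 ≤ b →
      α * (√a - √b) ^ 2 ≤ α * a + (1 - α) * b - a ^ α * b ^ (1 - α) := by
    intro α a b h0 h1 ha hb
    have h := Real.geom_mean_le_arith_mean2_weighted (w₁ := 2 * α) (w₂ := 1 - 2 * α)
      (p₁ := √a * √b) (p₂ := b) (by linarith) (by linarith) (by positivity) hb (by ring)
    have e : (√a * √b) ^ (2 * α) * b ^ (1 - 2 * α) = a ^ α * b ^ (1 - α) := by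
      rw [Real.mul_rpow (by positivity) (by positivity), Real.rpow_mul (by positivity),
        Real.rpow_mul (by positivity), Real.rpow_two, Real.rpow_two, Real.sq_sqrt ha,
        Real.sq_sqrt hb, mul_assoc, ← Real.rpow_add' hb (by linarith)]
      congr 2; ring
    rw [e] at h
    have := Real.sq_sqrt ha
    have := Real.sq_sqrt hb
    nlinarith
  rcases le_total α (1 / 2) with h | h
  · rw [min_eq_left (by linarith)]
    exact key α a b h0 h ha hb
  · rw [min_eq_right (by linarith)]
    have := key (1 - α) b a (by linarith) (by linarith) hb ha
    have e : 1 - (1 - α) = α := by ring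
    rw [e] at this
    nlinarith

lemma sq_sub_le (a b : ℝ) (ha : 0 ≤ a) (hb : 0 ≤ b) (ha' : a ≤ 1) (hb' : b ≤ 1) :
    (a - b) ^ 2 ≤ 4 * (√a - √b) ^ 2 := by
  have h1 := Real.sq_sqrt ha
  have h2 := Real.sq_sqrt hb
  have h3 := Real.sqrt_nonneg a
  have h4 := Real.sqrt_nonneg b
  have h5 : √a ≤ 1 := Real.sqrt_le_one.mpr ha'
  have h6 : √b ≤ 1 := Real.sqrt_le_one.mpr hb'
  have e : a - b = (√a - √b) * (√a + √b) := by nlinarith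
  rw [e, mul_pow]
  have : (√a + √b) ^ 2 ≤ 4 := by nlinarith
  nlinarith [sq_nonneg (√a - √b)]

variable {n : Type*} [Fintype n] [DecidableEq n]

lemma trace_formula (U V : Matrix n n ℂ) (a b : n → ℝ) :
    ((U * Matrix.diagonal (fun i => (a i : ℂ)) * star U) *
      (V * Matrix.diagonal (fun i => (b i : ℂ)) * star V)).trace.re
    = ∑ i, ∑ j, Complex.normSq ((star U * V) i j) * (a i * b j) := by
  have e : ((U * Matrix.diagonal (fun i => (a i : ℂ)) * star U) *
      (V * Matrix.diagonal (fun i => (b i : ℂ)) * star V)).trace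
      = (Matrix.diagonal (fun i => (a i : ℂ)) * (star U * V) *
        (Matrix.diagonal (fun i => (b i : ℂ)) * star (star U * V))).trace := by
    rw [star_mul, star_star]
    rw [show (U * Matrix.diagonal (fun i => (a i : ℂ)) * star U) *
      (V * Matrix.diagonal (fun i => (b i : ℂ)) * star V) =
      U * (Matrix.diagonal (fun i => (a i : ℂ)) * star U *
      (V * Matrix.diagonal (fun i => (b i : ℂ)) * star V)) by simp only [mul_assoc],
      Matrix.trace_mul_comm]
    simp only [mul_assoc]
  rw [e]
  generalize star U * V = W
  simp only [Matrix.trace, Matrix.diag_apply, Matrix.mul_apply (M := Matrix.diagonal _ * W),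
    Matrix.diagonal_mul, Complex.re_sum, Matrix.star_apply]
  refine Finset.sum_congr rfl fun i _ => Finset.sum_congr rfl fun j _ => ?_
  simp [Complex.normSq_apply]
  ring

lemma row_sum (W : Matrix n n ℂ) (h : W * star W = 1) (i : n) :
    ∑ j, Complex.normSq (W i j) = 1 := by
  have := congrFun (congrFun h i) i
  simp only [Matrix.mul_apply, Matrix.star_apply, Matrix.one_apply_eq, RCLike.star_def,
    Complex.mul_conj] at this
  exact_mod_cast this

lemma col_sum (W : Matrix n n ℂ) (h : star W * W = 1) (j : n) :
    ∑ i, Complex.normSq (W i j) = 1 := by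
  have := congrFun (congrFun h j) j
  simp only [Matrix.mul_apply, Matrix.star_apply, Matrix.one_apply_eq, RCLike.star_def,
    ← Complex.normSq_eq_conj_mul_self] at this
  exact_mod_cast this

lemma spec (X : Matrix n n ℂ) (h : X.IsHermitian) :
    X = (h.eigenvectorUnitary : Matrix n n ℂ) *
      Matrix.diagonal (fun i => (h.eigenvalues i : ℂ)) *
      star (h.eigenvectorUnitary : Matrix n n ℂ) := by
  conv_lhs => rw [h.spectral_theorem]
  rfl

lemma mpow_spec (X : Matrix n n ℂ) (h : X.IsHermitian) (p : ℝ) (hp : p ≠ 0) :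
    mpow X p = (h.eigenvectorUnitary : Matrix n n ℂ) *
      Matrix.diagonal (fun i => ((h.eigenvalues i ^ p : ℝ) : ℂ)) *
      star (h.eigenvectorUnitary : Matrix n n ℂ) := by
  rw [mpow, dif_pos h]
  congr 3
  funext i
  split_ifs with h0
  · rw [h0, Real.zero_rpow hp]
  · rfl

/-- the spectral overlap data of two states -/
lemma data (α : ℝ) (h0 : 0 < α) (h1 : α < 1) (X Y : MState n) :
    ∃ (w : n → n → ℝ) (a b : n → ℝ), (∀ i j, 0 ≤ w i j) ∧ (∀ i, ∑ j, w i j = 1) ∧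
      (∀ j, ∑ i, w i j = 1) ∧ (∀ i, 0 ≤ a i) ∧ (∀ i, 0 ≤ b i) ∧ (∑ i, a i = 1) ∧
      (∑ i, b i = 1) ∧
      QRenyi α X.mat Y.mat = ∑ i, ∑ j, w i j * (a i ^ α * b j ^ (1 - α)) ∧
      ∑ k, ∑ l, Complex.normSq ((X.mat - Y.mat) k l) =
        ∑ i, ∑ j, w i j * (a i - b j) ^ 2 := by
  have hX := X.posSemidef.isHermitian
  have hY := Y.posSemidef.isHermitian
  set U : Matrix n n ℂ := (hX.eigenvectorUnitary : Matrix n n ℂ) with hU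
  set V : Matrix n n ℂ := (hY.eigenvectorUnitary : Matrix n n ℂ) with hV
  have u1 : star U * U = 1 := Unitary.coe_star_mul_self hX.eigenvectorUnitary
  have u2 : U * star U = 1 := Unitary.coe_mul_star_self hX.eigenvectorUnitary
  have v1 : star V * V = 1 := Unitary.coe_star_mul_self hY.eigenvectorUnitary
  have v2 : V * star V = 1 := Unitary.coe_mul_star_self hY.eigenvectorUnitary
  have w1 : (star U * V) * star (star U * V) = 1 := by
    rw [star_mul, star_star, mul_assoc, ← mul_assoc V, v2, one_mul, u1]
  have w2 : star (star U * V) * (star U * V) = 1 := by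
    rw [star_mul, star_star, mul_assoc, ← mul_assoc U, u2, one_mul, v1]
  have r := row_sum _ w1
  have c := col_sum _ w2
  have sX : ∑ i, hX.eigenvalues i = 1 := by
    have := X.trace_one
    rw [hX.trace_eq_sum_eigenvalues] at this
    have h2 := congrArg Complex.re this
    simpa using h2
  have sY : ∑ i, hY.eigenvalues i = 1 := by
    have := Y.trace_one
    rw [hY.trace_eq_sum_eigenvalues] at this
    have h2 := congrArg Complex.re this
    simpa using h2
  refine ⟨fun i j => Complex.normSq ((star U * V) i j), hX.eigenvalues, hY.eigenvalues,
    fun i j => Complex.normSq_nonneg _, r, c, X.posSemidef.eigenvalues_nonneg,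
    Y.posSemidef.eigenvalues_nonneg, sX, sY, ?_, ?_⟩
  · rw [QRenyi, mpow_spec _ hX α h0.ne', mpow_spec _ hY (1 - α) (by linarith)]
    exact trace_formula U V _ _
  · have eXX : (X.mat * X.mat).trace.re = ∑ i, hX.eigenvalues i ^ 2 := by
      conv_lhs => rw [spec X.mat hX]
      rw [trace_formula, u1]
      refine Finset.sum_congr rfl fun i _ => ?_
      rw [Finset.sum_eq_single i]
      · simp [sq]
      · intro j _ hj
        simp [Matrix.one_apply_ne hj.symm]
      · simp
    have eYY : (Y.mat * Y.mat).trace.re = ∑ i, hY.eigenvalues i ^ 2 := by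
      conv_lhs => rw [spec Y.mat hY]
      rw [trace_formula, v1]
      refine Finset.sum_congr rfl fun i _ => ?_
      rw [Finset.sum_eq_single i]
      · simp [sq]
      · intro j _ hj
        simp [Matrix.one_apply_ne hj.symm]
      · simp
    have eXY : (X.mat * Y.mat).trace.re = ∑ i, ∑ j,
        Complex.normSq ((star U * V) i j) * (hX.eigenvalues i * hY.eigenvalues j) := by
      conv_lhs => rw [spec X.mat hX, spec Y.mat hY]
      exact trace_formula U V _ _
    have hs : (X.mat - Y.mat).IsHermitian := hX.sub hY
    have e1 : ∑ k, ∑ l, Complex.normSq ((X.mat - Y.mat) k l) =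
        ((X.mat - Y.mat) * (X.mat - Y.mat)).trace.re := by
      conv_rhs => arg 1; arg 1; arg 2; rw [← hs.eq]
      simp only [Matrix.trace, Matrix.diag_apply, Matrix.mul_apply, Matrix.conjTranspose_apply,
        Complex.re_sum, RCLike.star_def, Complex.mul_conj, Complex.ofReal_re]
    have e2 : ((X.mat - Y.mat) * (X.mat - Y.mat)).trace.re =
        (X.mat * X.mat).trace.re + (Y.mat * Y.mat).trace.re - 2 * (X.mat * Y.mat).trace.re := by
      rw [sub_mul, mul_sub, mul_sub, Matrix.trace_sub, Matrix.trace_sub, Matrix.trace_sub,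
        Matrix.trace_mul_comm Y.mat X.mat]
      simp only [Complex.sub_re]
      ring
    rw [e1, e2, eXX, eYY, eXY]
    have f1 : ∑ i, hX.eigenvalues i ^ 2 = ∑ i, ∑ j,
        Complex.normSq ((star U * V) i j) * hX.eigenvalues i ^ 2 := by
      refine Finset.sum_congr rfl fun i _ => ?_
      rw [← Finset.sum_mul, r, one_mul]
    have f2 : ∑ i, hY.eigenvalues i ^ 2 = ∑ i, ∑ j,
        Complex.normSq ((star U * V) i j) * hY.eigenvalues j ^ 2 := by
      rw [Finset.sum_comm]
      refine Finset.sum_congr rfl fun i _ => ?_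
      rw [← Finset.sum_mul, c, one_mul]
    rw [f1, f2]
    simp only [Finset.mul_sum, ← Finset.sum_add_distrib, ← Finset.sum_sub_distrib]
    refine Finset.sum_congr rfl fun i _ => Finset.sum_congr rfl fun j _ => ?_
    ring

lemma QRenyi_nonneg (α : ℝ) (h0 : 0 < α) (h1 : α < 1) (X Y : MState n) :
    0 ≤ QRenyi α X.mat Y.mat := by
  obtain ⟨w, a, b, hw, r, c, ha, hb, sa, sb, hQ, -⟩ := data α h0 h1 X Y
  rw [hQ]
  exact Finset.sum_nonneg fun i _ => Finset.sum_nonneg fun j _ => mul_nonneg (hw i j)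
    (mul_nonneg (Real.rpow_nonneg (ha i) _) (Real.rpow_nonneg (hb j) _))

lemma main_bound (α : ℝ) (h0 : 0 < α) (h1 : α < 1) (X Y : MState n) :
    min α (1 - α) / 4 * ∑ k, ∑ l, Complex.normSq ((X.mat - Y.mat) k l) ≤
      1 - QRenyi α X.mat Y.mat := by
  obtain ⟨w, a, b, hw, r, c, ha, hb, sa, sb, hQ, hD⟩ := data α h0 h1 X Y
  rw [hQ, hD]
  have ha1 : ∀ i, a i ≤ 1 := fun i => sa ▸
    Finset.single_le_sum (fun j _ => ha j) (Finset.mem_univ i)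
  have hb1 : ∀ i, b i ≤ 1 := fun i => sb ▸
    Finset.single_le_sum (fun j _ => hb j) (Finset.mem_univ i)
  have e : (1 : ℝ) = ∑ i, ∑ j, w i j * (α * a i + (1 - α) * b j) := by
    have f1 : ∑ i, ∑ j, w i j * (α * a i) = α := by
      simp only [← Finset.sum_mul, r, one_mul, ← Finset.mul_sum, sa, mul_one]
    have f2 : ∑ i, ∑ j, w i j * ((1 - α) * b j) = 1 - α := by
      rw [Finset.sum_comm]
      simp only [← Finset.sum_mul, c, one_mul, ← Finset.mul_sum, sb, mul_one]
    simp only [mul_add, Finset.sum_add_distrib, f1, f2]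
    ring
  have e2 : 1 - ∑ i, ∑ j, w i j * (a i ^ α * b j ^ (1 - α)) =
      ∑ i, ∑ j, w i j * (α * a i + (1 - α) * b j - a i ^ α * b j ^ (1 - α)) := by
    simp only [mul_sub, Finset.sum_sub_distrib]
    rw [← e]
  rw [e2, Finset.mul_sum]
  refine Finset.sum_le_sum fun i _ => ?_
  rw [Finset.mul_sum]
  refine Finset.sum_le_sum fun j _ => ?_
  have y := young_refined α (a i) (b j) h0 h1 (ha i) (hb j)
  have s := sq_sub_le (a i) (b j) (ha i) (hb j) (ha1 i) (hb1 j)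
  have m : 0 < min α (1 - α) := lt_min h0 (by linarith)
  have : min α (1 - α) / 4 * (a i - b j) ^ 2 ≤
      α * a i + (1 - α) * b j - a i ^ α * b j ^ (1 - α) := by nlinarith
  calc _ = w i j * (min α (1 - α) / 4 * (a i - b j) ^ 2) := by ring
    _ ≤ _ := mul_le_mul_of_nonneg_left this (hw i j)

lemma QRenyi_le_one (α : ℝ) (h0 : 0 < α) (h1 : α < 1) (X Y : MState n) :
    QRenyi α X.mat Y.mat ≤ 1 := by
  have := main_bound α h0 h1 X Y
  have m : 0 < min α (1 - α) := lt_min h0 (by linarith)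
  have : 0 ≤ min α (1 - α) / 4 * ∑ k, ∑ l, Complex.normSq ((X.mat - Y.mat) k l) :=
    mul_nonneg (by positivity) (Finset.sum_nonneg fun i _ => Finset.sum_nonneg fun j _ =>
      Complex.normSq_nonneg _)
  linarith

lemma QRenyi_self (α : ℝ) (h0 : 0 < α) (h1 : α < 1) (X : MState n) :
    QRenyi α X.mat X.mat = 1 := by
  have hX := X.posSemidef.isHermitian
  have u1 : star (hX.eigenvectorUnitary : Matrix n n ℂ) * hX.eigenvectorUnitary = 1 :=
    Unitary.coe_star_mul_self hX.eigenvectorUnitary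
  have sX : ∑ i, hX.eigenvalues i = 1 := by
    have := X.trace_one
    rw [hX.trace_eq_sum_eigenvalues] at this
    have h2 := congrArg Complex.re this
    simpa using h2
  rw [QRenyi, mpow_spec _ hX α h0.ne', mpow_spec _ hX (1 - α) (by linarith), trace_formula, u1]
  refine Eq.trans ?_ sX
  refine Finset.sum_congr rfl fun i _ => ?_
  rw [Finset.sum_eq_single i]
  · rw [← Real.rpow_add' (X.posSemidef.eigenvalues_nonneg i) (by norm_num)]
    simp
  · intro j _ hj
    simp [Matrix.one_apply_ne hj.symm]
  · simp

lemma DRenyi_nonneg (α : ℝ) (h0 : 0 < α) (h1 : α < 1) (X Y : MState n) :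
    0 ≤ DRenyi α X.mat Y.mat := by
  rw [DRenyi]
  split_ifs
  · exact le_top
  · have : 0 ≤ (α - 1)⁻¹ * Real.log (QRenyi α X.mat Y.mat) :=
      mul_nonneg_of_nonpos_of_nonpos (inv_nonpos.mpr (by linarith))
        (Real.log_nonpos (QRenyi_nonneg α h0 h1 X Y) (QRenyi_le_one α h0 h1 X Y))
    exact_mod_cast this

lemma bound_of_DRenyi_lt (α : ℝ) (h0 : 0 < α) (h1 : α < 1) (X Y : MState n) (ε : ℝ)
    (h : DRenyi α X.mat Y.mat < (ε : EReal)) : 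
    min α (1 - α) / 4 * ∑ k, ∑ l, Complex.normSq ((X.mat - Y.mat) k l) ≤ (1 - α) * ε := by
  rw [DRenyi] at h
  split_ifs at h with hQ
  · exact absurd h (by simp)
  · have hpos := lt_of_le_of_ne (QRenyi_nonneg α h0 h1 X Y) (Ne.symm hQ)
    have h' : (α - 1)⁻¹ * Real.log (QRenyi α X.mat Y.mat) < ε := by exact_mod_cast h
    have hl := Real.log_le_sub_one_of_pos hpos
    have hb := main_bound α h0 h1 X Y
    have e : -Real.log (QRenyi α X.mat Y.mat) =
        (1 - α) * ((α - 1)⁻¹ * Real.log (QRenyi α X.mat Y.mat)) := by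
      have : α - 1 ≠ 0 := by linarith
      field_simp
      ring
    have : (1 - α) * ((α - 1)⁻¹ * Real.log (QRenyi α X.mat Y.mat)) ≤ (1 - α) * ε :=
      mul_le_mul_of_nonneg_left h'.le (by linarith)
    linarith

variable {A B : Type*} [Fintype A] [DecidableEq A] [Fintype B] [DecidableEq B]

/-- product state -/
def kron (σ : MState A) (τ : MState B) : MState (A × B) where
  mat := σ.mat ⊗ₖ τ.mat
  posSemidef := σ.posSemidef.kronecker τ.posSemidef
  trace_one := by rw [Matrix.trace_kronecker, σ.trace_one, τ.trace_one, one_mul]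

lemma ptrA_kron (σ : MState A) (τ : MState B) : ptrA (σ.mat ⊗ₖ τ.mat) = τ.mat := by
  ext b b'
  have := σ.trace_one
  simp only [Matrix.trace, Matrix.diag_apply] at this
  simp [ptrA, ← Finset.sum_mul, this]

lemma ptrB_kron (σ : MState A) (τ : MState B) : ptrB (σ.mat ⊗ₖ τ.mat) = σ.mat := by
  ext b b'
  have := τ.trace_one
  simp only [Matrix.trace, Matrix.diag_apply] at this
  simp [ptrB, ← Finset.mul_sum, this]

/-- marginal -/
def margA (ρ : MState (A × B)) : MState A where
  mat := ptrB ρ.mat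
  posSemidef := by
    have : ptrB ρ.mat = ∑ b, ρ.mat.submatrix (fun a => (a, b)) (fun a => (a, b)) := by
      ext a a'
      simp [ptrB, Matrix.sum_apply]
    rw [this]
    exact Matrix.posSemidef_sum _ fun b _ => ρ.posSemidef.submatrix _
  trace_one := by
    rw [← ρ.trace_one]
    simp [Matrix.trace, ptrB, Fintype.sum_prod_type]

/-- marginal -/
def margB (ρ : MState (A × B)) : MState B where
  mat := ptrA ρ.mat
  posSemidef := by
    have : ptrA ρ.mat = ∑ a, ρ.mat.submatrix (fun b => (a, b)) (fun b => (a, b)) := by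
      ext a a'
      simp [ptrA, Matrix.sum_apply]
    rw [this]
    exact Matrix.posSemidef_sum _ fun b _ => ρ.posSemidef.submatrix _
  trace_one := by
    rw [← ρ.trace_one]
    simp [Matrix.trace, ptrA, Fintype.sum_prod_type_right]

lemma closed_prod : IsClosed {M : Matrix (A × B) (A × B) ℂ | M = ptrB M ⊗ₖ ptrA M} := by
  refine isClosed_eq continuous_id ?_
  refine continuous_pi fun x => continuous_pi fun y => ?_
  simp only [Matrix.kroneckerMap_apply, ptrA, ptrB, Matrix.of_apply]
  have (x y : A × B) : Continuous fun M : Matrix (A × B) (A × B) ℂ => M x y :=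
    (continuous_apply y).comp (continuous_apply x)
  exact (continuous_finsetSum _ fun _ _ => this _ _).mul
    (continuous_finsetSum _ fun _ _ => this _ _)

end LddProof

open LddProof in
/-- Faithfulness of the doubly minimized Petz Rényi lautum information (Theorem 1(n)):
it vanishes iff the state is the product of its marginals. -/
theorem Ldd_eq_zero_iff {A B : Type*} [Fintype A] [DecidableEq A] [Nonempty A]
    [Fintype B] [DecidableEq B] [Nonempty B]
    (α : ℝ) (hα : α ∈ Set.Ioo (0 : ℝ) 1) (ρ : MState (A × B)) :
    Ldd α ρ.mat = 0 ↔ ρ.mat = ptrB ρ.mat ⊗ₖ ptrA ρ.mat := by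
  obtain ⟨h0, h1⟩ := hα
  constructor
  · intro h
    set c : ℝ := min α (1 - α) / 4 with hc
    have cpos : 0 < c := by
      have : 0 < min α (1 - α) := lt_min h0 (by linarith)
      positivity
    have hex : ∀ m : ℕ, ∃ X : Matrix (A × B) (A × B) ℂ, X = ptrB X ⊗ₖ ptrA X ∧
        c * ∑ k, ∑ l, Complex.normSq ((X - ρ.mat) k l) ≤ (1 - α) * (1 / ((m : ℝ) + 1)) := by
      intro m
      have hlt : Ldd α ρ.mat < ((1 / ((m : ℝ) + 1) : ℝ) : EReal) := by
        rw [h]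
        have : (0 : ℝ) < 1 / ((m : ℝ) + 1) := by positivity
        exact_mod_cast this
      rw [Ldd, iInf_lt_iff] at hlt
      obtain ⟨σ, hlt⟩ := hlt
      rw [iInf_lt_iff] at hlt
      obtain ⟨τ, hlt⟩ := hlt
      refine ⟨σ.mat ⊗ₖ τ.mat, ?_, bound_of_DRenyi_lt α h0 h1 (kron σ τ) ρ _ hlt⟩
      rw [ptrA_kron, ptrB_kron]
    choose X hX1 hX2 using hex
    have ht : Filter.Tendsto X Filter.atTop (nhds ρ.mat) := by
      refine tendsto_pi_nhds.mpr fun k => tendsto_pi_nhds.mpr fun l => ?_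
      rw [tendsto_iff_norm_sub_tendsto_zero]
      have hsq : Filter.Tendsto (fun m => ‖X m k l - ρ.mat k l‖ ^ 2) Filter.atTop (nhds 0) := by
        have hz : Filter.Tendsto (fun m : ℕ => (1 - α) / c * (1 / ((m : ℝ) + 1)))
            Filter.atTop (nhds 0) := by
          simpa using (tendsto_one_div_add_atTop_nhds_zero_nat (𝕜 := ℝ)).const_mul ((1 - α) / c)
        refine squeeze_zero (fun m => by positivity) (fun m => ?_) hz
        have b1 : Complex.normSq ((X m - ρ.mat) k l) ≤
            ∑ k, ∑ l, Complex.normSq ((X m - ρ.mat) k l) :=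
          (Finset.single_le_sum (f := fun l => Complex.normSq ((X m - ρ.mat) k l))
            (fun j _ => Complex.normSq_nonneg _) (Finset.mem_univ l)).trans
          (Finset.single_le_sum (f := fun k => ∑ l, Complex.normSq ((X m - ρ.mat) k l))
            (fun j _ => Finset.sum_nonneg fun _ _ => Complex.normSq_nonneg _)
            (Finset.mem_univ k))
        rw [← Complex.normSq_eq_norm_sq, div_mul_eq_mul_div, le_div_iff₀ cpos, mul_comm]
        exact (mul_le_mul_of_nonneg_left b1 cpos.le).trans (hX2 m)
      have := hsq.sqrt
      simpa [Real.sqrt_sq (norm_nonneg _)] using this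
    exact closed_prod.mem_of_tendsto ht (Filter.Eventually.of_forall hX1)
  · intro h
    refine le_antisymm ?_ ?_
    · refine (iInf₂_le (margA ρ) (margB ρ)).trans ?_
      change DRenyi α (ptrB ρ.mat ⊗ₖ ptrA ρ.mat) ρ.mat ≤ 0
      rw [← h, DRenyi, QRenyi_self α h0 h1]
      simp
    · exact le_iInf₂ fun σ τ => DRenyi_nonneg α h0 h1 (kron σ τ) ρ

end
end
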